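/- Assume additionally that each λ_{ij} (j ≠ i) is differentiable on (0,∞). Let φ ∈ 𝓑 be the unique solution of the integral equation (IE). Then φ is of class C^{1,2,1} on D (once continuously differentiable in t, twice continuously differentiable in s, once continuously differentiable in y), and φ is a classical solution of the non-local degenerate parabolic terminal value problem (P): it satisfies the PDE at every point of D and φ(T,s,i,y) = K(s) for all s ∈ (0,∞), y ∈ [0,T], i ∈ χ. -/

import Mathlib

open MeasureTheory Real Filter Set

noncomputable def sumLam {k : ℕ} (lam : Fin k → Fin k → ℝ → ℝ) (i : Fin k) (y : ℝ) : ℝ :=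
  ∑ j ∈ Finset.univ.filter (fun j => j ≠ i), lam i j y

noncomputable def Lambda {k : ℕ} (lam : Fin k → Fin k → ℝ → ℝ) (i : Fin k) (y : ℝ) : ℝ :=
  ∫ v in (0:ℝ)..y, sumLam lam i v

noncomputable def Fcdf {k : ℕ} (lam : Fin k → Fin k → ℝ → ℝ) (i : Fin k) (y : ℝ) : ℝ :=
  1 - Real.exp (-(Lambda lam i y))

noncomputable def fdens {k : ℕ} (lam : Fin k → Fin k → ℝ → ℝ) (i : Fin k) (y : ℝ) : ℝ :=
  sumLam lam i y * Real.exp (-(Lambda lam i y))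

noncomputable def pMat {k : ℕ} (lam : Fin k → Fin k → ℝ → ℝ) (i j : Fin k) (y : ℝ) : ℝ :=
  if j = i then (if sumLam lam i y = 0 then 1 else 0)
  else (if sumLam lam i y = 0 then 0 else lam i j y / sumLam lam i y)

noncomputable def sigbar {k : ℕ} (σ : ℝ → Fin k → ℝ) (t : ℝ) (i : Fin k) (v : ℝ) : ℝ :=
  Real.sqrt (∫ u in t..(t+v), (σ u i)^2)

noncomputable def Lfun {k : ℕ} (r : Fin k → ℝ) (σ : ℝ → Fin k → ℝ)
    (t x s : ℝ) (i : Fin k) (v : ℝ) : ℝ :=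
  (Real.log (x / s) - ∫ u in t..(t+v), (r i - (σ u i)^2 / 2)) / sigbar σ t i v

noncomputable def alphaDens {k : ℕ} (r : Fin k → ℝ) (σ : ℝ → Fin k → ℝ)
    (x t s : ℝ) (i : Fin k) (v : ℝ) : ℝ :=
  Real.exp (-(Lfun r σ t x s i v)^2 / 2) / (Real.sqrt (2 * Real.pi) * x * sigbar σ t i v)

def memDbar (T t s y : ℝ) : Prop :=
  t ∈ Set.Icc 0 T ∧ s ∈ Set.Ici (0:ℝ) ∧ y ∈ Set.Icc 0 t

def memD (T t s y : ℝ) : Prop :=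
  t ∈ Set.Ioo 0 T ∧ s ∈ Set.Ioi (0:ℝ) ∧ y ∈ Set.Ioo 0 t

noncomputable def Aop {k : ℕ} (lam : Fin k → Fin k → ℝ → ℝ) (r : Fin k → ℝ)
    (σ : ℝ → Fin k → ℝ) (ρ : Fin k → ℝ → ℝ → ℝ) (T : ℝ)
    (φ : ℝ → ℝ → Fin k → ℝ → ℝ) (t s : ℝ) (i : Fin k) (y : ℝ) : ℝ :=
  (1 - Fcdf lam i (T - t + y)) / (1 - Fcdf lam i y) * ρ i t s
  + ∫ v in (0:ℝ)..(T - t),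
      Real.exp (-(r i * v)) * (fdens lam i (y + v) / (1 - Fcdf lam i y)) *
      ∑ j ∈ Finset.univ.filter (fun j => j ≠ i),
        pMat lam i j (y + v) *
        ∫ x in Set.Ioi (0:ℝ), φ (t + v) x j 0 * alphaDens r σ x t s i v

def memB {k : ℕ} (T : ℝ) (φ : ℝ → ℝ → Fin k → ℝ → ℝ) : Prop :=
  (∀ i : Fin k, ContinuousOn (fun p : ℝ × ℝ × ℝ => φ p.1 p.2.1 i p.2.2)
      {p : ℝ × ℝ × ℝ | memDbar T p.1 p.2.1 p.2.2}) ∧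
  ∃ M : ℝ, ∀ t s y : ℝ, memDbar T t s y → ∀ i : Fin k, |φ t s i y| ≤ M * (1 + s)

noncomputable def normB {k : ℕ} (T : ℝ) (φ : ℝ → ℝ → Fin k → ℝ → ℝ) : ℝ :=
  sSup {a : ℝ | ∃ t s y : ℝ, ∃ i : Fin k, memDbar T t s y ∧ a = |φ t s i y| / (1 + s)}

def isBSMSolution {k : ℕ} (r : Fin k → ℝ) (σ : ℝ → Fin k → ℝ) (K : ℝ → ℝ) (T : ℝ)
    (ρ : Fin k → ℝ → ℝ → ℝ) : Prop :=
  ∀ i : Fin k,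
    ContinuousOn (fun p : ℝ × ℝ => ρ i p.1 p.2) (Set.Icc 0 T ×ˢ Set.Ici 0) ∧
    (∀ t ∈ Set.Icc (0:ℝ) T, ∀ s ∈ Set.Ici (0:ℝ), 0 ≤ ρ i t s) ∧
    (∃ M : ℝ, ∀ t ∈ Set.Icc (0:ℝ) T, ∀ s ∈ Set.Ici (0:ℝ), ρ i t s ≤ M * (1 + s)) ∧
    (∀ t ∈ Set.Ioo (0:ℝ) T, ∀ s ∈ Set.Ioi (0:ℝ),
      (DifferentiableAt ℝ (fun u => ρ i u s) t ∧
       DifferentiableAt ℝ (fun x => ρ i t x) s ∧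
       DifferentiableAt ℝ (deriv (fun x => ρ i t x)) s) ∧
      deriv (fun u => ρ i u s) t + r i * s * deriv (fun x => ρ i t x) s
        + (1/2) * (σ t i)^2 * s^2 * deriv (deriv (fun x => ρ i t x)) s
        = r i * ρ i t s) ∧
    (∀ s ∈ Set.Ici (0:ℝ), ρ i T s = K s)

open scoped NNReal Topology Interval

/-- Data of a time-inhomogeneous renewal equation on the horizon `T`: the transition kernel `g`,
the no-transition probability `G`, and the additive functionals `β` (with density `b`, frozen
after `T`) accumulated in each state. -/
structure RenewalData (ι : Type*) [Fintype ι] (E : Type*) [NormedAddCommGroup E]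
    [NormedSpace ℝ E] where
  T : ℝ
  T_pos : 0 < T
  g : ι → ι → ℝ → ℝ
  G : ι → ℝ
  c : ℝ
  β : ι → ℝ → E
  b : ι → ℝ → E
  L : ℝ≥0
  c_nonneg : 0 ≤ c
  g_meas : ∀ j l, Measurable (g j l)
  g_nonneg : ∀ j l v, 0 < v → 0 ≤ g j l v
  g_le : ∀ j l v, 0 < v → |g j l v| ≤ c
  G_nonneg : ∀ j, 0 ≤ G j
  total : ∀ j, G j + ∑ l, ∫ v in (0:ℝ)..T, g j l v = 1
  β_lip : ∀ j, LipschitzWith L (β j)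
  β_deriv : ∀ j u, 0 < u → u ≠ T → HasDerivAt (β j) (b j u) u
  b_cont : ∀ j u, 0 < u → u ≠ T → ContinuousAt (b j) u
  β_const : ∀ j u, T ≤ u → β j u = β j T

lemma nonneg_mem_nhds {E : Type*} [TopologicalSpace E] {z : ℝ × E} (hz : 0 < z.1) :
    {z : ℝ × E | 0 ≤ z.1} ∈ 𝓝 z := by
  have : ∀ᶠ w : ℝ × E in 𝓝 z, 0 < w.1 :=
    continuousAt_fst.eventually (lt_mem_nhds hz)
  filter_upwards [this] with w hw using hw.le

section KernelIntegral

variable {F : Type*} [NormedAddCommGroup F] [NormedSpace ℝ F]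

lemma intervalIntegrable_of_bounded_measurable {κ : ℝ → ℝ} {c T : ℝ} (hT : 0 ≤ T)
    (hκm : Measurable κ) (hκ : ∀ v, 0 < v → |κ v| ≤ c) :
    IntervalIntegrable κ volume 0 T := by
  rw [intervalIntegrable_iff_integrableOn_Ioc_of_le hT]
  refine Measure.integrableOn_of_bounded (M := c) (by simp) hκm.aestronglyMeasurable ?_
  filter_upwards [ae_restrict_mem measurableSet_Ioc] with v hv
  exact hκ v hv.1

lemma abs_kernel_integral_le {κ h : ℝ → ℝ} {c T γ M t : ℝ} (hT : 0 ≤ T) (hγ : 0 < γ)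
    (hM : 0 ≤ M) (hκ : ∀ v, 0 < v → |κ v| ≤ c)
    (hh : ∀ v, 0 < v → v ≤ T → |h v| ≤ M * Real.exp (-γ * (t + v))) :
    |∫ v in (0:ℝ)..T, κ v * h v| ≤ c / γ * (M * Real.exp (-γ * t)) := by
  have hc : 0 ≤ c := (abs_nonneg _).trans (hκ 1 one_pos)
  have hder : ∀ v ∈ uIcc (0:ℝ) T,
      HasDerivAt (fun v => -(c / γ) * (M * Real.exp (-γ * (t + v))))
        (c * (M * Real.exp (-γ * (t + v)))) v := by
    intro v _
    have h1 : HasDerivAt (fun v : ℝ => -γ * (t + v)) (-γ) v := by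
      simpa using ((hasDerivAt_id v).const_add t).const_mul (-γ)
    refine ((h1.exp.const_mul M).const_mul (-(c / γ))).congr_deriv ?_
    field_simp
  have hcont : Continuous fun v => c * (M * Real.exp (-γ * (t + v))) := by fun_prop
  have h1 : ‖∫ v in (0:ℝ)..T, κ v * h v‖ ≤ ∫ v in (0:ℝ)..T, c * (M * Real.exp (-γ * (t + v))) := by
    refine intervalIntegral.norm_integral_le_of_norm_le hT (Eventually.of_forall ?_)
      (hcont.intervalIntegrable _ _)
    intro v hv
    rw [norm_mul]
    exact mul_le_mul (hκ v hv.1) (hh v hv.1 hv.2) (norm_nonneg _) hc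
  rw [intervalIntegral.integral_eq_sub_of_hasDerivAt hder (hcont.intervalIntegrable _ _)] at h1
  refine h1.trans ?_
  have : 0 ≤ c / γ * (M * Real.exp (-γ * (t + T))) := by positivity
  simp only [add_zero]
  linarith

/-- Joint continuity of `∫₀ᵀ κ(y, v) X(v, z) dv` when `X` is bounded and continuous off the
hyperplanes `z.1 = T` and `z.1 + v = T`. -/
lemma continuousAt_kernel_integral {E Y : Type*} [NormedAddCommGroup E] [NormedSpace ℝ E]
    [TopologicalSpace Y] [FirstCountableTopology Y] {κ : Y → ℝ → ℝ} {c T : ℝ} (hT : 0 ≤ T)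
    {y₀ : Y} (hκm : ∀ y, Measurable (κ y))
    (hκ : ∀ᶠ y in 𝓝 y₀, ∀ v, 0 < v → |κ y v| ≤ c)
    (hκc : ∀ v, 0 < v → ContinuousAt (fun y => κ y v) y₀)
    {X : ℝ → ℝ × E → F} {C : ℝ}
    (hXc : ∀ v z, 0 < v → 0 < z.1 → z.1 ≠ T → z.1 + v ≠ T →
      ContinuousAt (fun q : ℝ × (ℝ × E) => X q.1 q.2) (v, z))
    (hX : ∀ v z, 0 < v → 0 < z.1 → z.1 ≠ T → z.1 + v ≠ T → ‖X v z‖ ≤ C)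
    {z₀ : ℝ × E} (hz : 0 < z₀.1) (hzT : z₀.1 ≠ T) :
    ContinuousAt (fun q : Y × (ℝ × E) => ∫ v in (0:ℝ)..T, κ q.1 v • X v q.2) (y₀, z₀) := by
  have hz1 : ∀ᶠ q : Y × (ℝ × E) in 𝓝 (y₀, z₀), 0 < q.2.1 ∧ q.2.1 ≠ T := by
    have hc : ContinuousAt (fun q : Y × (ℝ × E) => q.2.1) (y₀, z₀) := by fun_prop
    exact (hc.eventually (lt_mem_nhds hz)).and (hc.eventually_ne hzT)
  have hκ' : ∀ᶠ q : Y × (ℝ × E) in 𝓝 (y₀, z₀), ∀ v, 0 < v → |κ q.1 v| ≤ c :=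
    (continuous_fst.tendsto (y₀, z₀)).eventually hκ
  have hc : 0 ≤ c := by
    obtain ⟨y, hy⟩ := hκ.exists
    exact (abs_nonneg _).trans (hy 1 one_pos)
  have hne : ∀ w : ℝ, ∀ᵐ v : ℝ, v ≠ w := fun w => by
    simp [ae_iff, measure_singleton]
  refine intervalIntegral.continuousAt_of_dominated_interval (bound := fun _ => c * C) ?_ ?_
    (by simp) ?_
  · filter_upwards [hz1] with q hq
    refine (hκm q.1).aestronglyMeasurable.smul ?_
    rw [uIoc_of_le hT]
    have hmeas : MeasurableSet (Ioc (0:ℝ) T \ {T - q.2.1}) :=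
      measurableSet_Ioc.diff (measurableSet_singleton _)
    have hcon : ContinuousOn (fun v => X v q.2) (Ioc (0:ℝ) T \ {T - q.2.1}) := by
      intro v hv
      have hv2 : q.2.1 + v ≠ T := fun h => hv.2 (by simp [← h])
      have := hXc v q.2 hv.1.1 hq.1 hq.2 hv2
      exact (ContinuousAt.comp (f := fun v : ℝ => (v, q.2)) this (by fun_prop)).continuousWithinAt
    have h2 := hcon.aestronglyMeasurable (μ := volume) hmeas
    rwa [Measure.restrict_congr_set (t := Ioc (0:ℝ) T)] at h2
    exact sdiff_null_ae_eq_self (by simp)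
  · filter_upwards [hz1, hκ'] with q hq hqκ
    filter_upwards [hne (T - q.2.1)] with v hv hvm
    rw [uIoc_of_le hT] at hvm
    have hv2 : q.2.1 + v ≠ T := fun h => hv (by simp [← h])
    rw [norm_smul]
    exact mul_le_mul (hqκ v hvm.1) (hX v q.2 hvm.1 hq.1 hq.2 hv2) (norm_nonneg _) hc
  · filter_upwards [hne (T - z₀.1)] with v hv hvm
    rw [uIoc_of_le hT] at hvm
    have hv2 : z₀.1 + v ≠ T := fun h => hv (by simp [← h])
    have h1 := hXc v z₀ hvm.1 hz hzT hv2
    refine ContinuousAt.smul ?_ ?_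
    · exact ContinuousAt.comp (f := fun q : Y × (ℝ × E) => q.1) (x := (y₀, z₀))
        (hκc v hvm.1) continuousAt_fst
    · exact ContinuousAt.comp (f := fun q : Y × (ℝ × E) => (v, q.2)) (x := (y₀, z₀)) h1
        (by fun_prop)

end KernelIntegral

namespace RenewalData

variable {ι : Type*} [Fintype ι] {E : Type*} [NormedAddCommGroup E] [NormedSpace ℝ E]
  (R : RenewalData ι E)

/-- Evolution of the clock and the additive functional over duration `v` in state `j`. -/
def shift (j : ι) (v : ℝ) (z : ℝ × E) : ℝ × E := (z.1 + v, z.2 + (R.β j (z.1 + v) - R.β j z.1))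

/-- Derivative of `shift` in the space-time variable. -/
noncomputable def shiftD (j : ι) (v t : ℝ) : ℝ × E →L[ℝ] ℝ × E :=
  ContinuousLinearMap.id ℝ (ℝ × E) +
    (ContinuousLinearMap.fst ℝ ℝ E).smulRight ((0, R.b j (t + v) - R.b j t) : ℝ × E)

lemma norm_b_le (j : ι) {u : ℝ} (hu : 0 < u) (huT : u ≠ R.T) : ‖R.b j u‖ ≤ R.L := by
  rw [← (R.β_deriv j u hu huT).deriv]
  exact norm_deriv_le_of_lipschitz (R.β_lip j)

lemma norm_shift_sub_le (j : ι) (v : ℝ) (z z' : ℝ × E) :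
    ‖R.shift j v z - R.shift j v z'‖ ≤ (1 + 2 * R.L) * ‖z - z'‖ := by
  have h1 : ‖z.1 - z'.1‖ ≤ ‖z - z'‖ := norm_fst_le (z - z')
  have h2 : ‖z.2 - z'.2‖ ≤ ‖z - z'‖ := norm_snd_le (z - z')
  have hL : (0:ℝ) ≤ R.L := R.L.2
  have h3 : ‖R.β j (z.1 + v) - R.β j (z'.1 + v)‖ ≤ R.L * ‖z - z'‖ := by
    refine ((R.β_lip j).norm_sub_le _ _).trans ?_
    rw [add_sub_add_right_eq_sub]
    gcongr
  have h4 : ‖R.β j z'.1 - R.β j z.1‖ ≤ R.L * ‖z - z'‖ := by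
    rw [norm_sub_rev]
    refine ((R.β_lip j).norm_sub_le _ _).trans ?_
    gcongr
  rw [Prod.norm_def]
  refine max_le ?_ ?_
  · simp only [shift, Prod.fst_sub, add_sub_add_right_eq_sub]
    nlinarith [norm_nonneg (z - z')]
  · have : (R.shift j v z - R.shift j v z').2 = (z.2 - z'.2) +
        ((R.β j (z.1 + v) - R.β j (z'.1 + v)) + (R.β j z'.1 - R.β j z.1)) := by
      simp only [shift, Prod.snd_sub]; abel
    rw [this]
    refine (norm_add_le _ _).trans ?_
    have := norm_add_le (R.β j (z.1 + v) - R.β j (z'.1 + v)) (R.β j z'.1 - R.β j z.1)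
    linarith

lemma continuous_shift (j : ι) : Continuous fun q : ℝ × (ℝ × E) => R.shift j q.1 q.2 := by
  have := (R.β_lip j).continuous
  unfold shift
  fun_prop

lemma hasFDerivAt_shift (j : ι) {v : ℝ} {z : ℝ × E} (hv : 0 < v) (hz : 0 < z.1) (hzT : z.1 ≠ R.T)
    (hvT : z.1 + v ≠ R.T) : HasFDerivAt (R.shift j v) (R.shiftD j v z.1) z := by
  have hf : HasFDerivAt (fun z : ℝ × E => z.1) (ContinuousLinearMap.fst ℝ ℝ E) z := hasFDerivAt_fst
  have hf' : HasFDerivAt (fun z : ℝ × E => z.1 + v) (ContinuousLinearMap.fst ℝ ℝ E) z :=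
    hf.add_const v
  have h1 := (R.β_deriv j _ hz hzT).hasFDerivAt.comp z hf
  have h2 := (R.β_deriv j _ (add_pos hz hv) hvT).hasFDerivAt.comp z hf'
  have h3 : HasFDerivAt (fun z : ℝ × E => z.2) (ContinuousLinearMap.snd ℝ ℝ E) z := hasFDerivAt_snd
  have h4 := hf'.prodMk (h3.add (h2.sub h1))
  refine h4.congr_fderiv ?_
  ext <;> simp [shiftD]

lemma norm_shiftD_le (j : ι) {v t : ℝ} (hv : 0 < v) (ht : 0 < t) (htT : t ≠ R.T)
    (hvT : t + v ≠ R.T) : ‖R.shiftD j v t‖ ≤ 1 + 2 * R.L := by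
  have := R.hasFDerivAt_shift j (z := ((t, 0) : ℝ × E)) hv ht htT hvT
  refine this.le_of_lip' (by positivity) (Eventually.of_forall fun z => ?_)
  exact R.norm_shift_sub_le j v z _

lemma continuousAt_shiftD (j : ι) {v t : ℝ} (hv : 0 < v) (ht : 0 < t) (htT : t ≠ R.T)
    (hvT : t + v ≠ R.T) : ContinuousAt (fun q : ℝ × ℝ => R.shiftD j q.1 q.2) (v, t) := by
  have h1 : ContinuousAt (fun q : ℝ × ℝ => R.b j (q.2 + q.1)) (v, t) :=
    ContinuousAt.comp (f := fun q : ℝ × ℝ => q.2 + q.1) (R.b_cont j _ (add_pos ht hv) hvT)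
      (by fun_prop)
  have h2 : ContinuousAt (fun q : ℝ × ℝ => R.b j q.2) (v, t) :=
    ContinuousAt.comp (f := fun q : ℝ × ℝ => q.2) (R.b_cont j _ ht htT) (by fun_prop)
  have h3 := h1.sub h2
  have h4 : Continuous fun e : E => ContinuousLinearMap.id ℝ (ℝ × E) +
      (ContinuousLinearMap.fst ℝ ℝ E).smulRight ((0, e) : ℝ × E) := by
    have h5 : Continuous fun e : ℝ × E => (ContinuousLinearMap.fst ℝ ℝ E).smulRight e :=
      (ContinuousLinearMap.smulRightL ℝ (ℝ × E) (ℝ × E)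
        (ContinuousLinearMap.fst ℝ ℝ E)).continuous
    exact continuous_const.add (h5.comp (by fun_prop))
  exact ContinuousAt.comp (f := fun q : ℝ × ℝ => R.b j (q.2 + q.1) - R.b j q.2) h4.continuousAt h3

/-- Functions that are Lipschitz on `t ≥ 0` and `C¹` on `t > 0` off the terminal time. -/
structure Regular (Φ : ℝ × E → ℝ) : Prop where
  lip : ∃ C : ℝ≥0, LipschitzOnWith C Φ {z | 0 ≤ z.1}
  contDiffAt : ∀ z : ℝ × E, 0 < z.1 → z.1 ≠ R.T → ContDiffAt ℝ 1 Φ z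

variable {R}

lemma continuousOn_comp_shift {Φ : ℝ × E → ℝ} {C : ℝ≥0}
    (hΦ : LipschitzOnWith C Φ {z | 0 ≤ z.1}) (j : ι) {z : ℝ × E} (hz : 0 ≤ z.1) :
    ContinuousOn (fun v => Φ (R.shift j v z)) (Ici 0) := by
  refine hΦ.continuousOn.comp (f := fun v => R.shift j v z) ?_ ?_
  · exact ((R.continuous_shift j).comp (by fun_prop : Continuous fun v : ℝ => (v, z))).continuousOn
  · intro v hv
    exact add_nonneg hz hv

lemma intervalIntegrable_kernel_shift {Φ : ℝ × E → ℝ} {C : ℝ≥0}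
    (hΦ : LipschitzOnWith C Φ {z | 0 ≤ z.1}) (j : ι) {κ : ℝ → ℝ} {c : ℝ} (hκm : Measurable κ)
    (hκ : ∀ v, 0 < v → |κ v| ≤ c) {z : ℝ × E} (hz : 0 ≤ z.1) :
    IntervalIntegrable (fun v => κ v * Φ (R.shift j v z)) volume 0 R.T := by
  refine (intervalIntegrable_of_bounded_measurable R.T_pos.le hκm hκ).mul_continuousOn ?_
  refine (continuousOn_comp_shift hΦ j hz).mono ?_
  rw [uIcc_of_le R.T_pos.le]
  exact Icc_subset_Ici_self

lemma continuousAt_fderiv_shift {Φ : ℝ × E → ℝ} (hΦ : R.Regular Φ) (j : ι) {v : ℝ} {z : ℝ × E}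
    (hv : 0 < v) (hz : 0 < z.1) (hvT : z.1 + v ≠ R.T) :
    ContinuousAt (fun q : ℝ × (ℝ × E) => fderiv ℝ Φ (R.shift j q.1 q.2)) (v, z) := by
  have h1 := (hΦ.contDiffAt (R.shift j v z) (add_pos hz hv) hvT).continuousAt_fderiv (by simp)
  exact ContinuousAt.comp (f := fun q : ℝ × (ℝ × E) => R.shift j q.1 q.2) h1
    (R.continuous_shift j).continuousAt

lemma norm_fderiv_le {Φ : ℝ × E → ℝ} {C : ℝ≥0} (hΦ : LipschitzOnWith C Φ {z | 0 ≤ z.1})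
    {z : ℝ × E} (hz : 0 < z.1) : ‖fderiv ℝ Φ z‖ ≤ C :=
  norm_fderiv_le_of_lipschitzOn ℝ (nonneg_mem_nhds hz) hΦ

lemma hasFDerivAt_comp_shift {Φ : ℝ × E → ℝ} (hΦ : R.Regular Φ) (j : ι) {v : ℝ} {z : ℝ × E}
    (hv : 0 < v) (hz : 0 < z.1) (hzT : z.1 ≠ R.T) (hvT : z.1 + v ≠ R.T) :
    HasFDerivAt (fun z => Φ (R.shift j v z))
      ((fderiv ℝ Φ (R.shift j v z)).comp (R.shiftD j v z.1)) z := by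
  have h1 := ((hΦ.contDiffAt (R.shift j v z) (add_pos hz hv) hvT).differentiableAt
    (by simp)).hasFDerivAt
  exact h1.comp z (R.hasFDerivAt_shift j hv hz hzT hvT)

/-- The derivative field of `Φ ∘ shift`, continuous off the terminal time. -/
lemma continuousAt_fderiv_comp_shiftD {Φ : ℝ × E → ℝ} (hΦ : R.Regular Φ) (j : ι) {v : ℝ}
    {z : ℝ × E} (hv : 0 < v) (hz : 0 < z.1) (hzT : z.1 ≠ R.T) (hvT : z.1 + v ≠ R.T) :
    ContinuousAt (fun q : ℝ × (ℝ × E) =>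
      (fderiv ℝ Φ (R.shift j q.1 q.2)).comp (R.shiftD j q.1 q.2.1)) (v, z) := by
  refine (continuousAt_fderiv_shift hΦ j hv hz hvT).clm_comp ?_
  exact ContinuousAt.comp (f := fun q : ℝ × (ℝ × E) => (q.1, q.2.1)) (x := (v, z))
    (R.continuousAt_shiftD j hv hz hzT hvT) (by fun_prop)

lemma norm_fderiv_comp_shiftD_le {Φ : ℝ × E → ℝ} {C : ℝ≥0}
    (hΦ : LipschitzOnWith C Φ {z | 0 ≤ z.1}) (j : ι) {v : ℝ} {z : ℝ × E}
    (hv : 0 < v) (hz : 0 < z.1) (hzT : z.1 ≠ R.T) (hvT : z.1 + v ≠ R.T) :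
    ‖(fderiv ℝ Φ (R.shift j v z)).comp (R.shiftD j v z.1)‖ ≤ C * (1 + 2 * R.L) := by
  refine (ContinuousLinearMap.opNorm_comp_le _ _).trans ?_
  have h1 : ‖fderiv ℝ Φ (R.shift j v z)‖ ≤ C := norm_fderiv_le hΦ (add_pos hz hv)
  exact mul_le_mul h1 (R.norm_shiftD_le j hv hz hzT hvT) (norm_nonneg _) C.2

lemma hasFDerivAt_kernel_integral {Φ : ℝ × E → ℝ} (hΦ : R.Regular Φ) (j : ι) {κ : ℝ → ℝ} {c : ℝ}
    (hκm : Measurable κ) (hκ : ∀ v, 0 < v → |κ v| ≤ c) {z : ℝ × E} (hz : 0 < z.1)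
    (hzT : z.1 ≠ R.T) :
    HasFDerivAt (fun z => ∫ v in (0:ℝ)..R.T, κ v * Φ (R.shift j v z))
      (∫ v in (0:ℝ)..R.T, κ v • (fderiv ℝ Φ (R.shift j v z)).comp (R.shiftD j v z.1)) z := by
  obtain ⟨C, hC⟩ := hΦ.lip
  have hT := R.T_pos.le
  have hc : 0 ≤ c := (abs_nonneg _).trans (hκ 1 one_pos)
  have hne : ∀ w : ℝ, ∀ᵐ v : ℝ, v ≠ w := fun w => by
    simp [ae_iff, measure_singleton]
  have hμ : ∀ᵐ v ∂(volume.restrict (Ι (0:ℝ) R.T)), 0 < v ∧ z.1 + v ≠ R.T := by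
    filter_upwards [ae_restrict_mem measurableSet_uIoc,
      ae_restrict_of_ae (hne (R.T - z.1))] with v hv hv2
    rw [uIoc_of_le hT] at hv
    exact ⟨hv.1, fun h => hv2 (by linarith)⟩
  simp only [intervalIntegral.integral_of_le hT]
  rw [uIoc_of_le hT] at hμ
  refine (hasFDerivAt_integral_of_dominated_loc_of_lip' (nonneg_mem_nhds hz)
    (bound := fun _ => c * (C * (1 + 2 * R.L))) ?_ ?_ ?_ ?_ (integrable_const _) ?_).2
  · intro w hw
    have := intervalIntegrable_kernel_shift (R := R) hC j hκm hκ hw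
    rw [intervalIntegrable_iff_integrableOn_Ioc_of_le hT] at this
    exact this.aestronglyMeasurable
  · have := intervalIntegrable_kernel_shift (R := R) hC j hκm hκ hz.le
    rwa [intervalIntegrable_iff_integrableOn_Ioc_of_le hT] at this
  · refine hκm.aestronglyMeasurable.smul ?_
    have hmeas : MeasurableSet (Ioc (0:ℝ) R.T \ {R.T - z.1}) :=
      measurableSet_Ioc.diff (measurableSet_singleton _)
    have hcon : ContinuousOn (fun v => (fderiv ℝ Φ (R.shift j v z)).comp (R.shiftD j v z.1))
        (Ioc (0:ℝ) R.T \ {R.T - z.1}) := by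
      intro v hv
      have hv2 : z.1 + v ≠ R.T := fun h => hv.2 (by simp [← h])
      have := continuousAt_fderiv_comp_shiftD hΦ j hv.1.1 hz hzT hv2
      exact (ContinuousAt.comp (f := fun v : ℝ => (v, z)) this (by fun_prop)).continuousWithinAt
    have h2 := hcon.aestronglyMeasurable (μ := volume) hmeas
    rwa [Measure.restrict_congr_set (t := Ioc (0:ℝ) R.T)] at h2
    exact sdiff_null_ae_eq_self (by simp)
  · filter_upwards [hμ] with v hv w hw
    rw [← mul_sub, norm_mul, mul_assoc]
    refine mul_le_mul (hκ v hv.1) ?_ (norm_nonneg _) hc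
    refine (hC.norm_sub_le (add_nonneg hw hv.1.le) (add_nonneg hz.le hv.1.le)).trans ?_
    rw [mul_assoc]
    exact mul_le_mul_of_nonneg_left (R.norm_shift_sub_le j v w z) C.2
  · filter_upwards [hμ] with v hv
    exact (hasFDerivAt_comp_shift hΦ j hv.1 hz hzT hv.2).const_mul (κ v)

lemma Regular.kernel_integral {Φ : ℝ × E → ℝ} (hΦ : R.Regular Φ) (j : ι) {κ : ℝ → ℝ} {c : ℝ}
    (hκm : Measurable κ) (hκ : ∀ v, 0 < v → |κ v| ≤ c) :
    R.Regular fun z => ∫ v in (0:ℝ)..R.T, κ v * Φ (R.shift j v z) := by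
  obtain ⟨C, hC⟩ := hΦ.lip
  have hT := R.T_pos.le
  have hc : 0 ≤ c := (abs_nonneg _).trans (hκ 1 one_pos)
  refine ⟨⟨Real.toNNReal (c * (C * (1 + 2 * R.L)) * R.T), ?_⟩, ?_⟩
  · refine LipschitzOnWith.of_dist_le_mul fun z hz w hw => ?_
    rw [dist_eq_norm, dist_eq_norm, ← intervalIntegral.integral_sub
      (intervalIntegrable_kernel_shift hC j hκm hκ hz)
      (intervalIntegrable_kernel_shift hC j hκm hκ hw)]
    have := intervalIntegral.norm_integral_le_of_norm_le_const (a := 0) (b := R.T)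
      (C := c * (C * (1 + 2 * R.L)) * ‖z - w‖)
      (f := fun v => κ v * Φ (R.shift j v z) - κ v * Φ (R.shift j v w)) ?_
    · refine this.trans_eq ?_
      rw [sub_zero, abs_of_nonneg hT, Real.coe_toNNReal _ (by positivity)]
      ring
    · intro v hv
      rw [uIoc_of_le hT] at hv
      rw [← mul_sub, norm_mul, mul_assoc]
      refine mul_le_mul (hκ v hv.1) ?_ (norm_nonneg _) hc
      refine (hC.norm_sub_le (add_nonneg hz hv.1.le) (add_nonneg hw hv.1.le)).trans ?_
      rw [mul_assoc]
      exact mul_le_mul_of_nonneg_left (R.norm_shift_sub_le j v z w) C.2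
  · intro z hz hzT
    rw [contDiffAt_one_iff]
    have hU : IsOpen {z : ℝ × E | 0 < z.1 ∧ z.1 ≠ R.T} :=
      (isOpen_lt continuous_const continuous_fst).inter
        (isOpen_ne_fun continuous_fst continuous_const)
    refine ⟨_, _, hU.mem_nhds ⟨hz, hzT⟩, ?_, fun w hw =>
      hasFDerivAt_kernel_integral hΦ j hκm hκ hw.1 hw.2⟩
    intro w hw
    have h1 := continuousAt_kernel_integral (Y := Unit) (κ := fun _ => κ) (y₀ := ()) (c := c)
      (z₀ := w) hT (fun _ => hκm) (Eventually.of_forall fun _ => hκ)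
      (fun _ _ => continuousAt_const)
      (X := fun v z => (fderiv ℝ Φ (R.shift j v z)).comp (R.shiftD j v z.1))
      (fun v z hv hz hzT hvT => continuousAt_fderiv_comp_shiftD hΦ j hv hz hzT hvT)
      (fun v z hv hz hzT hvT => norm_fderiv_comp_shiftD_le hC j hv hz hzT hvT) hw.1 hw.2
    exact (ContinuousAt.comp (f := fun z : ℝ × E => ((), z)) h1 (by fun_prop)).continuousWithinAt

end RenewalData

namespace RenewalData

variable {ι : Type*} [Fintype ι] {E : Type*} [NormedAddCommGroup E] [NormedSpace ℝ E]
  (R : RenewalData ι E)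

/-- The integral operator of the renewal equation. -/
noncomputable def op (Φ : ι → ℝ × E → ℝ) (j : ι) (z : ℝ × E) : ℝ :=
  ∑ l, ∫ v in (0:ℝ)..R.T, R.g j l v * Φ l (R.shift j v z)

/-- The source term of the renewal equation. -/
noncomputable def src (f : E → ℝ) (j : ι) (z : ℝ × E) : ℝ :=
  R.G j * f (R.shift j R.T z).2

/-- `Φ` is a bounded solution on `Dom` of the renewal equation with terminal value `f`. -/
structure SolvesOn (Dom : Set (ℝ × E)) (f : E → ℝ) (Φ : ι → ℝ × E → ℝ) : Prop where
  bdd : ∃ C, ∀ j, ∀ z ∈ Dom, |Φ j z| ≤ C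
  terminal : ∀ j, ∀ z ∈ Dom, R.T ≤ z.1 → Φ j z = f z.2
  eq : ∀ j, ∀ z ∈ Dom, z.1 < R.T → Φ j z = R.src f j z + R.op Φ j z
  int : ∀ j l, ∀ z ∈ Dom,
    IntervalIntegrable (fun v => R.g j l v * Φ l (R.shift j v z)) volume 0 R.T

/-- A set of nonnegative times that is closed under the evolution. -/
structure Invariant (Dom : Set (ℝ × E)) : Prop where
  nonneg : ∀ z ∈ Dom, 0 ≤ z.1
  shift_mem : ∀ j, ∀ z ∈ Dom, ∀ v, 0 < v → v ≤ R.T → R.shift j v z ∈ Dom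

lemma invariant_halfSpace : R.Invariant {z : ℝ × E | 0 ≤ z.1} :=
  ⟨fun _ hz => hz, fun _ _ hz _ hv _ => add_nonneg hz hv.le⟩

/-- An exponential rate that makes the integral operator a contraction by `1/2`. -/
noncomputable def rate : ℝ := 2 * Fintype.card ι * R.c * (1 + 2 * R.L) + 1

lemma rate_pos : 0 < R.rate := by
  have := R.c_nonneg
  unfold rate
  positivity

lemma card_mul_le : (Fintype.card ι : ℝ) * (R.c / R.rate * (1 + 2 * R.L)) ≤ 1 / 2 := by
  have := R.rate_pos
  rw [div_mul_eq_mul_div, mul_div_assoc', div_le_div_iff₀ this two_pos]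
  unfold rate
  nlinarith

lemma card_mul_le' : (Fintype.card ι : ℝ) * (R.c / R.rate) ≤ 1 / 2 := by
  refine le_trans ?_ R.card_mul_le
  have hc := R.c_nonneg
  have hr := R.rate_pos
  have hL : (0:ℝ) ≤ R.L := R.L.2
  gcongr
  exact le_mul_of_one_le_right (by positivity) (by linarith)

variable {R}

namespace SolvesOn

variable {Dom : Set (ℝ × E)} {f f' : E → ℝ} {Φ Φ' : ι → ℝ × E → ℝ}

lemma mono {Dom' : Set (ℝ × E)} (h : R.SolvesOn Dom f Φ) (hs : Dom' ⊆ Dom) :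
    R.SolvesOn Dom' f Φ where
  bdd := h.bdd.imp fun _ hC j z hz => hC j z (hs hz)
  terminal j z hz := h.terminal j z (hs hz)
  eq j z hz := h.eq j z (hs hz)
  int j l z hz := h.int j l z (hs hz)

lemma add (h : R.SolvesOn Dom f Φ) (h' : R.SolvesOn Dom f' Φ') :
    R.SolvesOn Dom (fun a => f a + f' a) (fun j z => Φ j z + Φ' j z) where
  bdd := by
    obtain ⟨C, hC⟩ := h.bdd
    obtain ⟨C', hC'⟩ := h'.bdd
    exact ⟨C + C', fun j z hz => (abs_add_le _ _).trans (add_le_add (hC j z hz) (hC' j z hz))⟩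
  terminal j z hz hT := by rw [h.terminal j z hz hT, h'.terminal j z hz hT]
  eq j z hz hT := by
    have h1 : R.op (fun j z => Φ j z + Φ' j z) j z = R.op Φ j z + R.op Φ' j z := by
      simp only [op, mul_add, ← Finset.sum_add_distrib]
      exact Finset.sum_congr rfl fun l _ =>
        intervalIntegral.integral_add (h.int j l z hz) (h'.int j l z hz)
    rw [h1, h.eq j z hz hT, h'.eq j z hz hT]
    simp only [src]
    ring
  int j l z hz := by
    simpa only [mul_add] using (h.int j l z hz).add (h'.int j l z hz)

lemma const_mul (c : ℝ) (h : R.SolvesOn Dom f Φ) :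
    R.SolvesOn Dom (fun a => c * f a) (fun j z => c * Φ j z) where
  bdd := by
    obtain ⟨C, hC⟩ := h.bdd
    refine ⟨|c| * C, fun j z hz => ?_⟩
    rw [abs_mul]
    exact mul_le_mul_of_nonneg_left (hC j z hz) (abs_nonneg c)
  terminal j z hz hT := by rw [h.terminal j z hz hT]
  eq j z hz hT := by
    have h1 : R.op (fun j z => c * Φ j z) j z = c * R.op Φ j z := by
      simp only [op, Finset.mul_sum, ← intervalIntegral.integral_const_mul]
      refine Finset.sum_congr rfl fun l _ => ?_
      congr 1
      ext v
      ring
    rw [h1, h.eq j z hz hT]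
    simp only [src]
    ring
  int j l z hz := by
    refine ((h.int j l z hz).const_mul c).congr (fun v _ => ?_)
    ring

lemma sub (h : R.SolvesOn Dom f Φ) (h' : R.SolvesOn Dom f' Φ') :
    R.SolvesOn Dom (fun a => f a - f' a) (fun j z => Φ j z - Φ' j z) := by
  simpa [sub_eq_add_neg] using h.add (h'.const_mul (-1))

lemma translate (h : R.SolvesOn {z | 0 ≤ z.1} f Φ) (e : E) :
    R.SolvesOn {z | 0 ≤ z.1} (fun a => f (a + e)) (fun j z => Φ j (z + (0, e))) := by
  have hs : ∀ j v (z : ℝ × E), R.shift j v (z + (0, e)) = R.shift j v z + (0, e) := by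
    intro j v z
    ext
    · simp [shift]
    · simp only [shift, Prod.fst_add, Prod.snd_add, add_zero]
      abel
  have hm : ∀ z : ℝ × E, 0 ≤ z.1 → 0 ≤ (z + (0, e)).1 := by simp
  have h1 : ∀ z : ℝ × E, (z + (0, e)).1 = z.1 := by simp
  obtain ⟨C, hC⟩ := h.bdd
  refine ⟨⟨C, fun j z hz => hC j _ (hm z hz)⟩, fun j z hz hT => ?_, fun j z hz hT => ?_,
    fun j l z hz => ?_⟩
  · exact h.terminal j _ (hm z hz) (by rwa [h1])
  · rw [h.eq j _ (hm z hz) (by rwa [h1])]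
    simp only [src, op, hs]
    rfl
  · simpa only [hs] using h.int j l _ (hm z hz)

/-- Maximum principle for the renewal equation. -/
lemma abs_le (h : R.SolvesOn Dom f Φ) (hD : R.Invariant Dom) {δ : ℝ} (hδ : 0 ≤ δ)
    (hf : ∀ z ∈ Dom, R.T ≤ z.1 → |f z.2| ≤ δ) (j : ι) (z : ℝ × E) (hz : z ∈ Dom) :
    |Φ j z| ≤ δ := by
  obtain ⟨B, hB⟩ := h.bdd
  have hγ := R.rate_pos
  have hT := R.T_pos.le
  set γ := R.rate with hγdef
  have hB0 : 0 ≤ B := (abs_nonneg _).trans (hB j z hz)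
  have key : ∀ n : ℕ, ∀ j, ∀ z ∈ Dom,
      |Φ j z| ≤ δ + B * Real.exp (γ * R.T) * (1 / 2) ^ n * Real.exp (-γ * z.1) := by
    intro n
    induction n with
    | zero =>
      intro j z hz
      rcases le_or_gt R.T z.1 with hzT | hzT
      · rw [h.terminal j z hz hzT]
        have := hf z hz hzT
        have : 0 ≤ B * Real.exp (γ * R.T) * (1 / 2) ^ 0 * Real.exp (-γ * z.1) := by positivity
        linarith
      · have h1 : 1 ≤ Real.exp (γ * R.T) * Real.exp (-γ * z.1) := by
          rw [← Real.exp_add]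
          refine Real.one_le_exp ?_
          nlinarith
        have h2 := hB j z hz
        rw [pow_zero, mul_one, mul_assoc]
        nlinarith
    | succ n ih =>
      intro j z hz
      set M := B * Real.exp (γ * R.T) * (1 / 2) ^ n with hM
      have hM0 : 0 ≤ M := by positivity
      have hpow : B * Real.exp (γ * R.T) * (1 / 2) ^ (n + 1) = M / 2 := by
        rw [hM, pow_succ]; ring
      rw [hpow]
      rcases le_or_gt R.T z.1 with hzT | hzT
      · rw [h.terminal j z hz hzT]
        have := hf z hz hzT
        have : 0 ≤ M / 2 * Real.exp (-γ * z.1) := by positivity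
        linarith
      · rw [h.eq j z hz hzT]
        have hsrc : |R.src f j z| ≤ R.G j * δ := by
          rw [src, abs_mul, abs_of_nonneg (R.G_nonneg j)]
          refine mul_le_mul_of_nonneg_left (hf _ (hD.shift_mem j z hz _ R.T_pos le_rfl) ?_)
            (R.G_nonneg j)
          have := hD.nonneg z hz
          simp only [shift]
          linarith
        have hterm : ∀ l, |∫ v in (0:ℝ)..R.T, R.g j l v * Φ l (R.shift j v z)| ≤
            δ * (∫ v in (0:ℝ)..R.T, R.g j l v) +
              R.c / γ * (M * Real.exp (-γ * z.1)) := by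
          intro l
          have hgint := intervalIntegrable_of_bounded_measurable hT (R.g_meas j l) (R.g_le j l)
          have hcont : Continuous fun v : ℝ => M * Real.exp (-γ * (z.1 + v)) := by fun_prop
          have hInt2 := hgint.mul_continuousOn (g := fun v : ℝ => M * Real.exp (-γ * (z.1 + v)))
            hcont.continuousOn
          have h1 : ‖∫ v in (0:ℝ)..R.T, R.g j l v * Φ l (R.shift j v z)‖ ≤
              ∫ v in (0:ℝ)..R.T, (δ * R.g j l v + R.g j l v * (M * Real.exp (-γ * (z.1 + v)))) := by
            refine intervalIntegral.norm_integral_le_of_norm_le hT (Eventually.of_forall ?_)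
              ((hgint.const_mul δ).add hInt2)
            intro v hv
            have hg0 := R.g_nonneg j l v hv.1
            have h2 := ih l _ (hD.shift_mem j z hz v hv.1 hv.2)
            rw [norm_mul, Real.norm_of_nonneg hg0]
            calc R.g j l v * ‖Φ l (R.shift j v z)‖
                ≤ R.g j l v * (δ + M * Real.exp (-γ * (z.1 + v))) := by
                  gcongr
                  exact h2
              _ = _ := by ring
          rw [intervalIntegral.integral_add (hgint.const_mul δ) hInt2,
            intervalIntegral.integral_const_mul] at h1
          refine h1.trans (add_le_add le_rfl ?_)
          refine (le_abs_self _).trans (abs_kernel_integral_le hT hγ hM0 (R.g_le j l) ?_)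
          intro v _ _
          rw [abs_of_nonneg (by positivity)]
        calc |R.src f j z + R.op Φ j z|
            ≤ |R.src f j z| + |R.op Φ j z| := abs_add_le _ _
          _ ≤ R.G j * δ + ∑ l, |∫ v in (0:ℝ)..R.T, R.g j l v * Φ l (R.shift j v z)| :=
              add_le_add hsrc (Finset.abs_sum_le_sum_abs _ _)
          _ ≤ R.G j * δ + ∑ l, (δ * (∫ v in (0:ℝ)..R.T, R.g j l v) +
              R.c / γ * (M * Real.exp (-γ * z.1))) := by
              gcongr with l
              exact hterm l
          _ = δ * (R.G j + ∑ l, ∫ v in (0:ℝ)..R.T, R.g j l v) +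
              (Fintype.card ι * (R.c / γ)) * (M * Real.exp (-γ * z.1)) := by
              rw [Finset.sum_add_distrib, ← Finset.mul_sum, Finset.sum_const, Finset.card_univ,
                nsmul_eq_mul]
              ring
          _ ≤ δ * 1 + 1 / 2 * (M * Real.exp (-γ * z.1)) := by
              rw [R.total j]
              gcongr
              exact R.card_mul_le'
          _ = δ + M / 2 * Real.exp (-γ * z.1) := by ring
  have hlim : Tendsto (fun n : ℕ => δ + B * Real.exp (γ * R.T) * (1 / 2) ^ n *
      Real.exp (-γ * z.1)) atTop (𝓝 (δ + B * Real.exp (γ * R.T) * 0 * Real.exp (-γ * z.1))) :=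
    (((tendsto_pow_atTop_nhds_zero_of_lt_one (by norm_num) (by norm_num)).const_mul _).mul_const
      _).const_add _
  have := ge_of_tendsto hlim (Eventually.of_forall fun n => key n j z hz)
  simpa using this

/-- Solutions whose terminal values agree on an invariant set agree there. -/
lemma eqOn (h : R.SolvesOn Dom f Φ) (h' : R.SolvesOn Dom f' Φ') (hD : R.Invariant Dom)
    (hf : ∀ z ∈ Dom, R.T ≤ z.1 → f z.2 = f' z.2) (j : ι) (z : ℝ × E) (hz : z ∈ Dom) :
    Φ j z = Φ' j z := by
  have := (h.sub h').abs_le hD le_rfl (fun z hz hT => by simp [hf z hz hT]) j z hz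
  exact sub_eq_zero.mp (abs_nonpos_iff.mp this)

/-- The solution is differentiable in the direction `e` with derivative the solution whose
terminal value is the derivative of the terminal value. -/
lemma hasDerivAt (h : R.SolvesOn {z | 0 ≤ z.1} f Φ) (h' : R.SolvesOn {z | 0 ≤ z.1} f' Φ') (e : E)
    {C : ℝ} (hC : 0 ≤ C) (hf : ∀ (a : E) (τ : ℝ), |f (a + τ • e) - f a - τ * f' a| ≤ C * τ ^ 2)
    (j : ι) (z : ℝ × E) (hz : 0 ≤ z.1) :
    HasDerivAt (fun τ : ℝ => Φ j (z + (0, τ • e))) (Φ' j z) 0 := by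
  have key : ∀ τ : ℝ, |Φ j (z + (0, τ • e)) - Φ j z - τ * Φ' j z| ≤ C * τ ^ 2 := by
    intro τ
    exact ((((h.translate (τ • e)).sub h).sub (h'.const_mul τ)).abs_le R.invariant_halfSpace
      (by positivity) (fun z _ _ => hf z.2 τ)) j z hz
  rw [hasDerivAt_iff_isLittleO]
  have h0 : Φ j (z + (0, (0:ℝ) • e)) = Φ j z := by rw [zero_smul, Prod.mk_zero_zero, add_zero]
  refine Asymptotics.IsBigO.trans_isLittleO (g := fun τ : ℝ => τ ^ 2) ?_ ?_
  · refine Asymptotics.IsBigO.of_bound C (Eventually.of_forall fun τ => ?_)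
    rw [h0, sub_zero, smul_eq_mul, Real.norm_eq_abs, Real.norm_of_nonneg (sq_nonneg τ)]
    exact key τ
  · simp only [sub_zero]
    exact Asymptotics.isLittleO_pow_id one_lt_two

end SolvesOn

end RenewalData

namespace RenewalData

variable {ι : Type*} [Fintype ι] {E : Type*} [NormedAddCommGroup E] [NormedSpace ℝ E]
  {R : RenewalData ι E}

lemma Regular.add {Φ Φ' : ℝ × E → ℝ} (h : R.Regular Φ) (h' : R.Regular Φ') :
    R.Regular fun z => Φ z + Φ' z := by
  obtain ⟨C, hC⟩ := h.lip
  obtain ⟨C', hC'⟩ := h'.lip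
  exact ⟨⟨C + C', hC.add hC'⟩, fun z hz hT => (h.contDiffAt z hz hT).add (h'.contDiffAt z hz hT)⟩

lemma Regular.sub {Φ Φ' : ℝ × E → ℝ} (h : R.Regular Φ) (h' : R.Regular Φ') :
    R.Regular fun z => Φ z - Φ' z := by
  obtain ⟨C, hC⟩ := h.lip
  obtain ⟨C', hC'⟩ := h'.lip
  exact ⟨⟨C + C', hC.sub hC'⟩, fun z hz hT => (h.contDiffAt z hz hT).sub (h'.contDiffAt z hz hT)⟩

lemma Regular.sum {α : Type*} (s : Finset α) {Φ : α → ℝ × E → ℝ} (h : ∀ l, R.Regular (Φ l)) :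
    R.Regular fun z => ∑ l ∈ s, Φ l z := by
  classical
  induction s using Finset.induction_on with
  | empty => exact ⟨⟨0, by simp [(LipschitzWith.const (0:ℝ)).lipschitzOnWith]⟩,
      fun z _ _ => by simp [contDiffAt_const]⟩
  | insert a s ha ih =>
    simp only [Finset.sum_insert ha]
    exact (h a).add ih

lemma contDiffAt_shift (j : ι) {v : ℝ} {z : ℝ × E} (hv : 0 < v) (hz : 0 < z.1)
    (hzT : z.1 ≠ R.T) (hvT : z.1 + v ≠ R.T) : ContDiffAt ℝ 1 (R.shift j v) z := by
  rw [contDiffAt_one_iff]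
  have hU : IsOpen {z : ℝ × E | 0 < z.1 ∧ z.1 ≠ R.T ∧ z.1 + v ≠ R.T} :=
    (isOpen_lt continuous_const continuous_fst).inter
      ((isOpen_ne_fun continuous_fst continuous_const).inter
        (isOpen_ne_fun (continuous_fst.add continuous_const) continuous_const))
  refine ⟨fun w => R.shiftD j v w.1, _, hU.mem_nhds ⟨hz, hzT, hvT⟩, fun w hw => ?_, fun w hw =>
    R.hasFDerivAt_shift j hv hw.1 hw.2.1 hw.2.2⟩
  exact (ContinuousAt.comp (f := fun w : ℝ × E => (v, w.1))
    (R.continuousAt_shiftD j hv hw.1 hw.2.1 hw.2.2) (by fun_prop)).continuousWithinAt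

lemma regular_snd {f : E → ℝ} {C : ℝ≥0} (hf : ContDiff ℝ 1 f) (hC : LipschitzWith C f) :
    R.Regular fun z => f z.2 :=
  ⟨⟨C * 1, (hC.comp LipschitzWith.prod_snd).lipschitzOnWith⟩,
    fun _ _ _ => (hf.comp contDiff_snd).contDiffAt⟩

lemma lipschitzWith_shift (j : ι) (v : ℝ) : LipschitzWith (1 + 2 * R.L) (R.shift j v) :=
  LipschitzWith.of_dist_le_mul fun z w => by
    rw [dist_eq_norm, dist_eq_norm]
    exact_mod_cast R.norm_shift_sub_le j v z w

lemma regular_src {f : E → ℝ} {C : ℝ≥0} (hf : ContDiff ℝ 1 f) (hC : LipschitzWith C f) (j : ι) :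
    R.Regular (R.src f j) := by
  refine ⟨⟨‖R.G j‖₊ * (C * (1 * (1 + 2 * R.L))), ?_⟩, fun z hz hzT => ?_⟩
  · have h1 := hC.comp (LipschitzWith.prod_snd.comp (lipschitzWith_shift (R := R) j R.T))
    have h2 : LipschitzWith ‖R.G j‖₊ (fun x : ℝ => R.G j * x) :=
      lipschitzWith_smul (R.G j)
    exact (h2.comp h1).lipschitzOnWith
  · exact contDiffAt_const.mul (hf.contDiffAt.comp z
      (contDiffAt_snd.comp z (contDiffAt_shift j R.T_pos hz hzT (by simpa using hz.ne'))))

lemma Regular.op {Φ : ι → ℝ × E → ℝ} (h : ∀ j, R.Regular (Φ j)) (j : ι) :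
    R.Regular (R.op Φ j) :=
  Regular.sum _ fun l => (h l).kernel_integral j (R.g_meas j l) (R.g_le j l)

variable (R)

/-- Exponentially weighted bounds that contract under the integral operator. -/
structure Ctrl (M : ℝ) (Φ : ι → ℝ × E → ℝ) : Prop where
  reg : ∀ j, R.Regular (Φ j)
  zero : ∀ j z, R.T ≤ z.1 → Φ j z = 0
  bd : ∀ j z, 0 ≤ z.1 → |Φ j z| ≤ M * Real.exp (-R.rate * z.1)
  lip : ∀ j z z', 0 ≤ z.1 → z.1 ≤ z'.1 →
    |Φ j z - Φ j z'| ≤ M * Real.exp (-R.rate * z.1) * ‖z - z'‖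

variable {R}

lemma Ctrl.op {M : ℝ} (hM : 0 ≤ M) {Φ : ι → ℝ × E → ℝ} (h : R.Ctrl M Φ) :
    R.Ctrl (M / 2) (R.op Φ) where
  reg := Regular.op h.reg
  zero j z hz := by
    refine Finset.sum_eq_zero fun l _ => ?_
    rw [intervalIntegral.integral_congr (g := fun _ => 0), intervalIntegral.integral_zero]
    intro v hv
    rw [uIcc_of_le R.T_pos.le] at hv
    have : R.T ≤ (R.shift j v z).1 := hz.trans (by simpa [shift] using hv.1)
    simp [h.zero l _ this]
  bd j z hz := by
    refine (Finset.abs_sum_le_sum_abs _ _).trans ?_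
    refine (Finset.sum_le_card_nsmul _ _ (R.c / R.rate * (M * Real.exp (-R.rate * z.1)))
      fun l _ => ?_).trans ?_
    · exact abs_kernel_integral_le R.T_pos.le R.rate_pos hM (R.g_le j l)
        fun v hv _ => h.bd l _ (add_nonneg hz hv.le)
    · have := mul_le_mul_of_nonneg_right R.card_mul_le'
        (by positivity : 0 ≤ M * Real.exp (-R.rate * z.1))
      rw [Finset.card_univ, nsmul_eq_mul]
      linarith
  lip j z z' hz hzz' := by
    have hz' := hz.trans hzz'
    have hL : (0:ℝ) ≤ R.L := R.L.2
    rw [RenewalData.op, RenewalData.op, ← Finset.sum_sub_distrib]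
    refine (Finset.abs_sum_le_sum_abs _ _).trans ?_
    refine (Finset.sum_le_card_nsmul _ _ (R.c / R.rate * (M * ((1 + 2 * R.L) * ‖z - z'‖) *
      Real.exp (-R.rate * z.1))) fun l _ => ?_).trans ?_
    · obtain ⟨C, hC⟩ := (h.reg l).lip
      rw [← intervalIntegral.integral_sub
        (intervalIntegrable_kernel_shift hC j (R.g_meas j l) (R.g_le j l) hz)
        (intervalIntegrable_kernel_shift hC j (R.g_meas j l) (R.g_le j l) hz')]
      simp only [← mul_sub]
      refine abs_kernel_integral_le R.T_pos.le R.rate_pos (by positivity) (R.g_le j l)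
        fun v hv _ => ?_
      refine (h.lip l _ _ (add_nonneg hz hv.le) (by simpa [shift] using hzz')).trans ?_
      rw [mul_right_comm M]
      exact mul_le_mul_of_nonneg_right
        (mul_le_mul_of_nonneg_left (R.norm_shift_sub_le j v z z') hM) (Real.exp_nonneg _)
    · have := mul_le_mul_of_nonneg_right R.card_mul_le
        (by positivity : 0 ≤ M * Real.exp (-R.rate * z.1) * ‖z - z'‖)
      rw [Finset.card_univ, nsmul_eq_mul]
      linarith

lemma Ctrl.iterate {M : ℝ} (hM : 0 ≤ M) {Φ : ι → ℝ × E → ℝ} (h : R.Ctrl M Φ) (n : ℕ) :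
    R.Ctrl (M * (1 / 2) ^ n) (R.op^[n] Φ) := by
  induction n with
  | zero => simpa using h
  | succ n ih =>
    rw [Function.iterate_succ_apply', pow_succ]
    convert ih.op (by positivity) using 1
    ring

lemma exists_ctrl {Φ : ι → ℝ × E → ℝ} (h : ∀ j, R.Regular (Φ j))
    (h0 : ∀ j z, R.T ≤ z.1 → Φ j z = 0) : ∃ M, 0 ≤ M ∧ R.Ctrl M Φ := by
  choose C hC using fun j => (h j).lip
  have hT := R.T_pos.le
  set A : ℝ := ∑ j, (C j : ℝ) with hA
  have hA0 : 0 ≤ A := Finset.sum_nonneg fun j _ => (C j).2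
  have hCA : ∀ j, (C j : ℝ) ≤ A := fun j =>
    Finset.single_le_sum (f := fun j => (C j : ℝ)) (fun j _ => (C j).2) (Finset.mem_univ j)
  set M := A * (1 + R.T) * Real.exp (R.rate * R.T) with hMdef
  have hM : 0 ≤ M := by positivity
  have hexp : ∀ t, t ≤ R.T → A * (1 + R.T) ≤ M * Real.exp (-R.rate * t) := by
    intro t ht
    rw [hMdef, mul_assoc, ← Real.exp_add]
    refine le_mul_of_one_le_right (by positivity) (Real.one_le_exp ?_)
    nlinarith [R.rate_pos]
  refine ⟨M, hM, h, h0, fun j z hz => ?_, fun j z z' hz hzz' => ?_⟩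
  · rcases le_or_gt R.T z.1 with hzT | hzT
    · rw [h0 j z hzT, abs_zero]
      positivity
    · refine le_trans ?_ (hexp z.1 hzT.le)
      have h1 := (hC j).norm_sub_le (x := z) (y := (R.T, z.2)) hz hT
      rw [h0 j (R.T, z.2) le_rfl, sub_zero] at h1
      have h2 : ‖z - (R.T, z.2)‖ ≤ R.T := by
        rw [Prod.norm_def]
        refine max_le ?_ ?_
        · rw [Prod.fst_sub, Real.norm_eq_abs, abs_le]
          constructor <;> linarith [show (0:ℝ) ≤ z.1 from hz]
        · simpa using hT
      calc |Φ j z| ≤ C j * ‖z - (R.T, z.2)‖ := h1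
        _ ≤ A * (1 + R.T) := by
          gcongr
          · exact hCA j
          · linarith
  · rcases le_or_gt R.T z.1 with hzT | hzT
    · rw [h0 j z hzT, h0 j z' (hzT.trans hzz'), sub_zero, abs_zero]
      positivity
    · have h1 := (hC j).norm_sub_le (x := z) (y := z') hz (hz.trans hzz')
      refine h1.trans (mul_le_mul_of_nonneg_right (le_trans ?_ (hexp z.1 hzT.le)) (norm_nonneg _))
      refine (hCA j).trans (le_mul_of_one_le_right hA0 (by linarith))

/-- Existence of a regular solution of the renewal equation with `C¹` terminal value. -/
theorem exists_solvesOn {f : E → ℝ} {C : ℝ≥0} (hf : ContDiff ℝ 1 f) (hC : LipschitzWith C f)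
    {B : ℝ} (hB : ∀ a, |f a| ≤ B) :
    ∃ Φ : ι → ℝ × E → ℝ, R.SolvesOn {z | 0 ≤ z.1} f Φ ∧ ∀ j, R.Regular (Φ j) := by
  have hT := R.T_pos.le
  set F : ι → ℝ × E → ℝ := fun _ z => f z.2 with hF
  have hFreg : ∀ j, R.Regular (F j) := fun j => regular_snd hf hC
  set Θ : ι → ℝ × E → ℝ := fun j z => R.src f j z + R.op F j z - F j z with hΘ
  have hΘreg : ∀ j, R.Regular (Θ j) := fun j =>
    ((regular_src hf hC j).add (Regular.op hFreg j)).sub (hFreg j)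
  have hshift : ∀ j v (z : ℝ × E), R.T ≤ z.1 → 0 ≤ v → (R.shift j v z).2 = z.2 := by
    intro j v z hz hv
    simp only [shift]
    rw [R.β_const j _ hz, R.β_const j (z.1 + v) (by linarith), sub_self, add_zero]
  have hΘ0 : ∀ j z, R.T ≤ z.1 → Θ j z = 0 := by
    intro j z hz
    have h1 : R.op F j z = (∑ l, ∫ v in (0:ℝ)..R.T, R.g j l v) * f z.2 := by
      rw [op, Finset.sum_mul]
      refine Finset.sum_congr rfl fun l _ => ?_
      rw [← intervalIntegral.integral_mul_const]
      refine intervalIntegral.integral_congr fun v hv => ?_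
      rw [uIcc_of_le hT] at hv
      simp only [hF, hshift j v z hz hv.1]
    simp only [hΘ]
    rw [h1]
    simp only [src, hshift j _ z hz hT, hF]
    linear_combination f z.2 * R.total j
  obtain ⟨M, hM, hctrl⟩ := exists_ctrl hΘreg hΘ0
  set θ : ℕ → ι → ℝ × E → ℝ := fun n => R.op^[n] Θ with hθ
  have hθc : ∀ n, R.Ctrl (M * (1 / 2) ^ n) (θ n) := fun n => hctrl.iterate hM n
  have hsumM : Summable fun n : ℕ => M * (1 / 2 : ℝ) ^ n := summable_geometric_two.mul_left M
  have hexp : ∀ z : ℝ × E, 0 ≤ z.1 → Real.exp (-R.rate * z.1) ≤ 1 := by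
    intro z hz
    rw [Real.exp_le_one_iff]
    nlinarith [R.rate_pos]
  have hbd : ∀ n j z, 0 ≤ z.1 → ‖θ n j z‖ ≤ M * (1 / 2) ^ n := fun n j z hz =>
    ((hθc n).bd j z hz).trans (mul_le_of_le_one_right (by positivity) (hexp z hz))
  have hlip : ∀ n j z z', 0 ≤ z.1 → 0 ≤ z'.1 →
      ‖θ n j z - θ n j z'‖ ≤ M * (1 / 2) ^ n * ‖z - z'‖ := by
    have : ∀ n j z z', 0 ≤ z.1 → z.1 ≤ z'.1 →
        ‖θ n j z - θ n j z'‖ ≤ M * (1 / 2) ^ n * ‖z - z'‖ := fun n j z z' hz hzz' =>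
      ((hθc n).lip j z z' hz hzz').trans (mul_le_mul_of_nonneg_right
        (mul_le_of_le_one_right (by positivity) (hexp z hz)) (norm_nonneg _))
    intro n j z z' hz hz'
    rcases le_total z.1 z'.1 with h | h
    · exact this n j z z' hz h
    · rw [norm_sub_rev, norm_sub_rev z]
      exact this n j z' z hz' h
  have hsum : ∀ j z, 0 ≤ z.1 → Summable fun n => θ n j z := fun j z hz =>
    Summable.of_norm_bounded hsumM fun n => hbd n j z hz
  set S : ι → ℝ × E → ℝ := fun j z => ∑' n, θ n j z with hS
  have hStot : ∑' n : ℕ, M * (1 / 2 : ℝ) ^ n = M * 2 := by rw [tsum_mul_left, tsum_geometric_two]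
  have hSlip : ∀ j, LipschitzOnWith (Real.toNNReal (M * 2)) (S j) {z | 0 ≤ z.1} := by
    intro j
    refine LipschitzOnWith.of_dist_le_mul fun z hz w hw => ?_
    rw [dist_eq_norm, dist_eq_norm, hS, ← (hsum j z hz).tsum_sub (hsum j w hw),
      Real.coe_toNNReal _ (by positivity), ← hStot, ← tsum_mul_right]
    exact tsum_of_norm_bounded (hsumM.mul_right _).hasSum fun n => hlip n j z w hz hw
  have hSreg : ∀ j, R.Regular (S j) := by
    intro j
    refine ⟨⟨_, hSlip j⟩, fun z hz hzT => ?_⟩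
    rcases lt_or_gt_of_ne hzT with hzT' | hzT'
    · set U : Set (ℝ × E) := Ioo 0 R.T ×ˢ univ with hU
      have hUo : IsOpen U := isOpen_Ioo.prod isOpen_univ
      have hUc : IsPreconnected U := ((convex_Ioo _ _).prod convex_univ).isPreconnected
      have hzU : z ∈ U := ⟨⟨hz, hzT'⟩, mem_univ _⟩
      have hcd : ∀ n, ∀ w ∈ U, ContDiffAt ℝ 1 (θ n j) w := fun n w hw =>
        ((hθc n).reg j).contDiffAt w hw.1.1 hw.1.2.ne
      have hnorm : ∀ n, ∀ w ∈ U, ‖fderiv ℝ (θ n j) w‖ ≤ M * (1 / 2) ^ n := by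
        intro n w hw
        have hl : LipschitzOnWith (Real.toNNReal (M * (1 / 2) ^ n)) (θ n j) {z | 0 ≤ z.1} := by
          refine LipschitzOnWith.of_dist_le_mul fun z hz w hw => ?_
          rw [dist_eq_norm, dist_eq_norm, Real.coe_toNNReal _ (by positivity)]
          exact hlip n j z w hz hw
        have := norm_fderiv_le hl hw.1.1
        rwa [Real.coe_toNNReal _ (by positivity)] at this
      rw [contDiffAt_one_iff]
      refine ⟨fun w => ∑' n, fderiv ℝ (θ n j) w, U, hUo.mem_nhds hzU, ?_, fun w hw => ?_⟩
      · refine continuousOn_tsum (fun n w hw => ?_) hsumM hnorm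
        exact ((hcd n w hw).continuousAt_fderiv (by simp)).continuousWithinAt
      · exact hasFDerivAt_tsum_of_isPreconnected hsumM hUo hUc
          (fun n w hw => ((hcd n w hw).differentiableAt (by simp)).hasFDerivAt) hnorm hzU
          (hsum j z hz.le) hw
    · have : S j =ᶠ[𝓝 z] fun _ => 0 := by
        have h1 : ∀ᶠ w : ℝ × E in 𝓝 z, R.T < w.1 := continuousAt_fst.eventually (lt_mem_nhds hzT')
        filter_upwards [h1] with w hw
        simp only [hS, (hθc _).zero j w hw.le, tsum_zero]
      exact contDiffAt_const.congr_of_eventuallyEq this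
  have hopS : ∀ j z, 0 ≤ z.1 → R.op S j z = ∑' n, θ (n + 1) j z := by
    intro j z hz
    have h1 : ∀ l, HasSum (fun n => ∫ v in (0:ℝ)..R.T, R.g j l v * θ n l (R.shift j v z))
        (∫ v in (0:ℝ)..R.T, R.g j l v * S l (R.shift j v z)) := by
      intro l
      refine intervalIntegral.hasSum_integral_of_dominated_convergence
        (fun n _ => R.c * (M * (1 / 2) ^ n)) (fun n => ?_) (fun n => ?_) ?_ (by simp) ?_
      · obtain ⟨C', hC'⟩ := ((hθc n).reg l).lip
        have := intervalIntegrable_kernel_shift (R := R) hC' j (R.g_meas j l) (R.g_le j l) hz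
        rw [intervalIntegrable_iff] at this
        exact this.aestronglyMeasurable
      · refine Eventually.of_forall fun v hv => ?_
        rw [uIoc_of_le hT] at hv
        rw [norm_mul]
        exact mul_le_mul (R.g_le j l v hv.1) (hbd n l _ (add_nonneg hz hv.1.le)) (norm_nonneg _)
          R.c_nonneg
      · exact Eventually.of_forall fun v _ => hsumM.mul_left _
      · refine Eventually.of_forall fun v hv => ?_
        rw [uIoc_of_le hT] at hv
        exact ((hsum l _ (add_nonneg hz hv.1.le)).hasSum).mul_left _
    have h2 := hasSum_sum fun l (_ : l ∈ (Finset.univ : Finset ι)) => h1 l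
    rw [op, ← h2.tsum_eq]
    refine tsum_congr fun n => ?_
    simp only [hθ, Function.iterate_succ_apply']
    rfl
  set Φ : ι → ℝ × E → ℝ := fun j z => F j z + S j z with hΦ
  have hΦreg : ∀ j, R.Regular (Φ j) := fun j => (hFreg j).add (hSreg j)
  refine ⟨Φ, ⟨⟨B + M * 2, fun j z hz => ?_⟩, fun j z hz hzT => ?_, fun j z hz hzT => ?_,
    fun j l z hz => ?_⟩, hΦreg⟩
  · refine (abs_add_le _ _).trans (add_le_add (hB _) ?_)
    rw [← hStot]
    exact tsum_of_norm_bounded hsumM.hasSum fun n => hbd n j z hz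
  · simp only [hΦ, hF, hS, (hθc _).zero j z hzT, tsum_zero, add_zero]
  · have h1 : R.op Φ j z = R.op F j z + R.op S j z := by
      simp only [op, hΦ, mul_add, ← Finset.sum_add_distrib]
      refine Finset.sum_congr rfl fun l _ => ?_
      obtain ⟨C1, hC1⟩ := (hFreg l).lip
      exact intervalIntegral.integral_add
        (intervalIntegrable_kernel_shift hC1 j (R.g_meas j l) (R.g_le j l) hz)
        (intervalIntegrable_kernel_shift (hSlip l) j (R.g_meas j l) (R.g_le j l) hz)
    have h2 : S j z = Θ j z + ∑' n, θ (n + 1) j z := (hsum j z hz).tsum_eq_zero_add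
    rw [h1, hopS j z hz]
    simp only [hΦ, h2, hΘ]
    ring
  · obtain ⟨C', hC'⟩ := (hΦreg l).lip
    exact intervalIntegrable_kernel_shift hC' j (R.g_meas j l) (R.g_le j l) hz

end RenewalData

section GaussMoment

/-- Moments of `h` against the Gaussian weight `exp (-(τ u²) + η u)`. -/
noncomputable def gaussMoment (h : ℝ → ℝ) (m : ℕ) (a : ℝ × ℝ) : ℝ :=
  ∫ u, h u * u ^ m * Real.exp (-(a.1 * u ^ 2) + a.2 * u)

variable {h : ℝ → ℝ} {M : ℝ}

lemma gaussMoment_bound (hM : ∀ u, |h u| ≤ M * (1 + Real.exp u)) (m : ℕ) {a N : ℝ} (ha : 0 < a) :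
    ∃ C, ∀ τ η u : ℝ, a ≤ τ → |η| ≤ N →
      ‖h u * u ^ m * Real.exp (-(τ * u ^ 2) + η * u)‖ ≤ C * Real.exp (-(a / 2) * u ^ 2) := by
  have hM0 : 0 ≤ M := by
    have h1 := (abs_nonneg _).trans (hM 0)
    have h2 := Real.exp_pos 0
    nlinarith
  refine ⟨2 * M * m.factorial * Real.exp ((N + 2) ^ 2 / (2 * a)), fun τ η u hτ hη => ?_⟩
  have h1 : |h u| ≤ 2 * M * Real.exp |u| := by
    refine (hM u).trans ?_
    have h2 : Real.exp u ≤ Real.exp |u| := Real.exp_le_exp.mpr (le_abs_self u)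
    have h3 : 1 ≤ Real.exp |u| := Real.one_le_exp (abs_nonneg u)
    nlinarith
  have h2 : |u| ^ m ≤ m.factorial * Real.exp |u| := by
    have := Real.pow_div_factorial_le_exp |u| (abs_nonneg u) m
    rwa [div_le_iff₀ (by positivity), mul_comm] at this
  have h3 : -(τ * u ^ 2) + η * u ≤ -(a * u ^ 2) + N * |u| := by
    have h4 : η * u ≤ N * |u| := (le_abs_self _).trans (by rw [abs_mul]; gcongr)
    have h5 : a * u ^ 2 ≤ τ * u ^ 2 := by gcongr
    linarith
  have h4 : (N + 2) * |u| ≤ a / 2 * u ^ 2 + (N + 2) ^ 2 / (2 * a) := by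
    have : 0 ≤ (a * |u| - (N + 2)) ^ 2 / (2 * a) := by positivity
    have h5 : (a * |u| - (N + 2)) ^ 2 / (2 * a) =
        a / 2 * |u| ^ 2 + (N + 2) ^ 2 / (2 * a) - (N + 2) * |u| := by
      field_simp
      ring
    rw [h5, sq_abs] at this
    linarith
  rw [norm_mul, norm_mul, norm_pow, Real.norm_eq_abs, Real.norm_eq_abs, Real.norm_eq_abs,
    Real.abs_exp]
  calc |h u| * |u| ^ m * Real.exp (-(τ * u ^ 2) + η * u)
      ≤ (2 * M * Real.exp |u|) * (m.factorial * Real.exp |u|) *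
        Real.exp (-(a * u ^ 2) + N * |u|) := by gcongr
    _ = 2 * M * m.factorial * Real.exp (-(a * u ^ 2) + (N + 2) * |u|) := by
        rw [show -(a * u ^ 2) + (N + 2) * |u| = |u| + |u| + (-(a * u ^ 2) + N * |u|) by ring,
          Real.exp_add (|u| + |u|), Real.exp_add |u|]
        ring
    _ ≤ 2 * M * m.factorial * Real.exp ((N + 2) ^ 2 / (2 * a) + -(a / 2) * u ^ 2) := by
        refine mul_le_mul_of_nonneg_left (Real.exp_le_exp.mpr ?_) (by positivity)
        linarith
    _ = _ := by rw [Real.exp_add]; ring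

lemma integrable_gaussMoment (hc : Continuous h) (hM : ∀ u, |h u| ≤ M * (1 + Real.exp u)) (m : ℕ)
    {a : ℝ × ℝ} (ha : 0 < a.1) :
    Integrable fun u => h u * u ^ m * Real.exp (-(a.1 * u ^ 2) + a.2 * u) := by
  obtain ⟨C, hC⟩ := gaussMoment_bound hM m (N := |a.2|) ha
  refine Integrable.mono' ((integrable_exp_neg_mul_sq (half_pos ha)).const_mul C)
    (Continuous.aestronglyMeasurable (by fun_prop)) (Eventually.of_forall fun u => ?_)
  exact hC _ _ u le_rfl le_rfl

lemma hasFDerivAt_gaussMoment (hc : Continuous h) (hM : ∀ u, |h u| ≤ M * (1 + Real.exp u)) (m : ℕ)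
    {a : ℝ × ℝ} (ha : 0 < a.1) :
    HasFDerivAt (gaussMoment h m) (gaussMoment h (m + 1) a • ContinuousLinearMap.snd ℝ ℝ ℝ -
      gaussMoment h (m + 2) a • ContinuousLinearMap.fst ℝ ℝ ℝ) a := by
  have hs : {b : ℝ × ℝ | a.1 / 2 ≤ b.1 ∧ |b.2| ≤ |a.2| + 1} ∈ 𝓝 a := by
    have h1 : ∀ᶠ b : ℝ × ℝ in 𝓝 a, a.1 / 2 < b.1 :=
      continuousAt_fst.eventually (lt_mem_nhds (by linarith))
    have h2 : ∀ᶠ b : ℝ × ℝ in 𝓝 a, |b.2| < |a.2| + 1 :=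
      (continuous_snd.abs.continuousAt).eventually (gt_mem_nhds (by linarith))
    filter_upwards [h1, h2] with b hb1 hb2 using ⟨hb1.le, hb2.le⟩
  obtain ⟨C1, hC1⟩ := gaussMoment_bound hM (m + 1) (N := |a.2| + 1) (half_pos ha)
  obtain ⟨C2, hC2⟩ := gaussMoment_bound hM (m + 2) (N := |a.2| + 1) (half_pos ha)
  have hInt := integrable_exp_neg_mul_sq (b := a.1 / 2 / 2) (by positivity)
  have key := hasFDerivAt_integral_of_dominated_of_fderiv_le (𝕜 := ℝ) (μ := volume)
    (F := fun b u => h u * u ^ m * Real.exp (-(b.1 * u ^ 2) + b.2 * u))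
    (F' := fun b u => (h u * u ^ (m + 1) * Real.exp (-(b.1 * u ^ 2) + b.2 * u)) •
      ContinuousLinearMap.snd ℝ ℝ ℝ - (h u * u ^ (m + 2) * Real.exp (-(b.1 * u ^ 2) + b.2 * u)) •
      ContinuousLinearMap.fst ℝ ℝ ℝ)
    (bound := fun u => C1 * Real.exp (-(a.1 / 2 / 2) * u ^ 2) +
      C2 * Real.exp (-(a.1 / 2 / 2) * u ^ 2)) hs ?_ (integrable_gaussMoment hc hM m ha) ?_ ?_ ?_ ?_
  · refine key.congr_fderiv ?_
    rw [integral_sub, integral_smul_const, integral_smul_const]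
    · rfl
    · exact (integrable_gaussMoment hc hM (m + 1) ha).smul_const _
    · exact (integrable_gaussMoment hc hM (m + 2) ha).smul_const _
  · exact Eventually.of_forall fun b => Continuous.aestronglyMeasurable (by fun_prop)
  · exact Continuous.aestronglyMeasurable (by fun_prop)
  · refine Eventually.of_forall fun u b hb => ?_
    refine (norm_sub_le _ _).trans (add_le_add ?_ ?_)
    · rw [norm_smul]
      exact (mul_le_of_le_one_right (norm_nonneg _) (ContinuousLinearMap.norm_snd_le _ _ _)).trans
        (hC1 _ _ u hb.1 hb.2)
    · rw [norm_smul]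
      exact (mul_le_of_le_one_right (norm_nonneg _) (ContinuousLinearMap.norm_fst_le _ _ _)).trans
        (hC2 _ _ u hb.1 hb.2)
  · exact (hInt.const_mul _).add (hInt.const_mul _)
  · refine Eventually.of_forall fun u b hb => ?_
    have h1 : HasFDerivAt (fun b : ℝ × ℝ => -(b.1 * u ^ 2) + b.2 * u)
        (-((u ^ 2) • ContinuousLinearMap.fst ℝ ℝ ℝ) + u • ContinuousLinearMap.snd ℝ ℝ ℝ) b :=
      ((hasFDerivAt_fst (𝕜 := ℝ) (p := b)).mul_const (u ^ 2)).neg.add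
        ((hasFDerivAt_snd (𝕜 := ℝ) (p := b)).mul_const u)
    refine (h1.exp.const_mul (h u * u ^ m)).congr_fderiv ?_
    ext <;> simp <;> ring

lemma contDiffOn_gaussMoment (hc : Continuous h) (hM : ∀ u, |h u| ≤ M * (1 + Real.exp u)) (n : ℕ) :
    ∀ m, ContDiffOn ℝ n (gaussMoment h m) {a | 0 < a.1} := by
  have ho : IsOpen {a : ℝ × ℝ | 0 < a.1} := isOpen_lt continuous_const continuous_fst
  induction n with
  | zero =>
    intro m
    exact contDiffOn_zero.mpr fun a ha =>
      (hasFDerivAt_gaussMoment hc hM m ha).continuousAt.continuousWithinAt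
  | succ n ih =>
    intro m
    push_cast
    rw [contDiffOn_succ_iff_fderiv_of_isOpen ho]
    refine ⟨fun a ha => (hasFDerivAt_gaussMoment hc hM m ha
      ).differentiableAt.differentiableWithinAt,
      by simp, ?_⟩
    refine ContDiffOn.congr ?_ fun a ha => (hasFDerivAt_gaussMoment hc hM m ha).fderiv
    exact ((ih (m + 1)).smul contDiffOn_const).sub ((ih (m + 2)).smul contDiffOn_const)

end GaussMoment

section GaussSmooth

open ProbabilityTheory

/-- Gaussian average of `h` with accumulated variance `a.1` at log-price `a.2`, normalised by the
price. -/
noncomputable def gaussSmooth (h : ℝ → ℝ) (a : ℝ × ℝ) : ℝ :=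
  Real.exp (-a.2) * ∫ u, h (a.2 + √a.1 * u - a.1 / 2) ∂(gaussianReal 0 1)

lemma gaussSmooth_zero (h : ℝ → ℝ) (x : ℝ) : gaussSmooth h (0, x) = Real.exp (-x) * h x := by
  simp [gaussSmooth]

lemma integral_gaussianReal_affine (k : ℝ → ℝ) (μ : ℝ) {q : ℝ} (hq : 0 < q) :
    ∫ u, k (μ + √q * u) ∂(gaussianReal 0 1) =
      ∫ w, (√(2 * π * q))⁻¹ * Real.exp (-(w - μ) ^ 2 / (2 * q)) * k w := by
  have hsq : 0 < √q := Real.sqrt_pos.mpr hq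
  rw [integral_gaussianReal_eq_integral_smul one_ne_zero]
  set H : ℝ → ℝ := fun w => gaussianPDFReal 0 1 ((w - μ) / √q) * k w with hH
  have h1 : ∀ u, gaussianPDFReal 0 1 u • k (μ + √q * u) = H (√q * u + μ) := by
    intro u
    simp only [hH, smul_eq_mul]
    rw [add_sub_cancel_right, mul_div_cancel_left₀ _ hsq.ne', add_comm μ]
  simp_rw [h1]
  rw [Measure.integral_comp_mul_left (fun w => H (w + μ)) (√q), integral_add_right_eq_self H,
    smul_eq_mul, ← integral_const_mul]
  refine integral_congr_ae (Eventually.of_forall fun w => ?_)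
  simp only [hH, gaussianPDFReal]
  rw [abs_of_pos (inv_pos.mpr hsq), Real.sqrt_mul (by positivity), mul_inv]
  have h2 : -((w - μ) / √q - 0) ^ 2 / (2 * ((1:ℝ≥0) : ℝ)) = -(w - μ) ^ 2 / (2 * q) := by
    rw [sub_zero, div_pow, Real.sq_sqrt hq.le]
    push_cast
    field_simp
  rw [h2]
  rw [NNReal.coe_one, Real.sqrt_one, inv_one, mul_one, Real.sqrt_mul (by positivity) q, mul_inv]
  ring

lemma integral_exp_gaussianReal {p : ℝ} (hp : 0 ≤ p) (x : ℝ) :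
    ∫ u, Real.exp (x + √p * u - p / 2) ∂(gaussianReal 0 1) = Real.exp x := by
  have h1 : ∀ u, Real.exp (x + √p * u - p / 2) = Real.exp (x - p / 2) * Real.exp (√p * u) := by
    intro u
    rw [← Real.exp_add]
    ring_nf
  simp_rw [h1]
  rw [integral_const_mul]
  have h2 := congrFun (mgf_fun_id_gaussianReal (μ := 0) (v := 1)) (√p)
  simp only [mgf] at h2
  rw [h2, ← Real.exp_add, Real.sq_sqrt hp]
  congr 1
  push_cast
  ring

variable {M : ℝ}

lemma integrable_exp_affine_gaussianReal (x b d : ℝ) (v : ℝ≥0) :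
    Integrable (fun u => Real.exp (x + b * u - d)) (gaussianReal 0 v) := by
  have h1 : ∀ u, Real.exp (x + b * u - d) = Real.exp (x - d) * Real.exp (b * u) := by
    intro u
    rw [← Real.exp_add]
    ring_nf
  simp_rw [h1]
  exact (integrable_exp_mul_gaussianReal b).const_mul _

lemma integrable_gaussianReal_affine {h : ℝ → ℝ} (hc : Continuous h)
    (hM : ∀ u, |h u| ≤ M * (1 + Real.exp u)) (x b d : ℝ) (v : ℝ≥0) :
    Integrable (fun u => h (x + b * u - d)) (gaussianReal 0 v) := by
  refine Integrable.mono' (((integrable_const (1:ℝ)).add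
    (integrable_exp_affine_gaussianReal x b d v)).const_mul M)
    (Continuous.aestronglyMeasurable (by fun_prop)) (Eventually.of_forall fun u => hM _)

lemma abs_gaussSmooth_le {h : ℝ → ℝ} (hM : ∀ u, |h u| ≤ M * (1 + Real.exp u)) {a : ℝ × ℝ}
    (ha : 0 ≤ a.1) : |gaussSmooth h a| ≤ M * (1 + Real.exp (-a.2)) := by
  have h1 : ‖∫ u, h (a.2 + √a.1 * u - a.1 / 2) ∂(gaussianReal 0 1)‖ ≤
      ∫ u, M * (1 + Real.exp (a.2 + √a.1 * u - a.1 / 2)) ∂(gaussianReal 0 1) :=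
    norm_integral_le_of_norm_le (((integrable_const (1:ℝ)).add
      (integrable_exp_affine_gaussianReal _ _ _ _)).const_mul M)
      (Eventually.of_forall fun u => hM _)
  rw [integral_const_mul, integral_add (integrable_const _)
    (integrable_exp_affine_gaussianReal _ _ _ _), integral_exp_gaussianReal ha] at h1
  simp only [integral_const, probReal_univ, smul_eq_mul, one_mul] at h1
  rw [gaussSmooth, abs_mul, Real.abs_exp]
  calc Real.exp (-a.2) * |∫ u, h (a.2 + √a.1 * u - a.1 / 2) ∂(gaussianReal 0 1)|
      ≤ Real.exp (-a.2) * (M * (1 + Real.exp a.2)) := by gcongr; exact h1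
    _ = M * (1 + Real.exp (-a.2)) := by
      have : Real.exp (-a.2) * Real.exp a.2 = 1 := by rw [← Real.exp_add]; simp
      linear_combination M * this

lemma continuous_gaussSmooth_param {Θ : Type*} [TopologicalSpace Θ] [FirstCountableTopology Θ]
    {H : Θ → ℝ → ℝ} (hc : Continuous fun q : Θ × ℝ => H q.1 q.2)
    (hM : ∀ θ u, |H θ u| ≤ M * (1 + Real.exp u)) :
    Continuous fun q : Θ × (ℝ × ℝ) => gaussSmooth (H q.1) q.2 := by
  have hM0 : ∀ θ : Θ, 0 ≤ M := by
    intro θ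
    have h1 := (abs_nonneg _).trans (hM θ 0)
    have h2 := Real.exp_pos 0
    nlinarith
  unfold gaussSmooth
  refine Continuous.mul (by fun_prop) ?_
  rw [continuous_iff_continuousAt]
  intro q₀
  set P := |q₀.2.1| + 1 with hP
  set A := |q₀.2.2| + 1 + P with hA
  have hM0 := hM0 q₀.1
  have hmem : ∀ᶠ q : Θ × (ℝ × ℝ) in 𝓝 q₀, |q.2.1| < P ∧ |q.2.2| < |q₀.2.2| + 1 := by
    have h1 : ContinuousAt (fun q : Θ × (ℝ × ℝ) => |q.2.1|) q₀ := by fun_prop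
    have h2 : ContinuousAt (fun q : Θ × (ℝ × ℝ) => |q.2.2|) q₀ := by fun_prop
    exact (h1.eventually (gt_mem_nhds (by simp [hP]))).and
      (h2.eventually (gt_mem_nhds (by simp)))
  refine continuousAt_of_dominated (bound := fun u => M * (1 + (Real.exp (A + √P * u - 0) +
    Real.exp (A + (-√P) * u - 0)))) ?_ ?_ ?_ ?_
  · refine Eventually.of_forall fun q => Continuous.aestronglyMeasurable ?_
    exact hc.comp (continuous_const.prodMk (by fun_prop))
  · filter_upwards [hmem] with q hq
    refine Eventually.of_forall fun u => (hM _ _).trans ?_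
    have h1 : √q.2.1 ≤ √P := Real.sqrt_le_sqrt ((le_abs_self _).trans hq.1.le)
    have h2 : √q.2.1 * u ≤ √P * |u| :=
      (mul_le_mul_of_nonneg_left (le_abs_self u) (Real.sqrt_nonneg _)).trans
        (mul_le_mul_of_nonneg_right h1 (abs_nonneg u))
    have h3 : q.2.2 + √q.2.1 * u - q.2.1 / 2 ≤ A + √P * |u| := by
      have h4 := (abs_lt.mp hq.1).1
      have h5 := (le_abs_self q.2.2).trans hq.2.le
      have h6 : 0 < P := by positivity
      linarith
    have h4 : Real.exp (q.2.2 + √q.2.1 * u - q.2.1 / 2) ≤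
        Real.exp (A + √P * u - 0) + Real.exp (A + (-√P) * u - 0) := by
      refine (Real.exp_le_exp.mpr h3).trans ?_
      rcases abs_cases u with h | h
      · rw [h.1, sub_zero]
        exact le_add_of_nonneg_right (Real.exp_nonneg _)
      · rw [h.1, mul_neg, ← neg_mul, sub_zero, sub_zero]
        exact le_add_of_nonneg_left (Real.exp_nonneg _)
    gcongr
  · exact ((integrable_const (1:ℝ)).add ((integrable_exp_affine_gaussianReal _ _ _ _).add
      (integrable_exp_affine_gaussianReal _ _ _ _))).const_mul M
  · refine Eventually.of_forall fun u => Continuous.continuousAt ?_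
    exact hc.comp (continuous_fst.prodMk (by fun_prop))

lemma continuous_gaussSmooth {h : ℝ → ℝ} (hc : Continuous h)
    (hM : ∀ u, |h u| ≤ M * (1 + Real.exp u)) : Continuous (gaussSmooth h) :=
  (continuous_gaussSmooth_param (Θ := Unit) (H := fun _ => h) (by fun_prop) fun _ => hM).comp
    (continuous_const.prodMk continuous_id : Continuous fun a : ℝ × ℝ => ((), a))

lemma integral_integral_gaussianReal_add {k : ℝ → ℝ} (hc : Continuous k)
    (hM : ∀ u, |k u| ≤ M * (1 + Real.exp u)) {p q : ℝ} (hp : 0 ≤ p) (hq : 0 ≤ q) :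
    ∫ u, ∫ w, k (√p * u + √q * w) ∂(gaussianReal 0 1) ∂(gaussianReal 0 1) =
      ∫ u, k (√(p + q) * u) ∂(gaussianReal 0 1) := by
  have hmap : ∀ {p : ℝ} (hp : 0 ≤ p), (gaussianReal 0 1).map (√p * ·) =
      gaussianReal 0 (p.toNNReal) := by
    intro p hp
    rw [gaussianReal_map_const_mul]
    congr 1
    · simp
    · ext
      simp [Real.sq_sqrt hp, hp]
  have hInt : ∀ {p : ℝ} (hp : 0 ≤ p) (k : ℝ → ℝ), Continuous k →
      ∫ u, k (√p * u) ∂(gaussianReal 0 1) = ∫ u, k u ∂(gaussianReal 0 p.toNNReal) := by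
    intro p hp k hk
    rw [← hmap hp, integral_map (by fun_prop) hk.aestronglyMeasurable]
  rw [hInt (add_nonneg hp hq) k hc, Real.toNNReal_add hp hq]
  have hconv := gaussianReal_conv_gaussianReal (m₁ := 0) (m₂ := 0) (v₁ := p.toNNReal)
    (v₂ := q.toNNReal)
  rw [add_zero] at hconv
  rw [← hconv, integral_conv]
  · have h1 : ∀ u, ∫ w, k (√p * u + √q * w) ∂(gaussianReal 0 1) =
        ∫ w, k (√p * u + w) ∂(gaussianReal 0 q.toNNReal) := fun u =>
      hInt hq (fun w => k (√p * u + w)) (by fun_prop)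
    simp_rw [h1]
    rw [← hmap hp, integral_map (by fun_prop)]
    refine (StronglyMeasurable.integral_prod_right (f := fun u w => k (u + w))
      ?_).aestronglyMeasurable
    exact Continuous.stronglyMeasurable (by fun_prop)
  · rw [hconv]
    simpa using integrable_gaussianReal_affine hc hM 0 1 0 (p.toNNReal + q.toNNReal)

/-- Semigroup property of Gaussian smoothing. -/
lemma gaussSmooth_gaussSmooth {h : ℝ → ℝ} (hc : Continuous h)
    (hM : ∀ u, |h u| ≤ M * (1 + Real.exp u)) {p q : ℝ} (hp : 0 ≤ p) (hq : 0 ≤ q) (x m : ℝ) :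
    gaussSmooth (fun x' => Real.exp x' * gaussSmooth h (q, x' + m)) (p, x) =
      gaussSmooth h (p + q, x + m) := by
  have hM0 : 0 ≤ M := by
    have h1 := (abs_nonneg _).trans (hM 0)
    have h2 := Real.exp_pos 0
    nlinarith
  set d := x + m - (p + q) / 2 with hd
  have key := integral_integral_gaussianReal_add (k := fun v => h (d + v))
    (M := M * (1 + Real.exp d))
    (by fun_prop) ?_ hp hq
  · have e1 : ∀ u, Real.exp (x + √p * u - p / 2) * gaussSmooth h (q, x + √p * u - p / 2 + m) =
        Real.exp (-m) * ∫ w, h (d + (√p * u + √q * w)) ∂(gaussianReal 0 1) := by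
      intro u
      simp only [gaussSmooth]
      rw [← mul_assoc, ← Real.exp_add]
      congr 2
      · ring
      · ext w
        congr 1
        rw [hd]
        ring
    simp only [gaussSmooth] at e1 ⊢
    simp only [e1]
    rw [integral_const_mul, key, ← mul_assoc, ← Real.exp_add]
    congr 2
    · ring
    · ext w
      congr 1
      rw [hd]
      ring
  · intro u
    refine (hM _).trans ?_
    rw [Real.exp_add]
    nlinarith [Real.exp_pos d, Real.exp_pos u, mul_nonneg hM0 (Real.exp_nonneg d),
      mul_nonneg hM0 (Real.exp_nonneg u)]

lemma integral_lognormal (φ : ℝ → ℝ) {q : ℝ} (hq : 0 < q) (ℓ m : ℝ) :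
    ∫ x in Ioi (0:ℝ), φ x * (Real.exp (-((Real.log x - ℓ - (m - q / 2)) / √q) ^ 2 / 2) /
      (√(2 * π) * x * √q)) =
      ∫ u, φ (Real.exp (ℓ + m + √q * u - q / 2)) ∂(gaussianReal 0 1) := by
  have h1 : ∀ u, φ (Real.exp (ℓ + m + √q * u - q / 2)) =
      (fun w => φ (Real.exp w)) (ℓ + m - q / 2 + √q * u) := by
    intro u
    simp only
    ring_nf
  simp_rw [h1]
  rw [integral_gaussianReal_affine (fun w => φ (Real.exp w)) _ hq, ← Real.range_exp, ← image_univ,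
    integral_image_eq_integral_abs_deriv_smul MeasurableSet.univ
      (fun x _ => (Real.hasDerivAt_exp x).hasDerivWithinAt) Real.exp_injective.injOn,
    setIntegral_univ]
  refine integral_congr_ae (Eventually.of_forall fun w => ?_)
  simp only [Real.abs_exp, smul_eq_mul, Real.log_exp]
  have h2 : -((w - ℓ - (m - q / 2)) / √q) ^ 2 / 2 = -(w - (ℓ + m - q / 2)) ^ 2 / (2 * q) := by
    rw [div_pow, Real.sq_sqrt hq.le]
    field_simp
    ring
  rw [h2, Real.sqrt_mul (by positivity) q]
  have := Real.exp_pos w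
  have : 0 < √q := Real.sqrt_pos.mpr hq
  field_simp

end GaussSmooth

section Slices

variable {F : Type*} [NormedAddCommGroup F] [NormedSpace ℝ F]

lemma hasDerivAt_slice_fst {f : ℝ × ℝ → F} {f' : ℝ × ℝ →L[ℝ] F} {p x : ℝ}
    (hf : HasFDerivAt f f' (p, x)) : HasDerivAt (fun u => f (u, x)) (f' (1, 0)) p :=
  hf.comp_hasDerivAt p ((hasDerivAt_id p).prodMk (hasDerivAt_const p x))

lemma hasDerivAt_slice_snd {f : ℝ × ℝ → F} {f' : ℝ × ℝ →L[ℝ] F} {p x : ℝ}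
    (hf : HasFDerivAt f f' (p, x)) : HasDerivAt (fun u => f (p, u)) (f' (0, 1)) x :=
  hf.comp_hasDerivAt x ((hasDerivAt_const x p).prodMk (hasDerivAt_id x))

end Slices

section HeatEquation

variable {h : ℝ → ℝ} {M : ℝ}

lemma hasDerivAt_gaussMoment_comp (hc : Continuous h) (hM : ∀ u, |h u| ≤ M * (1 + Real.exp u))
    (m : ℕ) {α β : ℝ → ℝ} {α' β' t : ℝ} (hα : HasDerivAt α α' t) (hβ : HasDerivAt β β' t)
    (ht : 0 < α t) : HasDerivAt (fun τ => gaussMoment h m (α τ, β τ))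
      (gaussMoment h (m + 1) (α t, β t) * β' - gaussMoment h (m + 2) (α t, β t) * α') t := by
  have h1 := (hasFDerivAt_gaussMoment hc hM m (a := (α t, β t)) ht).comp_hasDerivAt t
    (hα.prodMk hβ)
  exact h1.congr_deriv (by simp)

/-- Gaussian prefactor of `gaussSmooth` in terms of the moments. -/
noncomputable def gaussPrefactor (p x : ℝ) : ℝ :=
  (√(2 * π * p))⁻¹ * Real.exp (-(x ^ 2 / (2 * p)) - x / 2 - p / 8)

lemma gaussSmooth_eq_moment (h : ℝ → ℝ) {p : ℝ} (hp : 0 < p) (x : ℝ) :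
    gaussSmooth h (p, x) = gaussPrefactor p x * gaussMoment h 0 ((2 * p)⁻¹, x / p - 1 / 2) := by
  have h1 := integral_gaussianReal_affine h (x - p / 2) hp
  have h2 : ∀ u, h (x + √p * u - p / 2) = h (x - p / 2 + √p * u) := fun u => by ring_nf
  simp only [gaussSmooth, gaussPrefactor, gaussMoment, h2]
  rw [h1, ← integral_const_mul, ← integral_const_mul]
  refine integral_congr_ae (Eventually.of_forall fun w => ?_)
  have h3 : Real.exp (-x) * Real.exp (-(w - (x - p / 2)) ^ 2 / (2 * p)) =
      Real.exp (-(x ^ 2 / (2 * p)) - x / 2 - p / 8) *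
        Real.exp (-((2 * p)⁻¹ * w ^ 2) + (x / p - 1 / 2) * w) := by
    rw [← Real.exp_add, ← Real.exp_add]
    congr 1
    field_simp
    ring
  simp only [pow_zero, mul_one]
  linear_combination (√(2 * π * p))⁻¹ * h w * h3

lemma hasDerivAt_gaussPrefactor_snd (p x : ℝ) :
    HasDerivAt (fun x => gaussPrefactor p x) (gaussPrefactor p x * (-(x / p) - 1 / 2)) x := by
  have h1 : HasDerivAt (fun x : ℝ => -(x ^ 2 / (2 * p)) - x / 2 - p / 8)
      (-(x / p) - 1 / 2) x := by
    have h2 := ((((hasDerivAt_pow 2 x).div_const (2 * p)).neg).sub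
      ((hasDerivAt_id x).div_const 2)).sub_const (p / 8)
    refine h2.congr_deriv ?_
    rcases eq_or_ne p 0 with rfl | hp
    · simp
    · field_simp
      push_cast
      ring
  have h2 := h1.exp.const_mul (√(2 * π * p))⁻¹
  rwa [← mul_assoc] at h2

lemma hasDerivAt_gaussPrefactor_fst {p : ℝ} (hp : 0 < p) (x : ℝ) :
    HasDerivAt (fun p => gaussPrefactor p x)
      (gaussPrefactor p x * (-(1 / (2 * p)) + x ^ 2 / (2 * p ^ 2) - 1 / 8)) p := by
  have h1 : HasDerivAt (fun p : ℝ => -(x ^ 2 / (2 * p)) - x / 2 - p / 8)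
      (x ^ 2 / (2 * p ^ 2) - 1 / 8) p := by
    have h2 := (((hasDerivAt_const p (x ^ 2)).div ((hasDerivAt_id p).const_mul 2)
      (by simpa using hp.ne')).neg.sub_const (x / 2)).sub ((hasDerivAt_id p).div_const 8)
    refine h2.congr_deriv ?_
    simp only [id]
    field_simp
    ring
  have h3 : HasDerivAt (fun p : ℝ => (√(2 * π * p))⁻¹) ((√(2 * π * p))⁻¹ * (-(1 / (2 * p)))) p := by
    have h5 : 0 < 2 * π * p := by positivity
    have h4 := (((hasDerivAt_id p).const_mul (2 * π)).sqrt h5.ne').inv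
      (Real.sqrt_pos.mpr h5).ne'
    refine h4.congr_deriv ?_
    have h6 := Real.sqrt_pos.mpr h5
    have h7 := Real.sq_sqrt h5.le
    simp only [id]
    rw [h7]
    field_simp
  have h2 := h3.mul h1.exp
  refine h2.congr_deriv ?_
  simp only [gaussPrefactor]
  ring

lemma contDiffOn_gaussSmooth (hc : Continuous h) (hM : ∀ u, |h u| ≤ M * (1 + Real.exp u))
    (n : ℕ) : ContDiffOn ℝ n (gaussSmooth h) {a | 0 < a.1} := by
  have h1 : ContDiffOn ℝ n (fun a : ℝ × ℝ => gaussPrefactor a.1 a.2 *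
      gaussMoment h 0 ((2 * a.1)⁻¹, a.2 / a.1 - 1 / 2)) {a | 0 < a.1} := by
    refine ContDiffOn.mul ?_ ?_
    · intro a ha
      have ha : 0 < a.1 := ha
      have h2 : 2 * π * a.1 ≠ 0 := by positivity
      have h3 : √(2 * π * a.1) ≠ 0 := by positivity
      have h4 : 2 * a.1 ≠ 0 := by positivity
      refine ContDiffAt.contDiffWithinAt ?_
      unfold gaussPrefactor
      fun_prop (disch := assumption)
    · refine (contDiffOn_gaussMoment hc hM n 0).comp (fun a ha => ?_) (fun a ha => ?_)
      · have ha : 0 < a.1 := ha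
        have h4 : 2 * a.1 ≠ 0 := by positivity
        have h5 : a.1 ≠ 0 := by positivity
        refine ContDiffAt.contDiffWithinAt ?_
        fun_prop (disch := assumption)
      · have ha : 0 < a.1 := ha
        simp only [mem_ofPred_eq]
        positivity
  exact h1.congr fun a ha => gaussSmooth_eq_moment h ha a.2

lemma gaussSmooth_heat (hc : Continuous h) (hM : ∀ u, |h u| ≤ M * (1 + Real.exp u))
    {a : ℝ × ℝ} (ha : 0 < a.1) :
    fderiv ℝ (gaussSmooth h) a (1, 0) = 1 / 2 *
      (fderiv ℝ (fun b => fderiv ℝ (gaussSmooth h) b (0, 1)) a (0, 1) +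
        fderiv ℝ (gaussSmooth h) a (0, 1)) := by
  obtain ⟨p, x⟩ := a
  have ha : 0 < p := ha
  have hopen : IsOpen {a : ℝ × ℝ | 0 < a.1} := isOpen_lt continuous_const continuous_fst
  have hcd : ∀ b : ℝ × ℝ, 0 < b.1 → ContDiffAt ℝ 2 (gaussSmooth h) b := fun b hb =>
    (contDiffOn_gaussSmooth hc hM 2).contDiffAt (hopen.mem_nhds hb)
  have hdf : ∀ b : ℝ × ℝ, 0 < b.1 → DifferentiableAt ℝ (gaussSmooth h) b := fun b hb =>
    (hcd b hb).differentiableAt (by norm_num)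
  have hα : ∀ {p : ℝ}, 0 < p → HasDerivAt (fun p : ℝ => (2 * p)⁻¹) (-(1 / (2 * p ^ 2))) p := by
    intro p hp
    have h1 := ((hasDerivAt_id p).const_mul 2).inv (by simpa using hp.ne')
    refine h1.congr_deriv ?_
    simp only [id]
    field_simp
  have hβp : HasDerivAt (fun p : ℝ => x / p - 1 / 2) (-(x / p ^ 2)) p := by
    have h1 := ((hasDerivAt_const p x).div (hasDerivAt_id p) ha.ne').sub_const (1 / 2)
    refine h1.congr_deriv ?_
    simp only [id]
    field_simp
    ring
  have hβx : ∀ p x : ℝ, HasDerivAt (fun x : ℝ => x / p - 1 / 2) (1 / p) x := fun p x =>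
    ((hasDerivAt_id x).div_const p).sub_const (1 / 2)
  have hmx : ∀ (m : ℕ) {p : ℝ}, 0 < p → ∀ x, HasDerivAt
      (fun x => gaussMoment h m ((2 * p)⁻¹, x / p - 1 / 2))
      (gaussMoment h (m + 1) ((2 * p)⁻¹, x / p - 1 / 2) * (1 / p)) x := by
    intro m p hp x
    have h1 := hasDerivAt_gaussMoment_comp hc hM m (hasDerivAt_const x (2 * p)⁻¹) (hβx p x)
      (by positivity)
    simpa using h1
  have hmp := hasDerivAt_gaussMoment_comp hc hM 0 (hα ha) hβp (by positivity)
  set fx : ℝ × ℝ → ℝ := fun a => gaussPrefactor a.1 a.2 *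
    ((-(a.2 / a.1) - 1 / 2) * gaussMoment h 0 ((2 * a.1)⁻¹, a.2 / a.1 - 1 / 2) +
      gaussMoment h 1 ((2 * a.1)⁻¹, a.2 / a.1 - 1 / 2) * (1 / a.1)) with hfx
  have hx : ∀ b : ℝ × ℝ, 0 < b.1 → fderiv ℝ (gaussSmooth h) b (0, 1) = fx b := by
    intro b hb
    have h1 := hasDerivAt_slice_snd (p := b.1) (x := b.2) (hdf b hb).hasFDerivAt
    have h2 := (hasDerivAt_gaussPrefactor_snd b.1 b.2).mul (hmx 0 hb b.2)
    have h3 : (fun u => gaussSmooth h (b.1, u)) = fun u => gaussPrefactor b.1 u *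
        gaussMoment h 0 ((2 * b.1)⁻¹, u / b.1 - 1 / 2) := by
      ext u
      exact gaussSmooth_eq_moment h hb u
    rw [h3] at h1
    rw [h1.unique h2, hfx]
    ring_nf
  have hxx : fderiv ℝ (fun b => fderiv ℝ (gaussSmooth h) b (0, 1)) (p, x) (0, 1) =
      gaussPrefactor p x * (((x / p + 1 / 2) ^ 2 - 1 / p) *
        gaussMoment h 0 ((2 * p)⁻¹, x / p - 1 / 2)
        - 2 * (x / p + 1 / 2) * (1 / p) * gaussMoment h 1 ((2 * p)⁻¹, x / p - 1 / 2)
        + gaussMoment h 2 ((2 * p)⁻¹, x / p - 1 / 2) * (1 / p) ^ 2) := by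
    have h0 : DifferentiableAt ℝ (fun b => fderiv ℝ (gaussSmooth h) b (0, 1)) (p, x) := by
      have h1 : ContDiffAt ℝ 1 (fderiv ℝ (gaussSmooth h)) (p, x) :=
        (hcd (p, x) ha).fderiv_right (by norm_num)
      exact (h1.differentiableAt (by norm_num)).clm_apply (differentiableAt_const _)
    have h1 := hasDerivAt_slice_snd h0.hasFDerivAt
    have h3 : (fun u => fderiv ℝ (gaussSmooth h) (p, u) (0, 1)) = fun u => fx (p, u) := by
      ext u
      exact hx (p, u) ha
    rw [h3] at h1
    have h4 : HasDerivAt (fun x : ℝ => -(x / p) - 1 / 2) (-(1 / p)) x :=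
      (((hasDerivAt_id x).div_const p).neg).sub_const (1 / 2)
    have h2 := (hasDerivAt_gaussPrefactor_snd p x).mul
      ((h4.mul (hmx 0 ha x)).add ((hmx 1 ha x).mul_const (1 / p)))
    rw [h1.unique h2]
    simp only [Nat.reduceAdd, Pi.mul_apply, Pi.add_apply]
    ring
  have hp1 : fderiv ℝ (gaussSmooth h) (p, x) (1, 0) =
      gaussPrefactor p x * (-(1 / (2 * p)) + x ^ 2 / (2 * p ^ 2) - 1 / 8) *
        gaussMoment h 0 ((2 * p)⁻¹, x / p - 1 / 2) + gaussPrefactor p x *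
      (gaussMoment h 1 ((2 * p)⁻¹, x / p - 1 / 2) * -(x / p ^ 2) -
        gaussMoment h 2 ((2 * p)⁻¹, x / p - 1 / 2) * -(1 / (2 * p ^ 2))) := by
    have h1 := hasDerivAt_slice_fst (hdf (p, x) ha).hasFDerivAt
    have h2 := (hasDerivAt_gaussPrefactor_fst ha x).mul hmp
    have h3 : (fun u => gaussSmooth h (u, x)) =ᶠ[𝓝 p] fun u => gaussPrefactor u x *
        gaussMoment h 0 ((2 * u)⁻¹, x / u - 1 / 2) := by
      filter_upwards [lt_mem_nhds ha] with u hu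
      exact gaussSmooth_eq_moment h hu x
    exact h1.unique (h2.congr_of_eventuallyEq h3)
  rw [hp1, hxx, hx _ ha, hfx]
  simp only
  have := ha.ne'
  field_simp
  ring

end HeatEquation

section Uniqueness

lemma HasDerivAt.nonneg_of_forall_le_right {f : ℝ → ℝ} {f' a b : ℝ} (hf : HasDerivAt f f' a)
    (hab : a < b) (h : ∀ x, a ≤ x → x < b → f a ≤ f x) : 0 ≤ f' := by
  have h1 := (hasDerivWithinAt_iff_tendsto_slope' (s := Ioi a) (x := a) (by simp)).mp
    hf.hasDerivWithinAt
  refine ge_of_tendsto h1 ?_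
  filter_upwards [Ioo_mem_nhdsGT hab] with x hx
  rw [slope_def_field]
  exact div_nonneg (sub_nonneg.mpr (h x hx.1.le hx.2)) (sub_nonneg.mpr hx.1.le)

lemma IsLocalMin.deriv_deriv_nonneg {f : ℝ → ℝ} {a : ℝ} (h : IsLocalMin f a)
    (hf : ContinuousAt f a) : 0 ≤ deriv (deriv f) a := by
  by_contra! hneg
  have h2 : deriv (deriv (-f)) a = -deriv (deriv f) a := by
    have h1 : deriv (-f) = -deriv f := by
      ext x
      exact deriv.neg
    rw [h1]
    exact deriv.neg
  have h3 : IsLocalMin (-f) a := by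
    refine isLocalMin_of_deriv_deriv_pos (by rw [h2]; linarith) ?_ hf.neg
    rw [deriv.neg, h.deriv_eq_zero, neg_zero]
  have h4 : f =ᶠ[𝓝 a] fun _ => f a := by
    filter_upwards [h, h3] with x hx hx'
    simp only [Pi.neg_apply] at hx'
    linarith
  have h5 : deriv (deriv f) a = 0 := by
    have h6 := h4.deriv
    rw [h6.deriv_eq]
    simp
  linarith

variable {T r S M : ℝ} {σ : ℝ → ℝ} {D : ℝ → ℝ → ℝ}

/-- Comparison principle for the Black–Scholes–Merton equation in the class of functions of at most
linear growth. -/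
lemma bsm_nonneg (hr : 0 ≤ r) (hσ : ∀ t ∈ Ioo 0 T, σ t ^ 2 ≤ S)
    (hcont : ContinuousOn (fun q : ℝ × ℝ => D q.1 q.2) (Icc 0 T ×ˢ Ioi 0))
    (hM : ∀ t ∈ Icc 0 T, ∀ s, 0 < s → |D t s| ≤ M * (1 + s))
    (hT : ∀ s, 0 < s → D T s = 0)
    (ht : ∀ t ∈ Ioo 0 T, ∀ s, 0 < s → DifferentiableAt ℝ (fun u => D u s) t)
    (hs : ∀ t ∈ Ioo 0 T, ∀ s, 0 < s → DifferentiableAt ℝ (D t) s)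
    (hss : ∀ t ∈ Ioo 0 T, ∀ s, 0 < s → DifferentiableAt ℝ (deriv (D t)) s)
    (hpde : ∀ t ∈ Ioo 0 T, ∀ s, 0 < s → deriv (fun u => D u s) t + r * s * deriv (D t) s +
      1 / 2 * σ t ^ 2 * s ^ 2 * deriv (deriv (D t)) s = r * D t s)
    {t s : ℝ} (htT : t ∈ Ioo 0 T) (hs0 : 0 < s) : 0 ≤ D t s := by
  by_contra! hneg
  have hM0 : 0 ≤ M := by
    have h1 := (abs_nonneg _).trans (hM t (Ioo_subset_Icc_self htT) s hs0)
    by_contra! h2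
    nlinarith
  set C := S + r + 1 with hC
  set W : ℝ → ℝ → ℝ := fun t s => Real.exp (C * (T - t)) * (s ^ 2 + s⁻¹) with hW
  have hWpos : ∀ t s, 0 < s → 0 < W t s := fun t s hs => by simp only [hW]; positivity
  set ε := -D t s / (2 * W t s) with hε
  have hε0 : 0 < ε := div_pos (by linarith) (by linarith [hWpos t s hs0])
  set N : ℝ → ℝ → ℝ := fun t s => ε * W t s + D t s with hN
  have hNts : N t s < 0 := by
    have h1 : ε * W t s = -D t s / 2 := by
      rw [hε]
      have := (hWpos t s hs0).ne'
      field_simp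
    simp only [hN, h1]
    linarith
  have hC0 : 0 ≤ C := by
    have := (sq_nonneg _).trans (hσ t htT)
    linarith
  set hi := max (s + 1) (max 1 (2 * M / ε)) with hhi
  set lo := min (s / 2) (min 1 (ε / (2 * M + 1))) with hlo
  have hlo0 : 0 < lo := lt_min (by linarith) (lt_min one_pos (by positivity))
  have hlos : lo ≤ s := (min_le_left _ _).trans (by linarith)
  have hshi : s ≤ hi := le_trans (by linarith) (le_max_left _ _)
  have hW1 : ∀ t s, 0 < s → t ≤ T → s ^ 2 + s⁻¹ ≤ W t s := by
    intro t s hs htT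
    have h1 : 1 ≤ Real.exp (C * (T - t)) := Real.one_le_exp (mul_nonneg hC0 (by linarith))
    exact le_mul_of_one_le_left (by positivity) h1
  have hNhi : ∀ t ∈ Icc 0 T, 0 ≤ N t hi := by
    intro t ht
    have h0 : 1 ≤ hi := (le_max_left _ _).trans (le_max_right _ _)
    have h1 := hW1 t hi (by linarith) ht.2
    have h2 := (abs_le.mp (hM t ht hi (by linarith))).1
    have h3 : 2 * M ≤ hi * ε := by
      rw [← div_le_iff₀ hε0]
      exact (le_max_right _ _).trans (le_max_right _ _)
    have h4 : 0 < hi⁻¹ := by positivity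
    have h5 : ε * hi ^ 2 ≤ ε * W t hi := by gcongr; linarith
    simp only [hN]
    nlinarith
  have hNlo : ∀ t ∈ Icc 0 T, 0 ≤ N t lo := by
    intro t ht
    have h0 : lo ≤ 1 := (min_le_right _ _).trans (min_le_left _ _)
    have h1 := hW1 t lo hlo0 ht.2
    have h2 := (abs_le.mp (hM t ht lo hlo0)).1
    have h3 : 2 * M + 1 ≤ ε * lo⁻¹ := by
      rw [← div_eq_mul_inv, le_div_comm₀ (by positivity) hlo0]
      exact (min_le_right _ _).trans (min_le_right _ _)
    have h5 : ε * lo⁻¹ ≤ ε * W t lo := by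
      gcongr
      have := sq_nonneg lo
      linarith
    simp only [hN]
    nlinarith
  have hNT : ∀ s, 0 < s → 0 ≤ N T s := by
    intro s hs
    simp only [hN, hT s hs, add_zero]
    exact (mul_pos hε0 (hWpos T s hs)).le
  have hsub : Icc (t / 2) T ×ˢ Icc lo hi ⊆ Icc 0 T ×ˢ Ioi 0 :=
    prod_mono (Icc_subset_Icc_left (by linarith [htT.1])) fun x hx => hlo0.trans_le hx.1
  have hNc : ContinuousOn (fun q : ℝ × ℝ => N q.1 q.2) (Icc (t / 2) T ×ˢ Icc lo hi) := by
    refine ContinuousOn.add (ContinuousOn.mul continuousOn_const (ContinuousOn.mul (by fun_prop)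
      (ContinuousOn.add (by fun_prop) (ContinuousOn.inv₀ (by fun_prop) ?_)))) (hcont.mono hsub)
    intro q hq
    exact (hlo0.trans_le hq.2.1).ne'
  obtain ⟨⟨t₀, s₀⟩, hq, hmin⟩ := (isCompact_Icc.prod isCompact_Icc).exists_isMinOn
    ⟨(t, s), ⟨⟨by linarith [htT.1], htT.2.le⟩, hlos, hshi⟩⟩ hNc
  have hmin : ∀ u x, u ∈ Icc (t / 2) T → x ∈ Icc lo hi → N t₀ s₀ ≤ N u x := fun u x hu hx =>
    hmin (mk_mem_prod hu hx)
  have hN0 : N t₀ s₀ < 0 := (hmin t s ⟨by linarith [htT.1], htT.2.le⟩ ⟨hlos, hshi⟩).trans_lt hNts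
  have ht₀ : t₀ ∈ Icc 0 T := (hsub hq).1
  have hs₀ : 0 < s₀ := (hsub hq).2
  have ht₀T : t₀ < T := by
    refine lt_of_le_of_ne ht₀.2 fun h => ?_
    rw [h] at hN0
    exact (hNT s₀ hs₀).not_gt hN0
  have ht₀' : t₀ ∈ Ioo 0 T := ⟨lt_of_lt_of_le (by linarith [htT.1]) hq.1.1, ht₀T⟩
  have hs₀lo : lo < s₀ := by
    refine lt_of_le_of_ne hq.2.1 fun h => ?_
    rw [← h] at hN0
    exact (hNlo t₀ ht₀).not_gt hN0
  have hs₀hi : s₀ < hi := by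
    refine lt_of_le_of_ne hq.2.2 fun h => ?_
    rw [h] at hN0
    exact (hNhi t₀ ht₀).not_gt hN0
  set e := Real.exp (C * (T - t₀)) with he
  have he0 : 0 < e := Real.exp_pos _
  have hNt : HasDerivAt (fun u => N u s₀)
      (ε * (-C * W t₀ s₀) + deriv (fun u => D u s₀) t₀) t₀ := by
    have h1 : HasDerivAt (fun u => C * (T - u)) (-C) t₀ := by
      simpa using ((hasDerivAt_id t₀).const_sub T).const_mul C
    have h2 := ((h1.exp.mul_const (s₀ ^ 2 + s₀⁻¹)).const_mul ε).add (ht t₀ ht₀' s₀ hs₀).hasDerivAt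
    refine h2.congr_deriv ?_
    simp only [hW]
    ring
  have hNx : ∀ x, 0 < x → HasDerivAt (N t₀)
      (ε * (e * (2 * x - (x ^ 2)⁻¹)) + deriv (D t₀) x) x := by
    intro x hx
    have h2 := ((((hasDerivAt_pow 2 x).add (hasDerivAt_inv hx.ne')).const_mul e).const_mul ε).add
      (hs t₀ ht₀' x hx).hasDerivAt
    refine h2.congr_deriv ?_
    push_cast
    ring
  have hNxx : HasDerivAt (deriv (N t₀))
      (ε * (e * (2 + 2 * (s₀ ^ 3)⁻¹)) + deriv (deriv (D t₀)) s₀) s₀ := by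
    have h1 : deriv (N t₀) =ᶠ[𝓝 s₀]
        fun x => ε * (e * (2 * x - (x ^ 2)⁻¹)) + deriv (D t₀) x := by
      filter_upwards [lt_mem_nhds hs₀] with x hx
      exact (hNx x hx).deriv
    refine HasDerivAt.congr_of_eventuallyEq ?_ h1
    have h2 := (((((hasDerivAt_id s₀).const_mul 2).sub ((hasDerivAt_pow 2 s₀).inv
      (pow_pos hs₀ 2).ne')).const_mul e).const_mul ε).add (hss t₀ ht₀' s₀ hs₀).hasDerivAt
    refine h2.congr_deriv ?_
    have := hs₀.ne'
    push_cast
    field_simp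
    ring
  have hloc : IsLocalMin (N t₀) s₀ := by
    filter_upwards [Icc_mem_nhds hs₀lo hs₀hi] with x hx
    exact hmin t₀ x hq.1 hx
  have hA : 0 ≤ ε * (-C * W t₀ s₀) + deriv (fun u => D u s₀) t₀ :=
    hNt.nonneg_of_forall_le_right ht₀T fun u hu huT =>
      hmin u s₀ ⟨hq.1.1.trans hu, huT.le⟩ hq.2
  have hB : ε * (e * (2 * s₀ - (s₀ ^ 2)⁻¹)) + deriv (D t₀) s₀ = 0 := by
    rw [← (hNx s₀ hs₀).deriv]
    exact hloc.deriv_eq_zero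
  have hE : 0 ≤ ε * (e * (2 + 2 * (s₀ ^ 3)⁻¹)) + deriv (deriv (D t₀)) s₀ := by
    rw [← hNxx.deriv]
    exact hloc.deriv_deriv_nonneg (hNx s₀ hs₀).continuousAt
  have hP := hpde t₀ ht₀' s₀ hs₀
  have hσS := hσ t₀ ht₀'
  have hE2 := mul_nonneg (by positivity : 0 ≤ 1 / 2 * σ t₀ ^ 2 * s₀ ^ 2) hE
  have hrN : r * (ε * W t₀ s₀ + D t₀ s₀) ≤ 0 := mul_nonpos_of_nonneg_of_nonpos hr hN0.le
  set w := s₀ ^ 2 + s₀⁻¹ with hw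
  have hw0 : 0 < w := by positivity
  have hWw : W t₀ s₀ = e * w := rfl
  have hi1 : s₀ ^ 2 * (1 + (s₀ ^ 3)⁻¹) = w := by
    have := hs₀.ne'
    rw [hw]
    field_simp
  have hi2 : s₀ * (2 * s₀ - (s₀ ^ 2)⁻¹) = 2 * w - 3 * s₀⁻¹ := by
    have := hs₀.ne'
    rw [hw]
    field_simp
    ring
  have hb : r * s₀ * deriv (D t₀) s₀ = -(r * ε * e * (2 * w - 3 * s₀⁻¹)) := by
    linear_combination r * s₀ * hB - r * ε * e * hi2
  have hd : 0 ≤ σ t₀ ^ 2 * (ε * e * w) + 1 / 2 * σ t₀ ^ 2 * s₀ ^ 2 * deriv (deriv (D t₀)) s₀ := by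
    linarith [congrArg (fun x => σ t₀ ^ 2 * ε * e * x) hi1]
  rw [hWw] at hrN hA
  have hpos : 0 < ε * e * w := by positivity
  have hpos2 : 0 ≤ r * ε * e * s₀⁻¹ := by positivity
  have h8 : 0 ≤ (S - σ t₀ ^ 2) * (ε * e * w) := mul_nonneg (by linarith) hpos.le
  rw [hC] at hA
  linarith

/-- Uniqueness for the Black–Scholes–Merton equation in the class of functions of at most linear
growth. -/
lemma bsm_eq_zero (hr : 0 ≤ r) (hσ : ∀ t ∈ Ioo 0 T, σ t ^ 2 ≤ S)
    (hcont : ContinuousOn (fun q : ℝ × ℝ => D q.1 q.2) (Icc 0 T ×ˢ Ioi 0))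
    (hM : ∀ t ∈ Icc 0 T, ∀ s, 0 < s → |D t s| ≤ M * (1 + s))
    (hT : ∀ s, 0 < s → D T s = 0)
    (ht : ∀ t ∈ Ioo 0 T, ∀ s, 0 < s → DifferentiableAt ℝ (fun u => D u s) t)
    (hs : ∀ t ∈ Ioo 0 T, ∀ s, 0 < s → DifferentiableAt ℝ (D t) s)
    (hss : ∀ t ∈ Ioo 0 T, ∀ s, 0 < s → DifferentiableAt ℝ (deriv (D t)) s)
    (hpde : ∀ t ∈ Ioo 0 T, ∀ s, 0 < s → deriv (fun u => D u s) t + r * s * deriv (D t) s +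
      1 / 2 * σ t ^ 2 * s ^ 2 * deriv (deriv (D t)) s = r * D t s)
    {t s : ℝ} (htT : t ∈ Ioo 0 T) (hs0 : 0 < s) : D t s = 0 := by
  refine le_antisymm ?_ (bsm_nonneg hr hσ hcont hM hT ht hs hss hpde htT hs0)
  have hd1 : ∀ t, deriv (fun x => -D t x) = fun x => -deriv (D t) x := fun t => by
    ext x
    exact deriv.fun_neg
  have h := bsm_nonneg (D := fun t x => -D t x) hr hσ hcont.neg
    (fun t ht s hs => by simpa using hM t ht s hs) (fun s hs => by simp [hT s hs])
    (fun t h s h' => (ht t h s h').neg) (fun t h s h' => (hs t h s h').neg)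
    (fun t h s h' => by
      rw [hd1]
      exact (hss t h s h').neg)
    (fun t h s h' => by
      rw [hd1, deriv.fun_neg, deriv.fun_neg]
      linarith [hpde t h s h']) htT hs0
  linarith

end Uniqueness

section LogPrice

/-- In log-price coordinates, the first two derivatives of `s ↦ s * f (log s + m)`. -/
lemma hasDerivAt_mul_comp_log {f f' : ℝ → ℝ} {s m : ℝ} (hs : 0 < s)
    (hf : HasDerivAt f (f' (Real.log s + m)) (Real.log s + m)) :
    HasDerivAt (fun s => s * f (Real.log s + m)) (f (Real.log s + m) + f' (Real.log s + m)) s := by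
  have h1 : HasDerivAt (fun s => Real.log s + m) s⁻¹ s := (Real.hasDerivAt_log hs.ne').add_const m
  refine ((hasDerivAt_id s).mul (HasDerivAt.comp s hf h1)).congr_deriv ?_
  have := hs.ne'
  simp only [id, Function.comp]
  field_simp

lemma hasDerivAt_add_comp_log {f g : ℝ → ℝ} {f' g' s m : ℝ} (hs : 0 < s)
    (hf : HasDerivAt f f' (Real.log s + m)) (hg : HasDerivAt g g' (Real.log s + m)) :
    HasDerivAt (fun s => f (Real.log s + m) + g (Real.log s + m)) ((f' + g') / s) s := by
  have h1 : HasDerivAt (fun s => Real.log s + m) s⁻¹ s := (Real.hasDerivAt_log hs.ne').add_const m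
  refine ((HasDerivAt.comp s hf h1).add (HasDerivAt.comp s hg h1)).congr_deriv ?_
  rw [← add_mul, div_eq_mul_inv]

end LogPrice

section BSM

variable {T r M : ℝ} {σ : ℝ → ℝ} {h : ℝ → ℝ}

/-- Accumulated variance. -/
noncomputable def cumVar (σ : ℝ → ℝ) (u : ℝ) : ℝ := ∫ w in (0:ℝ)..u, σ (max w 0) ^ 2

lemma continuous_comp_max (hσ : ContinuousOn σ (Ici 0)) : Continuous fun w => σ (max w 0) :=
  hσ.comp_continuous (by fun_prop) fun w => mem_Ici.mpr (le_max_right w 0)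

lemma hasDerivAt_cumVar (hσ : ContinuousOn σ (Ici 0)) (u : ℝ) :
    HasDerivAt (cumVar σ) (σ (max u 0) ^ 2) u :=
  (((continuous_comp_max hσ).pow 2).integral_hasStrictDerivAt 0 u).hasDerivAt

lemma continuous_cumVar (hσ : ContinuousOn σ (Ici 0)) : Continuous (cumVar σ) :=
  continuous_iff_continuousAt.mpr fun u => (hasDerivAt_cumVar hσ u).continuousAt

lemma cumVar_sub (hσ : ContinuousOn σ (Ici 0)) (u v : ℝ) :
    cumVar σ v - cumVar σ u = ∫ w in u..v, σ (max w 0) ^ 2 :=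
  intervalIntegral.integral_interval_sub_left
    (((continuous_comp_max hσ).pow 2).intervalIntegrable _ _)
    (((continuous_comp_max hσ).pow 2).intervalIntegrable _ _)

lemma cumVar_strictMono (hσ : ContinuousOn σ (Ici 0)) (hσ0 : ∀ u, 0 ≤ u → 0 < σ u) :
    StrictMono (cumVar σ) :=
  strictMono_of_deriv_pos fun u => by
    rw [(hasDerivAt_cumVar hσ u).deriv]
    exact pow_pos (hσ0 _ (le_max_right _ _)) 2

/-- Gaussian smoothing of the payoff gives the solution of the Black–Scholes–Merton equation. -/
lemma bsm_eq_gaussSmooth (hT0 : 0 < T) (hr : 0 ≤ r) (hσ : ContinuousOn σ (Ici 0))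
    (hσ0 : ∀ u, 0 ≤ u → 0 < σ u) (hc : Continuous h) (hM : ∀ u, |h u| ≤ M * (1 + Real.exp u))
    {ρ : ℝ → ℝ → ℝ} {M' : ℝ}
    (hcont : ContinuousOn (fun q : ℝ × ℝ => ρ q.1 q.2) (Icc 0 T ×ˢ Ioi 0))
    (hM' : ∀ t ∈ Icc 0 T, ∀ s, 0 < s → |ρ t s| ≤ M' * (1 + s))
    (hT : ∀ s, 0 < s → ρ T s = h (Real.log s))
    (ht : ∀ t ∈ Ioo 0 T, ∀ s, 0 < s → DifferentiableAt ℝ (fun u => ρ u s) t)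
    (hs : ∀ t ∈ Ioo 0 T, ∀ s, 0 < s → DifferentiableAt ℝ (ρ t) s)
    (hss : ∀ t ∈ Ioo 0 T, ∀ s, 0 < s → DifferentiableAt ℝ (deriv (ρ t)) s)
    (hpde : ∀ t ∈ Ioo 0 T, ∀ s, 0 < s → deriv (fun u => ρ u s) t + r * s * deriv (ρ t) s +
      1 / 2 * σ t ^ 2 * s ^ 2 * deriv (deriv (ρ t)) s = r * ρ t s)
    {t s : ℝ} (htT : t ∈ Icc 0 T) (hs0 : 0 < s) :
    ρ t s = s * gaussSmooth h (cumVar σ T - cumVar σ t, Real.log s + r * (T - t)) := by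
  set V : ℝ → ℝ → ℝ := fun t s =>
    s * gaussSmooth h (cumVar σ T - cumVar σ t, Real.log s + r * (T - t)) with hV
  have hM0 : 0 ≤ M := by
    have h1 := (abs_nonneg _).trans (hM 0)
    have h2 := Real.exp_pos 0
    nlinarith
  have hmono := cumVar_strictMono hσ hσ0
  have hVc : ContinuousOn (fun q : ℝ × ℝ => V q.1 q.2) (Icc 0 T ×ˢ Ioi 0) := by
    have hcv := continuous_cumVar hσ
    refine continuousOn_snd.mul ((continuous_gaussSmooth hc hM).comp_continuousOn
      (ContinuousOn.prodMk (by fun_prop) (ContinuousOn.add ?_ (by fun_prop))))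
    exact continuousOn_snd.log fun q hq => ne_of_gt hq.2
  have hVb : ∀ t ∈ Icc 0 T, ∀ s, 0 < s → |V t s| ≤ M * (1 + s) := by
    intro t ht s hs
    have h1 := abs_gaussSmooth_le hM
      (a := (cumVar σ T - cumVar σ t, Real.log s + r * (T - t)))
      (sub_nonneg.mpr (hmono.monotone ht.2))
    have h2 : Real.exp (-(Real.log s + r * (T - t))) ≤ s⁻¹ := by
      rw [neg_add, Real.exp_add, Real.exp_neg, Real.exp_log hs]
      refine mul_le_of_le_one_right (by positivity) (Real.exp_le_one_iff.mpr ?_)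
      have := mul_nonneg hr (sub_nonneg.mpr ht.2)
      linarith
    rw [hV, abs_mul, abs_of_pos hs]
    calc s * _ ≤ s * (M * (1 + s⁻¹)) := by
            gcongr
            refine h1.trans ?_
            gcongr
      _ = M * (1 + s) := by
        have := hs.ne'
        field_simp
        ring
  have hVT : ∀ s, 0 < s → V T s = h (Real.log s) := by
    intro s hs
    simp only [hV, sub_self, mul_zero, add_zero, gaussSmooth_zero]
    rw [Real.exp_neg, Real.exp_log hs, mul_inv_cancel_left₀ hs.ne']
  have hopen : IsOpen {a : ℝ × ℝ | 0 < a.1} := isOpen_lt continuous_const continuous_fst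
  have hcd : ∀ b : ℝ × ℝ, 0 < b.1 → ContDiffAt ℝ 2 (gaussSmooth h) b := fun b hb =>
    (contDiffOn_gaussSmooth hc hM 2).contDiffAt (hopen.mem_nhds hb)
  have hdf : ∀ b : ℝ × ℝ, 0 < b.1 → DifferentiableAt ℝ (gaussSmooth h) b := fun b hb =>
    (hcd b hb).differentiableAt (by norm_num)
  have hdf' : ∀ b : ℝ × ℝ, 0 < b.1 →
      DifferentiableAt ℝ (fun b => fderiv ℝ (gaussSmooth h) b (0, 1)) b := fun b hb =>
    (((hcd b hb).fderiv_right (m := 1) (by norm_num)).differentiableAt (by norm_num)).clm_apply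
      (differentiableAt_const _)
  have hq : ∀ t ∈ Ioo 0 T, 0 < cumVar σ T - cumVar σ t := fun t ht => sub_pos.mpr (hmono ht.2)
  have hVt : ∀ t ∈ Ioo 0 T, ∀ s, HasDerivAt (fun u => V u s)
      (s * fderiv ℝ (gaussSmooth h) (cumVar σ T - cumVar σ t, Real.log s + r * (T - t))
        (-σ t ^ 2, -r)) t := by
    intro t ht s
    have h1 := (hasDerivAt_cumVar hσ t).const_sub (cumVar σ T)
    rw [max_eq_left ht.1.le] at h1
    have h2 : HasDerivAt (fun t => Real.log s + r * (T - t)) (-r) t := by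
      simpa using (((hasDerivAt_id t).const_sub T).const_mul r).const_add (Real.log s)
    exact ((hdf _ (hq t ht)).hasFDerivAt.comp_hasDerivAt t (h1.prodMk h2)).const_mul s
  have hVs : ∀ t ∈ Ioo 0 T, ∀ s, 0 < s → HasDerivAt (V t)
      (gaussSmooth h (cumVar σ T - cumVar σ t, Real.log s + r * (T - t)) +
        fderiv ℝ (gaussSmooth h) (cumVar σ T - cumVar σ t, Real.log s + r * (T - t)) (0, 1)) s :=
    fun t ht s hs => hasDerivAt_mul_comp_log
      (f := fun x => gaussSmooth h (cumVar σ T - cumVar σ t, x))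
      (f' := fun x => fderiv ℝ (gaussSmooth h) (cumVar σ T - cumVar σ t, x) (0, 1)) hs
      (hasDerivAt_slice_snd (hdf _ (hq t ht)).hasFDerivAt)
  have hVss : ∀ t ∈ Ioo 0 T, ∀ s, 0 < s → HasDerivAt (deriv (V t))
      ((fderiv ℝ (gaussSmooth h) (cumVar σ T - cumVar σ t, Real.log s + r * (T - t)) (0, 1) +
        fderiv ℝ (fun b => fderiv ℝ (gaussSmooth h) b (0, 1))
          (cumVar σ T - cumVar σ t, Real.log s + r * (T - t)) (0, 1)) / s) s := by
    intro t ht s hs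
    refine (hasDerivAt_add_comp_log (m := r * (T - t))
      (f := fun x => gaussSmooth h (cumVar σ T - cumVar σ t, x))
      (g := fun x => fderiv ℝ (gaussSmooth h) (cumVar σ T - cumVar σ t, x) (0, 1)) hs
      (hasDerivAt_slice_snd (hdf _ (hq t ht)).hasFDerivAt)
      (hasDerivAt_slice_snd (hdf' _ (hq t ht)).hasFDerivAt)).congr_of_eventuallyEq ?_
    filter_upwards [lt_mem_nhds hs] with x hx
    exact (hVs t ht x hx).deriv
  obtain ⟨S, hS⟩ : ∃ S, ∀ t ∈ Ioo 0 T, σ t ^ 2 ≤ S := by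
    obtain ⟨S, hS⟩ := (isCompact_Icc (a := 0) (b := T)).bddAbove_image
      ((hσ.mono Icc_subset_Ici_self).pow 2)
    exact ⟨S, fun t ht => hS ⟨t, Ioo_subset_Icc_self ht, rfl⟩⟩
  have hds : ∀ t ∈ Ioo 0 T, ∀ s, 0 < s →
      deriv (fun x => ρ t x - V t x) s = deriv (ρ t) s - deriv (V t) s := fun t ht s h0 =>
    deriv_fun_sub (hs t ht s h0) (hVs t ht s h0).differentiableAt
  have hdss : ∀ t ∈ Ioo 0 T, ∀ s, 0 < s →
      deriv (fun x => ρ t x - V t x) =ᶠ[𝓝 s] fun s => deriv (ρ t) s - deriv (V t) s := by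
    intro t ht s h0
    filter_upwards [lt_mem_nhds h0] with x hx
    exact hds t ht x hx
  have key : ∀ t ∈ Ioo 0 T, ∀ s, 0 < s → ρ t s - V t s = 0 := by
    intro t htI s hs0
    refine bsm_eq_zero (D := fun t s => ρ t s - V t s) (M := M' + M) hr hS (hcont.sub hVc)
      (fun t ht s hs => ?_) (fun s hs => by rw [hT s hs, hVT s hs, sub_self])
      (fun t h' s hs => (ht t h' s hs).sub (hVt t h' s).differentiableAt)
      (fun t h' s h0 => (hs t h' s h0).sub (hVs t h' s h0).differentiableAt)
      (fun t h' s h0 => ?_) (fun t h' s h0 => ?_) htI hs0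
    · have h1 := hM' t ht s hs
      have h2 := hVb t ht s hs
      have h3 := abs_sub (ρ t s) (V t s)
      linarith
    · exact ((hss t h' s h0).sub (hVss t h' s h0).differentiableAt).congr_of_eventuallyEq
        (hdss t h' s h0)
    · rw [hds t h' s h0, (hdss t h' s h0).deriv_eq,
        deriv_fun_sub (ht t h' s h0) (hVt t h' s).differentiableAt,
        deriv_fun_sub (hss t h' s h0) (hVss t h' s h0).differentiableAt, (hVt t h' s).deriv,
        (hVs t h' s h0).deriv, (hVss t h' s h0).deriv]
      have h1 := hpde t h' s h0
      have h2 := gaussSmooth_heat hc hM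
        (a := (cumVar σ T - cumVar σ t, Real.log s + r * (T - t))) (hq t h')
      have h3 : ((-σ t ^ 2, -r) : ℝ × ℝ) =
          (-σ t ^ 2) • ((1, 0) : ℝ × ℝ) + (-r) • ((0, 1) : ℝ × ℝ) := by
        simp
      rw [h3, map_add, map_smul, map_smul, smul_eq_mul, smul_eq_mul, h2]
      simp only [hV]
      have := h0.ne'
      field_simp
      field_simp at h1
      linear_combination h1
  have hclos : Icc 0 T ⊆ closure (Ioo 0 T) := by rw [closure_Ioo hT0.ne]
  have hcs : ContinuousOn (fun u => ρ u s - V u s) (Icc 0 T) :=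
    (hcont.sub hVc).comp (f := fun u : ℝ => (u, s)) (by fun_prop) fun u hu => ⟨hu, hs0⟩
  have h1 : EqOn (fun u => ρ u s - V u s) (fun _ => 0) (Ioo 0 T) := fun u hu => key u hu s hs0
  have h0 := h1.of_subset_closure hcs continuousOn_const Ioo_subset_Icc_self hclos
  exact sub_eq_zero.mp (h0 htT)

end BSM

/-- A semi-Markov modulated market on the horizon `T`: continuous transition rates `lam`, interest
rates `r` and volatilities `σ`, with uniform bounds. -/
structure SemiMarkovMarket (k : ℕ) where
  lam : Fin k → Fin k → ℝ → ℝ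
  lam_meas : ∀ i j, i ≠ j → Measurable (lam i j)
  lam_nonneg : ∀ i j, i ≠ j → ∀ y, 0 < y → 0 ≤ lam i j y
  lam_cont : ∀ i j, i ≠ j → ∀ y, 0 < y → ContinuousAt (lam i j) y
  c : ℝ
  c_pos : 0 < c
  sumLam_le : ∀ i y, 0 < y → sumLam lam i y ≤ c
  r : Fin k → ℝ
  r_nonneg : ∀ i, 0 ≤ r i
  σ : ℝ → Fin k → ℝ
  σ_pos : ∀ u, 0 ≤ u → ∀ i, 0 < σ u i
  σ_cont : ∀ i, ContinuousOn (fun u => σ u i) (Ici 0)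
  T : ℝ
  T_pos : 0 < T
  m : ℝ
  m_pos : 0 < m
  S : ℝ≥0
  m_le : ∀ u ∈ Icc 0 T, ∀ i, m ≤ σ u i ^ 2
  le_S : ∀ u ∈ Icc 0 T, ∀ i, σ u i ^ 2 ≤ S
  r_le : ∀ i, r i ≤ S

namespace SemiMarkovMarket

variable {k : ℕ} (P : SemiMarkovMarket k)

lemma measurable_sumLam (i : Fin k) : Measurable (sumLam P.lam i) :=
  Finset.measurable_sum _ fun j hj => P.lam_meas i j (Finset.mem_filter.mp hj).2.symm

lemma sumLam_nonneg (i : Fin k) {y : ℝ} (hy : 0 < y) : 0 ≤ sumLam P.lam i y :=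
  Finset.sum_nonneg fun j hj => P.lam_nonneg i j (Finset.mem_filter.mp hj).2.symm y hy

lemma continuousAt_sumLam (i : Fin k) {y : ℝ} (hy : 0 < y) : ContinuousAt (sumLam P.lam i) y :=
  tendsto_finsetSum _ fun j hj => P.lam_cont i j (Finset.mem_filter.mp hj).2.symm y hy

lemma lam_le (i l : Fin k) (h : i ≠ l) {y : ℝ} (hy : 0 < y) : P.lam i l y ≤ P.c :=
  (Finset.single_le_sum (f := fun j => P.lam i j y)
    (fun j hj => P.lam_nonneg i j (Finset.mem_filter.mp hj).2.symm y hy)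
    (Finset.mem_filter.mpr ⟨Finset.mem_univ l, h.symm⟩)).trans (P.sumLam_le i y hy)

lemma intervalIntegrable_sumLam (i : Fin k) {a b : ℝ} (ha : 0 ≤ a) (hb : 0 ≤ b) :
    IntervalIntegrable (sumLam P.lam i) volume a b := by
  refine (intervalIntegrable_const (c := P.c)).mono_fun'
    (P.measurable_sumLam i).aestronglyMeasurable ?_
  refine (ae_restrict_iff' measurableSet_uIoc).mpr (Eventually.of_forall fun y hy => ?_)
  have hy : 0 < y := (le_min ha hb).trans_lt hy.1
  simpa only [norm_eq_abs, abs_of_nonneg (P.sumLam_nonneg i hy)] using P.sumLam_le i y hy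

lemma Lambda_zero (i : Fin k) : Lambda P.lam i 0 = 0 := intervalIntegral.integral_same

lemma hasDerivAt_Lambda (i : Fin k) {y : ℝ} (hy : 0 < y) :
    HasDerivAt (Lambda P.lam i) (sumLam P.lam i y) y :=
  intervalIntegral.integral_hasDerivAt_right (P.intervalIntegrable_sumLam i le_rfl hy.le)
    (P.measurable_sumLam i).stronglyMeasurable.stronglyMeasurableAtFilter
    (P.continuousAt_sumLam i hy)

lemma continuousOn_Lambda (i : Fin k) : ContinuousOn (Lambda P.lam i) (Ici 0) := by
  intro y hy
  have h1 := intervalIntegral.continuousOn_primitive_interval (μ := volume) (a := 0) (b := y + 1)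
    (f := sumLam P.lam i) (by
      rw [uIcc_of_le (by linarith [mem_Ici.mp hy]), integrableOn_Icc_iff_integrableOn_Ioc,
        ← intervalIntegrable_iff_integrableOn_Ioc_of_le (by linarith [mem_Ici.mp hy])]
      exact P.intervalIntegrable_sumLam i le_rfl (by linarith [mem_Ici.mp hy]))
  rw [uIcc_of_le (by linarith [mem_Ici.mp hy])] at h1
  refine (h1 y ⟨hy, by linarith⟩).mono_of_mem_nhdsWithin ?_
  rw [← Ici_inter_Iic]
  exact inter_mem_nhdsWithin _ (Iic_mem_nhds (by linarith))

lemma Lambda_nonneg (i : Fin k) {y : ℝ} (hy : 0 ≤ y) : 0 ≤ Lambda P.lam i y :=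
  intervalIntegral.integral_nonneg_of_ae_restrict hy <|
    ((ae_restrict_iff' measurableSet_Icc).mpr (by
      filter_upwards [Measure.ae_ne volume (0:ℝ)] with u hu0 hu
      exact P.sumLam_nonneg i (lt_of_le_of_ne hu.1 (Ne.symm hu0))))

/-- Density of the holding time in state `i` followed by a transition to `l`. -/
noncomputable def g (i l : Fin k) (w : ℝ) : ℝ :=
  if 0 < w ∧ i ≠ l then P.lam i l w * Real.exp (-Lambda P.lam i w) else 0

lemma g_of_pos {i l : Fin k} (h : i ≠ l) {w : ℝ} (hw : 0 < w) :
    P.g i l w = P.lam i l w * Real.exp (-Lambda P.lam i w) := if_pos ⟨hw, h⟩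

lemma g_self (i : Fin k) (w : ℝ) : P.g i i w = 0 := if_neg (by simp)

lemma measurable_g (i l : Fin k) : Measurable (P.g i l) := by
  by_cases h : i = l
  · subst h
    have : P.g i i = fun _ => 0 := funext (P.g_self i)
    rw [this]
    exact measurable_const
  have h1 : P.g i l = fun w => (Ioi (0:ℝ)).indicator
      (fun w => P.lam i l w * Real.exp (-Lambda P.lam i w)) w := by
    ext w
    by_cases hw : 0 < w <;> simp [g, hw, h]
  rw [h1]
  have h2 : Measurable fun w => Lambda P.lam i (max w 0) :=
    ((P.continuousOn_Lambda i).comp_continuous (by fun_prop)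
      fun w => mem_Ici.mpr (le_max_right w 0)).measurable
  have h3 : (fun w => (Ioi (0:ℝ)).indicator
      (fun w => P.lam i l w * Real.exp (-Lambda P.lam i w)) w) = (Ioi (0:ℝ)).indicator
      (fun w => P.lam i l w * Real.exp (-Lambda P.lam i (max w 0))) := by
    ext w
    by_cases hw : 0 < w
    · simp [hw, max_eq_left hw.le]
    · simp [hw]
  rw [h3]
  exact ((P.lam_meas i l h).mul (Real.measurable_exp.comp h2.neg)).indicator measurableSet_Ioi

lemma g_nonneg (i l : Fin k) {w : ℝ} (hw : 0 < w) : 0 ≤ P.g i l w := by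
  by_cases h : i = l
  · rw [h, g_self]
  · rw [P.g_of_pos h hw]
    exact mul_nonneg (P.lam_nonneg i l h w hw) (Real.exp_nonneg _)

lemma abs_g_le (i l : Fin k) {w : ℝ} (hw : 0 < w) : |P.g i l w| ≤ P.c := by
  rw [abs_of_nonneg (P.g_nonneg i l hw)]
  by_cases h : i = l
  · rw [h, g_self]
    exact P.c_pos.le
  · rw [P.g_of_pos h hw]
    exact (mul_le_of_le_one_right (P.lam_nonneg i l h w hw) (Real.exp_le_one_iff.mpr
      (neg_nonpos.mpr (P.Lambda_nonneg i hw.le)))).trans (P.lam_le i l h hw)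

lemma continuousAt_g (i l : Fin k) {w : ℝ} (hw : 0 < w) : ContinuousAt (P.g i l) w := by
  by_cases h : i = l
  · subst h
    have : P.g i i = fun _ => 0 := funext (P.g_self i)
    rw [this]
    exact continuousAt_const
  · have h1 : ContinuousAt (fun w => P.lam i l w * Real.exp (-Lambda P.lam i w)) w :=
      (P.lam_cont i l h w hw).mul (P.hasDerivAt_Lambda i hw).continuousAt.neg.rexp
    refine h1.congr ?_
    filter_upwards [lt_mem_nhds hw] with u hu
    exact (P.g_of_pos h hu).symm

lemma sum_g (i : Fin k) {w : ℝ} (hw : 0 < w) :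
    ∑ l, P.g i l w = sumLam P.lam i w * Real.exp (-Lambda P.lam i w) := by
  rw [sumLam, Finset.sum_mul, Finset.sum_filter]
  refine Finset.sum_congr rfl fun l _ => ?_
  by_cases h : i = l
  · simp [h, g_self]
  · rw [P.g_of_pos h hw, if_pos (Ne.symm h)]

lemma intervalIntegrable_g (i l : Fin k) {a b : ℝ} (ha : 0 ≤ a) (hb : 0 ≤ b) :
    IntervalIntegrable (P.g i l) volume a b := by
  refine (intervalIntegrable_const (c := P.c)).mono_fun'
    (P.measurable_g i l).aestronglyMeasurable ?_
  refine (ae_restrict_iff' measurableSet_uIoc).mpr (Eventually.of_forall fun y hy => ?_)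
  exact P.abs_g_le i l ((le_min ha hb).trans_lt hy.1)

lemma sum_integral_g (i : Fin k) {a b : ℝ} (ha : 0 ≤ a) (hab : a ≤ b) :
    ∑ l, ∫ v in a..b, P.g i l v =
      Real.exp (-Lambda P.lam i a) - Real.exp (-Lambda P.lam i b) := by
  rw [← intervalIntegral.integral_finsetSum fun l _ =>
    P.intervalIntegrable_g i l ha (ha.trans hab)]
  have hcont : ContinuousOn (fun v => -Real.exp (-Lambda P.lam i v)) (Icc a b) :=
    ((P.continuousOn_Lambda i).mono fun v hv => ha.trans hv.1).neg.rexp.neg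
  have hd : ∀ v ∈ Ioo a b, HasDerivAt (fun v => -Real.exp (-Lambda P.lam i v))
      (∑ l, P.g i l v) v := by
    intro v hv
    have hv0 := ha.trans_lt hv.1
    refine (P.hasDerivAt_Lambda i hv0).neg.exp.neg.congr_deriv ?_
    rw [P.sum_g i hv0, Pi.neg_apply]
    ring
  rw [intervalIntegral.integral_eq_sub_of_hasDerivAt_of_le hab hcont hd
    (by simpa only [Finset.sum_fn] using
      IntervalIntegrable.sum Finset.univ fun l _ => P.intervalIntegrable_g i l ha (ha.trans hab))]
  ring

lemma continuous_σ (i : Fin k) : Continuous fun w => P.σ (max w 0) i :=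
  continuous_comp_max (P.σ_cont i)

lemma cumVar_sub_bounds (i : Fin k) {u v : ℝ} (huv : u ≤ v) (hv : v ≤ P.T) :
    P.m * (v - u) ≤ cumVar (P.σ · i) v - cumVar (P.σ · i) u ∧
      cumVar (P.σ · i) v - cumVar (P.σ · i) u ≤ P.S * (v - u) := by
  rw [cumVar_sub (P.σ_cont i)]
  have hmem : ∀ w ∈ Icc u v, max w 0 ∈ Icc 0 P.T := fun w hw =>
    ⟨le_max_right _ _, max_le (hw.2.trans hv) P.T_pos.le⟩
  have hInt : IntervalIntegrable (fun w => P.σ (max w 0) i ^ 2) volume u v :=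
    ((P.continuous_σ i).pow 2).intervalIntegrable _ _
  constructor
  · have := intervalIntegral.integral_mono_on huv intervalIntegrable_const hInt
      fun w hw => P.m_le _ (hmem w hw) i
    simpa [mul_comm] using this
  · have := intervalIntegral.integral_mono_on huv hInt intervalIntegrable_const
      fun w hw => P.le_S _ (hmem w hw) i
    simpa [mul_comm] using this

/-- Accumulated variance and interest in state `i`. -/
noncomputable def β (i : Fin k) (u : ℝ) : ℝ × ℝ :=
  (cumVar (P.σ · i) (min u P.T), P.r i * min u P.T)

/-- Density of `β`. -/
noncomputable def b (i : Fin k) (u : ℝ) : ℝ × ℝ :=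
  if u < P.T then (P.σ (max u 0) i ^ 2, P.r i) else 0

lemma lipschitzWith_β (i : Fin k) : LipschitzWith P.S (P.β i) := by
  have key : ∀ u v, u ≤ v → dist (P.β i u) (P.β i v) ≤ P.S * dist u v := by
    intro u v huv
    have h1 : min u P.T ≤ min v P.T := min_le_min_right _ huv
    have h2 := P.cumVar_sub_bounds i h1 (min_le_right _ _)
    have h3 : min v P.T - min u P.T ≤ v - u := by
      rcases le_total u P.T with h | h
      · rw [min_eq_left h]
        linarith [min_le_left v P.T]
      · rw [min_eq_right h, min_eq_right (h.trans huv)]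
        linarith
    have h4 : (P.S : ℝ) * (min v P.T - min u P.T) ≤ P.S * (v - u) := by gcongr
    have h5 : P.r i * (min v P.T - min u P.T) ≤ P.S * (v - u) :=
      (mul_le_mul_of_nonneg_right (P.r_le i) (by linarith)).trans h4
    have h6 := mul_nonneg P.m_pos.le (sub_nonneg.mpr h1)
    have h7 := mul_nonneg (P.r_nonneg i) (sub_nonneg.mpr h1)
    rw [dist_comm u v, Real.dist_eq, abs_of_nonneg (sub_nonneg.mpr huv), dist_comm, Prod.dist_eq,
      Real.dist_eq, Real.dist_eq]
    simp only [β]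
    rw [← mul_sub, abs_of_nonneg (h6.trans h2.1), abs_of_nonneg h7]
    exact max_le (h2.2.trans h4) h5
  refine LipschitzWith.of_dist_le_mul fun u v => ?_
  rcases le_total u v with h | h
  · exact key u v h
  · rw [dist_comm, dist_comm u v]
    exact key v u h

lemma hasDerivAt_β (i : Fin k) {u : ℝ} (hu : u ≠ P.T) : HasDerivAt (P.β i) (P.b i u) u := by
  rcases lt_or_gt_of_ne hu with h | h
  · have h1 := (hasDerivAt_cumVar (P.σ_cont i) u).prodMk ((hasDerivAt_id u).const_mul (P.r i))
    rw [b, if_pos h]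
    refine (h1.congr_deriv (by simp)).congr_of_eventuallyEq ?_
    filter_upwards [gt_mem_nhds h] with v hv
    simp only [β, min_eq_left hv.le, id]
  · rw [b, if_neg h.not_gt]
    refine (hasDerivAt_const u (P.β i P.T)).congr_of_eventuallyEq ?_
    filter_upwards [lt_mem_nhds h] with v hv
    simp only [β, min_eq_right hv.le, min_self]

lemma continuousAt_b (i : Fin k) {u : ℝ} (hu : u ≠ P.T) : ContinuousAt (P.b i) u := by
  rcases lt_or_gt_of_ne hu with h | h
  · have h1 : Continuous fun u => (P.σ (max u 0) i ^ 2, P.r i) :=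
      ((P.continuous_σ i).pow 2).prodMk continuous_const
    refine h1.continuousAt.congr ?_
    filter_upwards [gt_mem_nhds h] with v hv
    exact (if_pos hv).symm
  · refine (continuousAt_const (y := (0 : ℝ × ℝ))).congr ?_
    filter_upwards [lt_mem_nhds h] with v hv
    exact (if_neg hv.not_gt).symm

/-- The renewal data of the market. -/
noncomputable def renewal : RenewalData (Fin k) (ℝ × ℝ) where
  T := P.T
  T_pos := P.T_pos
  g := P.g
  G i := Real.exp (-Lambda P.lam i P.T)
  c := P.c
  β := P.β
  b := P.b
  L := P.S
  c_nonneg := P.c_pos.le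
  g_meas := P.measurable_g
  g_nonneg _ _ _ hv := P.g_nonneg _ _ hv
  g_le _ _ _ hv := P.abs_g_le _ _ hv
  G_nonneg _ := Real.exp_nonneg _
  total i := by
    rw [P.sum_integral_g i le_rfl P.T_pos.le, P.Lambda_zero]
    simp
  β_lip := P.lipschitzWith_β
  β_deriv _ _ _ hu := P.hasDerivAt_β _ hu
  b_cont _ _ _ hu := P.continuousAt_b _ hu
  β_const i u hu := by simp only [β, min_eq_right hu, min_self]

end SemiMarkovMarket

section

open ProbabilityTheory

lemma gaussSmooth_kernel_integral {κ : ℝ → ℝ} {F : ℝ → ℝ → ℝ} {c M T : ℝ} (hT : 0 ≤ T) (hc : 0 ≤ c)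
    (hκm : Measurable κ) (hκ : ∀ v, 0 < v → |κ v| ≤ c)
    (hF : Continuous fun q : ℝ × ℝ => F q.1 q.2)
    (hM : ∀ v, 0 < v → ∀ x, |F v x| ≤ M * (1 + Real.exp x)) (p x : ℝ) :
    Integrable (fun u => ∫ v in (0:ℝ)..T, κ v * F v (x + √p * u - p / 2)) (gaussianReal 0 1) ∧
      gaussSmooth (fun x' => ∫ v in (0:ℝ)..T, κ v * F v x') (p, x) =
        ∫ v in (0:ℝ)..T, κ v * gaussSmooth (F v) (p, x) := by
  have hInt : Integrable (fun q : ℝ × ℝ => κ q.2 * F q.2 (x + √p * q.1 - p / 2))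
      ((gaussianReal 0 1).prod (volume.restrict (Ioc 0 T))) := by
    have h1 : Integrable (fun q : ℝ × ℝ =>
        (c * (M * (1 + Real.exp (x + √p * q.1 - p / 2)))) * (1:ℝ))
        ((gaussianReal 0 1).prod (volume.restrict (Ioc 0 T))) :=
      ((((integrable_const (1:ℝ)).add (integrable_exp_affine_gaussianReal x
        (√p) (p / 2) 1)).const_mul
        M).const_mul c).mul_prod (integrable_const 1)
    refine h1.mono' ?_ ?_
    · refine ((hκm.comp measurable_snd).mul ?_).aestronglyMeasurable
      exact (hF.comp (by fun_prop : Continuous fun q : ℝ × ℝ =>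
        (q.2, x + √p * q.1 - p / 2))).measurable
    · have h2 : ∀ᵐ q : ℝ × ℝ ∂((gaussianReal 0 1).prod (volume.restrict (Ioc 0 T))),
          q.2 ∈ Ioc 0 T :=
        Measure.quasiMeasurePreserving_snd.ae (ae_restrict_mem measurableSet_Ioc)
      filter_upwards [h2] with q hq
      rw [mul_one, norm_mul]
      exact mul_le_mul (hκ _ hq.1) (hM _ hq.1 _) (norm_nonneg _) hc
  refine ⟨?_, ?_⟩
  · simp only [intervalIntegral.integral_of_le hT]
    exact hInt.integral_prod_left
  · simp only [gaussSmooth, intervalIntegral.integral_of_le hT]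
    rw [integral_integral_swap hInt, ← integral_const_mul]
    refine integral_congr_ae (Eventually.of_forall fun v => ?_)
    simp only
    rw [integral_const_mul]
    ring

end

namespace SemiMarkovMarket

variable {k : ℕ} (P : SemiMarkovMarket k) {φ : ℝ → ℝ → Fin k → ℝ → ℝ} {h : ℝ → ℝ} {M : ℝ}

/-- A price function `φ` of linear growth with terminal payoff `h ∘ log` that satisfies the integral
equation, with the Black–Scholes–Merton prices expressed through `gaussSmooth`. -/
structure IsPrice (h : ℝ → ℝ) (M : ℝ) (φ : ℝ → ℝ → Fin k → ℝ → ℝ) : Prop where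
  h_cont : Continuous h
  h_le : ∀ u, |h u| ≤ M * (1 + Real.exp u)
  cont : ∀ i, ContinuousOn (fun p : ℝ × ℝ × ℝ => φ p.1 p.2.1 i p.2.2)
    {p : ℝ × ℝ × ℝ | memDbar P.T p.1 p.2.1 p.2.2}
  le : ∀ t s y, memDbar P.T t s y → ∀ i, |φ t s i y| ≤ M * (1 + s)
  terminal : ∀ i x, φ P.T (Real.exp x) i 0 = h x
  eq : ∀ t x y, t ∈ Icc 0 P.T → y ∈ Icc 0 t → ∀ i, φ t (Real.exp x) i y =
    Aop P.lam P.r P.σ (fun i t s => s * gaussSmooth h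
      (cumVar (P.σ · i) P.T - cumVar (P.σ · i) t, Real.log s + P.r i * (P.T - t))) P.T φ t
      (Real.exp x) i y

/-- The price immediately after a transition, in log-price coordinates and extended to all times. -/
noncomputable def renewedPrice (φ : ℝ → ℝ → Fin k → ℝ → ℝ) (l : Fin k) (u x : ℝ) : ℝ :=
  φ (max 0 (min u P.T)) (Real.exp x) l 0

/-- Gaussian smoothing of the price immediately after a transition. -/
noncomputable def smoothedPrice (φ : ℝ → ℝ → Fin k → ℝ → ℝ) (l : Fin k) (z : ℝ × (ℝ × ℝ)) : ℝ :=
  gaussSmooth (P.renewedPrice φ l z.1) z.2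

variable {P}

namespace IsPrice

lemma M_nonneg (H : P.IsPrice h M φ) : 0 ≤ M := by
  have h1 := (abs_nonneg _).trans (H.h_le 0)
  have h2 := Real.exp_pos 0
  nlinarith

lemma continuous_renewedPrice (H : P.IsPrice h M φ) (l : Fin k) :
    Continuous fun q : ℝ × ℝ => P.renewedPrice φ l q.1 q.2 :=
  (H.cont l).comp_continuous
    (f := fun q : ℝ × ℝ => (max 0 (min q.1 P.T), Real.exp q.2, (0:ℝ))) (by fun_prop) fun q =>
    ⟨⟨le_max_left _ _, max_le P.T_pos.le (min_le_right _ _)⟩, (Real.exp_pos _).le,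
      ⟨le_rfl, le_max_left _ _⟩⟩

lemma abs_renewedPrice_le (H : P.IsPrice h M φ) (l : Fin k) (u x : ℝ) :
    |P.renewedPrice φ l u x| ≤ M * (1 + Real.exp x) :=
  H.le _ _ _ ⟨⟨le_max_left _ _, max_le P.T_pos.le (min_le_right _ _)⟩, (Real.exp_pos _).le,
      ⟨le_rfl, le_max_left _ _⟩⟩ l

lemma renewedPrice_of_ge (H : P.IsPrice h M φ) (l : Fin k) {u : ℝ} (hu : P.T ≤ u) :
    P.renewedPrice φ l u = h := by
  ext x
  rw [renewedPrice, min_eq_right hu, max_eq_right P.T_pos.le, H.terminal]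

lemma smoothedPrice_of_ge (H : P.IsPrice h M φ) (l : Fin k) {z : ℝ × (ℝ × ℝ)} (hz : P.T ≤ z.1) :
    P.smoothedPrice φ l z = gaussSmooth h z.2 := by
  rw [smoothedPrice, H.renewedPrice_of_ge l hz]

lemma continuous_smoothedPrice (H : P.IsPrice h M φ) (l : Fin k) :
    Continuous (P.smoothedPrice φ l) :=
  continuous_gaussSmooth_param (H.continuous_renewedPrice l) (H.abs_renewedPrice_le l)

lemma abs_smoothedPrice_le (H : P.IsPrice h M φ) (l : Fin k) {z : ℝ × (ℝ × ℝ)} (hz : 0 ≤ z.2.1) :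
    |P.smoothedPrice φ l z| ≤ M * (1 + Real.exp (-z.2.2)) :=
  abs_gaussSmooth_le (H.abs_renewedPrice_le l _) hz

end IsPrice

variable (P)

lemma shift_eq {i : Fin k} {t v p x : ℝ} (ht : t ≤ P.T) (htv : t + v ≤ P.T) :
    P.renewal.shift i v (t, (p, x)) =
      (t + v, (p + (cumVar (P.σ · i) (t + v) - cumVar (P.σ · i) t), x + P.r i * v)) := by
  simp only [RenewalData.shift, renewal, β, min_eq_left ht, min_eq_left htv, Prod.mk_add_mk,
    Prod.mk_sub_mk]
  ring_nf

lemma shift_T_eq {i : Fin k} {t p x : ℝ} (h0 : 0 ≤ t) (ht : t ≤ P.T) :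
    (P.renewal.shift i P.T (t, (p, x))).2 =
      (p + (cumVar (P.σ · i) P.T - cumVar (P.σ · i) t), x + P.r i * (P.T - t)) := by
  simp only [RenewalData.shift, renewal, β, min_eq_left ht,
    min_eq_right (le_add_of_nonneg_left h0), Prod.mk_add_mk, Prod.mk_sub_mk]
  ring_nf

lemma shift_snd_of_ge {i : Fin k} {t v : ℝ} {a : ℝ × ℝ} (h0 : 0 ≤ t) (htv : P.T ≤ t + v) :
    (P.renewal.shift i v (t, a)).2 = (P.renewal.shift i P.T (t, a)).2 := by
  simp only [RenewalData.shift, renewal, β, min_eq_right htv,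
    min_eq_right (le_add_of_nonneg_left h0)]

lemma shift_nonneg {i : Fin k} {v : ℝ} {z : ℝ × (ℝ × ℝ)} (hv : 0 ≤ v) :
    z.2.1 ≤ (P.renewal.shift i v z).2.1 ∧ z.2.2 ≤ (P.renewal.shift i v z).2.2 := by
  have h1 : min z.1 P.T ≤ min (z.1 + v) P.T := min_le_min_right _ (by linarith)
  have h2 := (P.cumVar_sub_bounds i h1 (min_le_right _ _)).1
  have h3 := mul_nonneg P.m_pos.le (sub_nonneg.mpr h1)
  have h4 := mul_nonneg (P.r_nonneg i) (sub_nonneg.mpr h1)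
  simp only [RenewalData.shift, renewal, β, Prod.snd_add, Prod.fst_add, Prod.fst_sub, Prod.snd_sub]
  constructor <;> linarith

lemma measurable_g_add (i l : Fin k) (y : ℝ) : Measurable fun v => P.g i l (y + v) :=
  (P.measurable_g i l).comp (measurable_const_add y)

lemma abs_g_add_le (i l : Fin k) {y : ℝ} (hy : 0 ≤ y) (v : ℝ) (hv : 0 < v) :
    |P.g i l (y + v)| ≤ P.c := P.abs_g_le i l (by linarith)

variable {P}

namespace IsPrice

lemma intervalIntegrable_g_smoothedPrice (H : P.IsPrice h M φ) (i l : Fin k) {y : ℝ} (hy : 0 ≤ y)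
    (z : ℝ × (ℝ × ℝ)) {a b : ℝ} (ha : 0 ≤ a) (hb : 0 ≤ b) : IntervalIntegrable
      (fun v => P.g i l (y + v) * P.smoothedPrice φ l (P.renewal.shift i v z)) volume a b := by
  refine IntervalIntegrable.mul_continuousOn ?_ (Continuous.continuousOn ?_)
  · have h1 := (P.intervalIntegrable_g i l (add_nonneg hy ha) (add_nonneg hy hb)).comp_add_left y
    simpa using h1
  · exact (H.continuous_smoothedPrice l).comp
      ((P.renewal.continuous_shift i).comp (continuous_id.prodMk continuous_const))

/-- The integral against the lognormal density in terms of `smoothedPrice`. -/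
lemma integral_alphaDens (i l : Fin k) {t v : ℝ} (x : ℝ) (ht : 0 ≤ t) (hv : 0 < v)
    (htv : t + v ≤ P.T) :
    ∫ x' in Ioi (0:ℝ), φ (t + v) x' l 0 * alphaDens P.r P.σ x' t (Real.exp x) i v =
      Real.exp x * Real.exp (P.r i * v) *
        P.smoothedPrice φ l (P.renewal.shift i v (t, (0, x))) := by
  set q := cumVar (P.σ · i) (t + v) - cumVar (P.σ · i) t with hq
  have hσ2 : ∀ w ∈ uIcc t (t + v), P.σ (max w 0) i ^ 2 = P.σ w i ^ 2 := by
    intro w hw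
    rw [uIcc_of_le (by linarith)] at hw
    rw [max_eq_left (ht.trans hw.1)]
  have hq1 : ∫ u in t..(t + v), P.σ u i ^ 2 = q := by
    rw [hq, cumVar_sub (P.σ_cont i)]
    exact (intervalIntegral.integral_congr hσ2).symm
  have hInt : IntervalIntegrable (fun u => P.σ u i ^ 2) volume t (t + v) := by
    refine ContinuousOn.intervalIntegrable (((P.σ_cont i).mono fun w hw => ?_).pow 2)
    rw [uIcc_of_le (by linarith)] at hw
    exact ht.trans hw.1
  have hq0 : 0 < q := sub_pos.mpr
    (cumVar_strictMono (P.σ_cont i) (fun u hu => P.σ_pos u hu i) (by linarith))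
  have hdrift : ∫ u in t..(t + v), (P.r i - P.σ u i ^ 2 / 2) = P.r i * v - q / 2 := by
    rw [intervalIntegral.integral_sub intervalIntegrable_const (hInt.div_const 2),
      intervalIntegral.integral_div, hq1, intervalIntegral.integral_const, smul_eq_mul]
    ring
  have h1 : ∀ x' ∈ Ioi (0:ℝ), φ (t + v) x' l 0 * alphaDens P.r P.σ x' t (Real.exp x) i v =
      φ (t + v) x' l 0 * (Real.exp (-((Real.log x' - x - (P.r i * v - q / 2)) / √q) ^ 2 / 2) /
      (√(2 * π) * x' * √q)) := by
    intro x' hx'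
    rw [alphaDens, Lfun, sigbar, hq1, hdrift, Real.log_div (ne_of_gt hx') (Real.exp_ne_zero x),
      Real.log_exp]
  rw [setIntegral_congr_fun measurableSet_Ioi h1,
    integral_lognormal (fun x' => φ (t + v) x' l 0) hq0 x (P.r i * v), smoothedPrice,
    P.shift_eq (by linarith) htv, gaussSmooth]
  simp only [renewedPrice, zero_add, min_eq_left htv, max_eq_right (add_nonneg ht hv.le), ← hq]
  rw [← mul_assoc, ← Real.exp_add, ← Real.exp_add, add_neg_cancel, Real.exp_zero, one_mul]

lemma fdens_mul_pMat {i j : Fin k} (hij : j ≠ i) {w : ℝ} (hw : 0 < w) :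
    fdens P.lam i w * pMat P.lam i j w = P.g i j w := by
  rw [P.g_of_pos hij.symm hw, fdens, pMat, if_neg hij]
  split_ifs with h0
  · have h1 := (Finset.sum_eq_zero_iff_of_nonneg fun l hl =>
      P.lam_nonneg i l (Finset.mem_filter.mp hl).2.symm w hw).mp h0 j
      (Finset.mem_filter.mpr ⟨Finset.mem_univ j, hij⟩)
    rw [h0, h1]
    ring
  · field_simp

/-- The price as an integral over the full horizon. -/
lemma eq_kernel (H : P.IsPrice h M φ) (i : Fin k) {t y : ℝ} (x : ℝ) (ht : t ∈ Icc 0 P.T)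
    (hy : y ∈ Icc 0 t) :
    φ t (Real.exp x) i y = Real.exp x * Real.exp (Lambda P.lam i y) *
      (Real.exp (-Lambda P.lam i (y + P.T)) *
          gaussSmooth h (P.renewal.shift i P.T (t, (0, x))).2 +
        ∑ l, ∫ v in (0:ℝ)..P.T,
          P.g i l (y + v) * P.smoothedPrice φ l (P.renewal.shift i v (t, (0, x)))) := by
  have hTt : 0 ≤ P.T - t := sub_nonneg.mpr ht.2
  set z : ℝ × (ℝ × ℝ) := (t, (0, x)) with hz
  have hinner : ∫ v in (0:ℝ)..(P.T - t), Real.exp (-(P.r i * v)) *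
      (fdens P.lam i (y + v) / (1 - Fcdf P.lam i y)) *
      ∑ j ∈ Finset.univ.filter (fun j => j ≠ i), pMat P.lam i j (y + v) *
        ∫ x' in Ioi (0:ℝ), φ (t + v) x' j 0 * alphaDens P.r P.σ x' t (Real.exp x) i v =
      ∑ l, Real.exp x * Real.exp (Lambda P.lam i y) * ∫ v in (0:ℝ)..(P.T - t),
        P.g i l (y + v) * P.smoothedPrice φ l (P.renewal.shift i v z) := by
    have h1 : ∀ v ∈ Ioc 0 (P.T - t), Real.exp (-(P.r i * v)) *
        (fdens P.lam i (y + v) / (1 - Fcdf P.lam i y)) *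
        ∑ j ∈ Finset.univ.filter (fun j => j ≠ i), pMat P.lam i j (y + v) *
          ∫ x' in Ioi (0:ℝ), φ (t + v) x' j 0 * alphaDens P.r P.σ x' t (Real.exp x) i v =
        ∑ l, Real.exp x * Real.exp (Lambda P.lam i y) *
          (P.g i l (y + v) * P.smoothedPrice φ l (P.renewal.shift i v z)) := by
      intro v hv
      have hyv : 0 < y + v := add_pos_of_nonneg_of_pos hy.1 hv.1
      rw [Finset.mul_sum, Finset.sum_filter]
      refine Finset.sum_congr rfl fun l _ => ?_
      by_cases hl : l = i
      · rw [if_neg (not_not.mpr hl), hl, P.g_self]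
        ring
      · rw [if_pos hl, integral_alphaDens i l x ht.1 hv.1 (by linarith [hv.2]),
          ← fdens_mul_pMat hl hyv, Fcdf, sub_sub_cancel, Real.exp_neg (Lambda P.lam i y),
          div_inv_eq_mul, Real.exp_neg]
        have := (Real.exp_pos (P.r i * v)).ne'
        rw [← hz]
        field_simp
    simp only [← intervalIntegral.integral_const_mul]
    rw [← intervalIntegral.integral_finsetSum fun l _ =>
      ((H.intervalIntegrable_g_smoothedPrice i l hy.1 z le_rfl hTt).const_mul _),
      intervalIntegral.integral_of_le hTt, intervalIntegral.integral_of_le hTt]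
    exact setIntegral_congr_fun measurableSet_Ioc h1
  have htail : ∀ l, ∫ v in (P.T - t)..P.T,
      P.g i l (y + v) * P.smoothedPrice φ l (P.renewal.shift i v z) =
      (∫ v in (y + (P.T - t))..(y + P.T), P.g i l v) *
        gaussSmooth h (P.renewal.shift i P.T z).2 := by
    intro l
    rw [← intervalIntegral.integral_comp_add_left, ← intervalIntegral.integral_mul_const]
    refine intervalIntegral.integral_congr fun v hv => ?_
    rw [uIcc_of_le (by linarith [ht.1])] at hv
    rw [H.smoothedPrice_of_ge l (by
      simp only [RenewalData.shift, hz]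
      linarith [hv.1]), hz, P.shift_snd_of_ge ht.1 (by linarith [hv.1])]
  have hsplit : ∀ l, ∫ v in (0:ℝ)..(P.T - t),
      P.g i l (y + v) * P.smoothedPrice φ l (P.renewal.shift i v z) =
      (∫ v in (0:ℝ)..P.T, P.g i l (y + v) * P.smoothedPrice φ l (P.renewal.shift i v z)) -
      (∫ v in (y + (P.T - t))..(y + P.T), P.g i l v) *
        gaussSmooth h (P.renewal.shift i P.T z).2 := by
    intro l
    rw [← htail l, eq_sub_iff_add_eq]
    exact intervalIntegral.integral_add_adjacent_intervals
      (H.intervalIntegrable_g_smoothedPrice i l hy.1 z le_rfl hTt)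
      (H.intervalIntegrable_g_smoothedPrice i l hy.1 z hTt P.T_pos.le)
  rw [H.eq t x y ht hy i, Aop, hinner, ← Finset.mul_sum, Finset.sum_congr rfl fun l _ => hsplit l,
    Finset.sum_sub_distrib, ← Finset.sum_mul,
    P.sum_integral_g i (add_nonneg hy.1 hTt) (by linarith [ht.1]), hz, P.shift_T_eq ht.1 ht.2,
    Real.log_exp, zero_add, Fcdf, Fcdf, sub_sub_cancel, sub_sub_cancel,
    Real.exp_neg (Lambda P.lam i y), div_inv_eq_mul, add_comm (P.T - t) y]
  ring

/-- The smoothed prices solve the renewal equation on any region of nonnegative variance where they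
are bounded. -/
lemma solvesOn (H : P.IsPrice h M φ) {x₀ : ℝ} {Dom : Set (ℝ × (ℝ × ℝ))}
    (h0 : ∀ z ∈ Dom, 0 ≤ z.1) (hp : ∀ z ∈ Dom, 0 ≤ z.2.1) (hx : ∀ z ∈ Dom, x₀ ≤ z.2.2) :
    P.renewal.SolvesOn Dom (gaussSmooth h) (P.smoothedPrice φ) where
  bdd := by
    refine ⟨M * (1 + Real.exp (-x₀)), fun j z hz => (H.abs_smoothedPrice_le j (hp z hz)).trans ?_⟩
    have := H.M_nonneg
    gcongr
    exact hx z hz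
  terminal j z _ hT := H.smoothedPrice_of_ge j hT
  int j l z _ := by
    have h1 := H.intervalIntegrable_g_smoothedPrice j l le_rfl z le_rfl P.T_pos.le
    simp only [zero_add] at h1
    exact h1
  eq := by
    rintro i ⟨t, p, x⟩ hz hT
    have h0 : 0 ≤ t := h0 _ hz
    have hp : 0 ≤ p := hp _ hz
    have hT : t < P.T := hT
    have hM0 := H.M_nonneg
    set B : ℝ → ℝ × ℝ := fun v => P.β i (t + v) - P.β i t with hB
    have hshift : ∀ v p x, P.renewal.shift i v (t, (p, x)) =
        (t + v, (p + (B v).1, x + (B v).2)) := fun v p x => rfl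
    have hB0 : ∀ v, 0 ≤ v → 0 ≤ (B v).1 ∧ 0 ≤ (B v).2 := by
      intro v hv
      have := P.shift_nonneg (i := i) (z := (t, (0, 0))) hv
      simpa [hshift] using this
    have hψ : ∀ x', P.renewedPrice φ i t x' = Real.exp (-Lambda P.lam i P.T) *
          (Real.exp x' * gaussSmooth h ((B P.T).1, x' + (B P.T).2)) +
        ∑ l, ∫ v in (0:ℝ)..P.T, P.g i l v *
          (Real.exp x' * P.smoothedPrice φ l (P.renewal.shift i v (t, (0, x')))) := by
      intro x'
      rw [renewedPrice, min_eq_left hT.le, max_eq_right h0,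
        H.eq_kernel i x' ⟨h0, hT.le⟩ ⟨le_rfl, h0⟩,
        P.Lambda_zero, Real.exp_zero, mul_one, hshift, mul_add, Finset.mul_sum]
      simp only [zero_add]
      congr 1
      · ring
      · refine Finset.sum_congr rfl fun l _ => ?_
        rw [← intervalIntegral.integral_const_mul]
        congr 1
        ext v
        ring
    have hbound : ∀ v, 0 < v → ∀ (F : ℝ → ℝ),
        (∀ x', |F x'| ≤ M * (1 + Real.exp (-(x' + (B v).2)))) →
        ∀ x', |Real.exp x' * F x'| ≤ M * (1 + Real.exp x') := by
      intro v hv F hF x'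
      rw [abs_mul, Real.abs_exp]
      have h1 := (hB0 v hv.le).2
      calc Real.exp x' * |F x'| ≤ Real.exp x' * (M * (1 + Real.exp (-x'))) := by
            gcongr
            refine (hF x').trans ?_
            gcongr
            linarith
        _ = M * (1 + Real.exp x') := by
            have : Real.exp x' * Real.exp (-x') = 1 := by rw [← Real.exp_add]; simp
            linear_combination M * this
    have hkey := fun l => gaussSmooth_kernel_integral P.T_pos.le P.c_pos.le (P.measurable_g i l)
      (fun v hv => P.abs_g_le i l hv)
      (F := fun v x' => Real.exp x' * P.smoothedPrice φ l (P.renewal.shift i v (t, (0, x'))))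
      (M := M) (Continuous.mul (by fun_prop) ((H.continuous_smoothedPrice l).comp
        ((P.renewal.continuous_shift i).comp (by fun_prop :
          Continuous fun q : ℝ × ℝ => (q.1, ((t, ((0:ℝ), q.2)) : ℝ × (ℝ × ℝ)))))))
      (fun v hv => hbound v hv _ fun x' => by
        have h2 := H.abs_smoothedPrice_le l (z := P.renewal.shift i v (t, (0, x')))
          (by simpa [hshift] using (hB0 v hv.le).1)
        simpa [hshift] using h2) p x
    have hinner : ∀ l, ∀ v ∈ uIcc 0 P.T, P.g i l v * gaussSmooth (fun x' =>
        Real.exp x' * P.smoothedPrice φ l (P.renewal.shift i v (t, (0, x')))) (p, x) =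
        P.g i l v * P.smoothedPrice φ l (P.renewal.shift i v (t, (p, x))) := by
      intro l v hv
      rw [uIcc_of_le P.T_pos.le] at hv
      simp only [hshift, smoothedPrice, zero_add]
      rw [gaussSmooth_gaussSmooth (h := P.renewedPrice φ l (t + v))
          ((H.continuous_renewedPrice l).comp (by fun_prop :
        Continuous fun x : ℝ => (t + v, x))) (H.abs_renewedPrice_le l _) hp (hB0 v hv.1).1]
    have hfirst := gaussSmooth_gaussSmooth H.h_cont H.h_le hp (hB0 P.T P.T_pos.le).1 x (B P.T).2
    have hInt1 : Integrable (fun u => Real.exp (-Lambda P.lam i P.T) *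
        (Real.exp (x + √p * u - p / 2) *
          gaussSmooth h ((B P.T).1, x + √p * u - p / 2 + (B P.T).2)))
        (ProbabilityTheory.gaussianReal 0 1) := by
      refine Integrable.const_mul (integrable_gaussianReal_affine
        (h := fun x' => Real.exp x' * gaussSmooth h ((B P.T).1, x' + (B P.T).2)) ?_
        (hbound P.T P.T_pos _ fun x' => abs_gaussSmooth_le H.h_le (hB0 P.T P.T_pos.le).1)
        x (√p) (p / 2) 1) _
      exact Real.continuous_exp.mul ((continuous_gaussSmooth H.h_cont H.h_le).comp (by fun_prop))
    have hlin : P.smoothedPrice φ i (t, (p, x)) = Real.exp (-Lambda P.lam i P.T) *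
        gaussSmooth (fun x' => Real.exp x' * gaussSmooth h ((B P.T).1, x' + (B P.T).2)) (p, x) +
        ∑ l, gaussSmooth (fun x' => ∫ v in (0:ℝ)..P.T, P.g i l v *
          (Real.exp x' * P.smoothedPrice φ l (P.renewal.shift i v (t, (0, x'))))) (p, x) := by
      rw [smoothedPrice]
      simp only [gaussSmooth, hψ]
      simp only [gaussSmooth] at hInt1
      rw [integral_add hInt1 (integrable_finsetSum _ fun l _ => (hkey l).1),
        integral_finsetSum _ fun l _ => (hkey l).1, integral_const_mul, mul_add, Finset.mul_sum]
      ring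
    rw [hlin, hfirst, Finset.sum_congr rfl fun l _ =>
      (hkey l).2.trans (intervalIntegral.integral_congr (hinner l))]
    rfl

end IsPrice

end SemiMarkovMarket

section DelayDerivative

variable {κ : ℝ → ℝ} {c T : ℝ}

lemma intervalIntegrable_of_abs_le_of_pos (hκm : Measurable κ) (hκ : ∀ v, 0 < v → |κ v| ≤ c)
    {a b : ℝ} (ha : 0 ≤ a) (hb : 0 ≤ b) : IntervalIntegrable κ volume a b := by
  refine (intervalIntegrable_const (c := c)).mono_fun' hκm.aestronglyMeasurable ?_
  exact (ae_restrict_iff' measurableSet_uIoc).mpr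
    (Eventually.of_forall fun y hy => hκ y ((le_min ha hb).trans_lt hy.1))

/-- Derivative in the delay `y` of `∫ κ (y + v) H v dv`, transferred to `H` by parts. -/
lemma hasDerivAt_delay_integral (hT : 0 < T) (hκm : Measurable κ) (hκ : ∀ v, 0 < v → |κ v| ≤ c)
    (hκc : ∀ v, 0 < v → ContinuousAt κ v) {H H' : ℝ → ℝ} {s : Set ℝ} (hs : s.Countable)
    (hH : ContinuousOn H (Icc 0 T)) (hH' : ∀ v ∈ Ioo 0 T \ s, HasDerivAt H (H' v) v)
    (hInt : IntervalIntegrable H' volume 0 T) {y : ℝ} (hy : 0 < y) :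
    HasDerivAt (fun y => ∫ v in (0:ℝ)..T, κ (y + v) * H v)
      (κ (y + T) * H T - κ y * H 0 - ∫ v in (0:ℝ)..T, κ (y + v) * H' v) y := by
  set K : ℝ → ℝ := fun w => ∫ u in (0:ℝ)..w, κ u with hK
  have hκi : ∀ {a b : ℝ}, 0 ≤ a → 0 ≤ b → IntervalIntegrable κ volume a b :=
    fun ha hb => intervalIntegrable_of_abs_le_of_pos hκm hκ ha hb
  have hKd : ∀ w, 0 < w → HasDerivAt K (κ w) w := fun w hw =>
    intervalIntegral.integral_hasDerivAt_right (hκi le_rfl hw.le)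
      hκm.stronglyMeasurable.stronglyMeasurableAtFilter (hκc w hw)
  have hKl : ∀ w w', 0 < w → 0 < w' → |K w - K w'| ≤ c * |w - w'| := by
    intro w w' hw hw'
    rw [hK, intervalIntegral.integral_interval_sub_left (hκi le_rfl hw.le) (hκi le_rfl hw'.le)]
    exact intervalIntegral.norm_integral_le_of_norm_le_const (f := κ) (C := c) fun u hu =>
      hκ u ((lt_min hw' hw).trans hu.1)
  have hKc : ∀ y', 0 < y' → ContinuousOn (fun v => K (y' + v)) (Icc 0 T) := fun y' hy' v hv =>
    (((hKd (y' + v) (by linarith [hv.1])).continuousAt.comp (f := fun v => y' + v)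
      (by fun_prop)).continuousWithinAt)
  have hκi' : ∀ y', 0 < y' → IntervalIntegrable (fun v => κ (y' + v)) volume 0 T := by
    intro y' hy'
    have h1 := (hκi hy'.le (add_pos hy' hT).le).comp_add_left y'
    simpa using h1
  have hparts : ∀ y', 0 < y' → ∫ v in (0:ℝ)..T, κ (y' + v) * H v =
      K (y' + T) * H T - K y' * H 0 - ∫ v in (0:ℝ)..T, K (y' + v) * H' v := by
    intro y' hy'
    have hi1 : IntervalIntegrable (fun v => κ (y' + v) * H v) volume 0 T :=
      (hκi' y' hy').mul_continuousOn (by rwa [uIcc_of_le hT.le])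
    have hi2 : IntervalIntegrable (fun v => K (y' + v) * H' v) volume 0 T :=
      hInt.continuousOn_mul (by rw [uIcc_of_le hT.le]; exact hKc y' hy')
    have h1 := integral_eq_of_hasDerivAt_off_countable_of_le (fun v => K (y' + v) * H v)
      (fun v => κ (y' + v) * H v + K (y' + v) * H' v) hT.le hs ((hKc y' hy').mul hH)
      (fun v hv => ((hKd (y' + v) (by linarith [hv.1.1])).comp_const_add y' v).mul (hH' v hv))
      (hi1.add hi2)
    rw [intervalIntegral.integral_add hi1 hi2, add_zero] at h1
    linarith
  have hInt' := (intervalIntegral.hasDerivAt_integral_of_dominated_loc_of_lip (μ := volume)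
    (F := fun y' v => K (y' + v) * H' v) (F' := fun v => κ (y + v) * H' v) (x₀ := y)
    (bound := fun v => c * |H' v|) (a := 0) (b := T) (Ioi_mem_nhds hy) ?_
    (hInt.continuousOn_mul (by rw [uIcc_of_le hT.le]; exact hKc y hy)) ?_ ?_
    (hInt.abs.const_mul c) ?_).2
  · have h2 := (((hKd (y + T) (by linarith)).comp_add_const y T).mul_const (H T)).sub
      ((hKd y hy).mul_const (H 0))
    refine (h2.sub hInt').congr_of_eventuallyEq ?_
    filter_upwards [Ioi_mem_nhds hy] with y' hy' using hparts y' hy'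
  · filter_upwards [Ioi_mem_nhds hy] with y' hy'
    exact (hInt.continuousOn_mul (by rw [uIcc_of_le hT.le]; exact hKc y' hy')
      ).def'.aestronglyMeasurable
  · exact (hκm.comp (measurable_const_add y)).aestronglyMeasurable.mul
      hInt.def'.aestronglyMeasurable
  · refine Eventually.of_forall fun v hv => LipschitzOnWith.of_dist_le_mul fun w hw w' hw' => ?_
    rw [uIoc_of_le hT.le] at hv
    have h3 := hKl (w + v) (w' + v) (add_pos hw hv.1) (add_pos hw' hv.1)
    have hc : 0 ≤ c := (abs_nonneg _).trans (hκ 1 one_pos)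
    rw [Real.dist_eq, Real.dist_eq, ← sub_mul, abs_mul, coe_nnabs, abs_mul, abs_abs,
      abs_of_nonneg hc]
    rw [add_sub_add_right_eq_sub] at h3
    calc _ ≤ c * |w - w'| * |H' v| := by gcongr
      _ = _ := by ring
  · refine Eventually.of_forall fun v hv => ?_
    rw [uIoc_of_le hT.le] at hv
    exact ((hKd (y + v) (by linarith [hv.1])).comp_add_const y v).mul_const (H' v)

end DelayDerivative

namespace RenewalData

variable {ι : Type*} [Fintype ι] {E : Type*} [NormedAddCommGroup E] [NormedSpace ℝ E]
  {R : RenewalData ι E}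

lemma hasDerivAt_shift_duration (j : ι) {v : ℝ} {z : ℝ × E} (hv : 0 < z.1 + v)
    (hvT : z.1 + v ≠ R.T) : HasDerivAt (fun v => R.shift j v z) (1, R.b j (z.1 + v)) v := by
  have h1 := ((R.β_deriv j _ hv hvT).comp_const_add z.1 v)
  exact ((hasDerivAt_id v).const_add z.1).prodMk ((h1.sub_const _).const_add z.2)

lemma Regular.hasFDerivAt {Φ : ℝ × E → ℝ} (hΦ : R.Regular Φ) {z : ℝ × E} (hz : 0 < z.1)
    (hzT : z.1 ≠ R.T) : HasFDerivAt Φ (fderiv ℝ Φ z) z :=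
  ((hΦ.contDiffAt z hz hzT).differentiableAt (by simp)).hasFDerivAt

/-- The derivative of `Φ ∘ shift` in the duration. -/
noncomputable def durationDeriv (R : RenewalData ι E) (Φ : ℝ × E → ℝ) (j : ι) (v : ℝ)
    (z : ℝ × E) : ℝ :=
  fderiv ℝ Φ (R.shift j v z) (1, R.b j (z.1 + v))

lemma hasDerivAt_comp_shift_duration {Φ : ℝ × E → ℝ} (hΦ : R.Regular Φ) (j : ι) {v : ℝ}
    {z : ℝ × E} (hv : 0 < z.1 + v) (hvT : z.1 + v ≠ R.T) :
    HasDerivAt (fun v => Φ (R.shift j v z)) (R.durationDeriv Φ j v z) v :=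
  (hΦ.hasFDerivAt (z := R.shift j v z) hv hvT).comp_hasDerivAt v
    (hasDerivAt_shift_duration j hv hvT)

lemma continuousAt_durationDeriv {Φ : ℝ × E → ℝ} (hΦ : R.Regular Φ) (j : ι) {v : ℝ}
    {z : ℝ × E} (hv : 0 < v) (hz : 0 < z.1) (hvT : z.1 + v ≠ R.T) :
    ContinuousAt (fun q : ℝ × (ℝ × E) => R.durationDeriv Φ j q.1 q.2) (v, z) := by
  refine (continuousAt_fderiv_shift hΦ j hv hz hvT).clm_apply
    (ContinuousAt.prodMk continuousAt_const ?_)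
  exact ContinuousAt.comp (f := fun q : ℝ × (ℝ × E) => q.2.1 + q.1) (x := (v, z))
    (R.b_cont j _ (add_pos hz hv) hvT) (by fun_prop)

lemma abs_durationDeriv_le {Φ : ℝ × E → ℝ} {C : ℝ≥0} (hΦ : LipschitzOnWith C Φ {z | 0 ≤ z.1})
    (j : ι) {v : ℝ} {z : ℝ × E} (hv : 0 < z.1 + v) (hvT : z.1 + v ≠ R.T) :
    |R.durationDeriv Φ j v z| ≤ C * (1 + R.L) := by
  refine (ContinuousLinearMap.le_opNorm (fderiv ℝ Φ (R.shift j v z)) _).trans ?_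
  have h1 := norm_fderiv_le hΦ (z := R.shift j v z) hv
  have h2 : ‖((1:ℝ), R.b j (z.1 + v))‖ ≤ 1 + R.L := by
    have h3 := R.norm_b_le j hv hvT
    have h4 : (0:ℝ) ≤ R.L := R.L.2
    rw [Prod.norm_def]
    refine max_le ?_ (by simpa using h3.trans (by linarith))
    simp
  exact mul_le_mul h1 h2 (norm_nonneg _) C.2

lemma intervalIntegrable_durationDeriv {Φ : ℝ × E → ℝ} (hΦ : R.Regular Φ) (j : ι) {z : ℝ × E}
    (hz : 0 < z.1) : IntervalIntegrable (fun v => R.durationDeriv Φ j v z) volume 0 R.T := by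
  obtain ⟨C, hC⟩ := hΦ.lip
  have h1 : ∀ᵐ v ∂(volume.restrict (Ι 0 R.T)), 0 < v ∧ v ≠ R.T - z.1 := by
    refine (ae_restrict_iff' measurableSet_uIoc).mpr ?_
    filter_upwards [Measure.ae_ne volume (R.T - z.1)] with v hv hv'
    rw [uIoc_of_le R.T_pos.le] at hv'
    exact ⟨hv'.1, hv⟩
  refine (intervalIntegrable_const (c := (C : ℝ) * (1 + R.L))).mono_fun' ?_ ?_
  · refine (measurable_deriv fun v => Φ (R.shift j v z)).aestronglyMeasurable.congr ?_
    filter_upwards [h1] with v hv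
    exact (hasDerivAt_comp_shift_duration hΦ j (add_pos hz hv.1) fun h => hv.2 (by linarith)).deriv
  · filter_upwards [h1] with v hv
    exact abs_durationDeriv_le hC j (add_pos hz hv.1) fun h => hv.2 (by linarith)

lemma hasDerivAt_delay_kernel_integral {Φ : ℝ × E → ℝ} (hΦ : R.Regular Φ) (j : ι) {κ : ℝ → ℝ}
    {c : ℝ} (hκm : Measurable κ) (hκ : ∀ v, 0 < v → |κ v| ≤ c)
    (hκc : ∀ v, 0 < v → ContinuousAt κ v) {z : ℝ × E} (hz : 0 < z.1) {y : ℝ} (hy : 0 < y) :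
    HasDerivAt (fun y => ∫ v in (0:ℝ)..R.T, κ (y + v) * Φ (R.shift j v z))
      (κ (y + R.T) * Φ (R.shift j R.T z) - κ y * Φ z -
        ∫ v in (0:ℝ)..R.T, κ (y + v) * R.durationDeriv Φ j v z) y := by
  obtain ⟨C, hC⟩ := hΦ.lip
  have h1 := hasDerivAt_delay_integral R.T_pos hκm hκ hκc (countable_singleton (R.T - z.1))
    ((continuousOn_comp_shift hC j hz.le).mono Icc_subset_Ici_self)
    (fun v hv => hasDerivAt_comp_shift_duration hΦ j (add_pos hz hv.1.1)
      fun h => hv.2 (by rw [mem_singleton_iff]; linarith))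
      (intervalIntegrable_durationDeriv hΦ j hz) hy
  have h0 : R.shift j 0 z = z := by simp [shift]
  rwa [h0] at h1

/-- Joint continuity of kernel integrals with a moving delay. -/
lemma continuousAt_delay_kernel_integral {F : Type*} [NormedAddCommGroup F] [NormedSpace ℝ F]
    {κ : ℝ → ℝ} {c : ℝ} (hκm : Measurable κ) (hκ : ∀ v, 0 < v → |κ v| ≤ c)
    (hκc : ∀ v, 0 < v → ContinuousAt κ v) {X : ℝ → ℝ × E → F} {C : ℝ}
    (hXc : ∀ v z, 0 < v → 0 < z.1 → z.1 ≠ R.T → z.1 + v ≠ R.T →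
      ContinuousAt (fun q : ℝ × (ℝ × E) => X q.1 q.2) (v, z))
    (hX : ∀ v z, 0 < v → 0 < z.1 → z.1 ≠ R.T → z.1 + v ≠ R.T → ‖X v z‖ ≤ C)
    {y : ℝ} (hy : 0 < y) {z : ℝ × E} (hz : 0 < z.1) (hzT : z.1 ≠ R.T) :
    ContinuousAt (fun q : ℝ × (ℝ × E) => ∫ v in (0:ℝ)..R.T, κ (q.1 + v) • X v q.2) (y, z) := by
  refine continuousAt_kernel_integral (κ := fun y v => κ (y + v)) (c := c) R.T_pos.le
    (fun y => hκm.comp (measurable_const_add y)) ?_ ?_ hXc hX hz hzT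
  · filter_upwards [Ioi_mem_nhds hy] with y' hy' v hv using hκ _ (add_pos hy' hv)
  · exact fun v hv => (hκc (y + v) (add_pos hy hv)).comp (f := fun y => y + v) (by fun_prop)

end RenewalData

namespace RenewalData

variable {ι : Type*} [Fintype ι] {E : Type*} [NormedAddCommGroup E] [NormedSpace ℝ E]

/-- The derivative of `Φ ∘ shift` in the space-time variable. -/
noncomputable def shiftFDeriv (R : RenewalData ι E) (Φ : ℝ × E → ℝ) (j : ι) (v : ℝ) (z : ℝ × E) :
    ℝ × E →L[ℝ] ℝ :=
  (fderiv ℝ Φ (R.shift j v z)).comp (R.shiftD j v z.1)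

lemma shiftFDeriv_space (R : RenewalData ι E) (Φ : ℝ × E → ℝ) (j : ι) (v : ℝ) (z : ℝ × E) (e : E) :
    R.shiftFDeriv Φ j v z (0, e) = fderiv ℝ Φ (R.shift j v z) (0, e) := by
  simp [shiftFDeriv, shiftD]

lemma shiftFDeriv_time (R : RenewalData ι E) (Φ : ℝ × E → ℝ) (j : ι) (v : ℝ) (z : ℝ × E) :
    R.shiftFDeriv Φ j v z (1, 0) =
      R.durationDeriv Φ j v z - fderiv ℝ Φ (R.shift j v z) (0, R.b j z.1) := by
  rw [durationDeriv, ← map_sub]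
  simp [shiftFDeriv, shiftD, ← map_add]

variable {R : RenewalData ι E}

lemma intervalIntegrable_kernel_shiftFDeriv {Φ : ℝ × E → ℝ} (hΦ : R.Regular Φ) (j : ι) {κ : ℝ → ℝ}
    {c : ℝ} (hκm : Measurable κ) (hκ : ∀ v, 0 < v → |κ v| ≤ c) {z : ℝ × E} (hz : 0 < z.1)
    (hzT : z.1 ≠ R.T) :
    IntervalIntegrable (fun v => κ v • R.shiftFDeriv Φ j v z) volume 0 R.T := by
  obtain ⟨C, hC⟩ := hΦ.lip
  have hc : 0 ≤ c := (abs_nonneg _).trans (hκ 1 one_pos)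
  have h1 : ∀ᵐ v ∂(volume.restrict (Ι 0 R.T)), 0 < v ∧ z.1 + v ≠ R.T := by
    refine (ae_restrict_iff' measurableSet_uIoc).mpr ?_
    filter_upwards [Measure.ae_ne volume (R.T - z.1)] with v hv hv'
    rw [uIoc_of_le R.T_pos.le] at hv'
    exact ⟨hv'.1, fun h => hv (by linarith)⟩
  refine (intervalIntegrable_const (c := c * (C * (1 + 2 * R.L)))).mono_fun' ?_ ?_
  · have hmeas : MeasurableSet (Ioc (0:ℝ) R.T \ {R.T - z.1}) :=
      measurableSet_Ioc.diff (measurableSet_singleton _)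
    have hcon : ContinuousOn (fun v => R.shiftFDeriv Φ j v z) (Ioc (0:ℝ) R.T \ {R.T - z.1}) := by
      intro v hv
      have := continuousAt_fderiv_comp_shiftD hΦ j hv.1.1 hz hzT
        (fun h => hv.2 (by rw [mem_singleton_iff]; linarith))
      exact (ContinuousAt.comp (f := fun v : ℝ => (v, z)) this (by fun_prop)).continuousWithinAt
    have h2 := hcon.aestronglyMeasurable (μ := volume) hmeas
    rw [uIoc_of_le R.T_pos.le]
    rw [Measure.restrict_congr_set (t := Ioc (0:ℝ) R.T) (sdiff_null_ae_eq_self (by simp))] at h2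
    exact hκm.aestronglyMeasurable.smul h2
  · filter_upwards [h1] with v hv
    rw [norm_smul]
    exact mul_le_mul (hκ v hv.1) (norm_fderiv_comp_shiftD_le hC j hv.1 hz hzT hv.2)
      (norm_nonneg _) hc

/-- Congruence of kernel integrals off the duration at which the terminal time is reached. -/
lemma kernel_integral_congr {F : Type*} [NormedAddCommGroup F] [NormedSpace ℝ F] {κ : ℝ → ℝ}
    {X X' : ℝ → F} {t : ℝ} (h : ∀ v, 0 < v → v ≤ R.T → t + v ≠ R.T → X v = X' v) :
    ∫ v in (0:ℝ)..R.T, κ v • X v = ∫ v in (0:ℝ)..R.T, κ v • X' v := by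
  refine intervalIntegral.integral_congr_ae ?_
  filter_upwards [Measure.ae_ne volume (R.T - t)] with v hv hv'
  rw [uIoc_of_le R.T_pos.le] at hv'
  rw [h v hv'.1 hv'.2 fun h => hv (by linarith)]

end RenewalData

namespace SemiMarkovMarket

variable {k : ℕ} (P : SemiMarkovMarket k)

/-- The discounted value in state `i` with elapsed time `q.1` when the value functions right after
a transition are `Φ`. -/
noncomputable def value (Φ : Fin k → ℝ × (ℝ × ℝ) → ℝ) (i : Fin k) (q : ℝ × (ℝ × (ℝ × ℝ))) : ℝ :=
  Real.exp (Lambda P.lam i q.1 - Lambda P.lam i (q.1 + P.T)) * Φ i (P.renewal.shift i P.T q.2) +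
    Real.exp (Lambda P.lam i q.1) * ∑ l, ∫ v in (0:ℝ)..P.T,
      P.g i l (q.1 + v) * Φ l (P.renewal.shift i v q.2)

/-- The space-time derivative of `value`. -/
noncomputable def valueFDeriv (Φ : Fin k → ℝ × (ℝ × ℝ) → ℝ) (i : Fin k)
    (q : ℝ × (ℝ × (ℝ × ℝ))) : ℝ × (ℝ × ℝ) →L[ℝ] ℝ :=
  Real.exp (Lambda P.lam i q.1 - Lambda P.lam i (q.1 + P.T)) •
      P.renewal.shiftFDeriv (Φ i) i P.T q.2 +
    Real.exp (Lambda P.lam i q.1) • ∑ l, ∫ v in (0:ℝ)..P.T,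
      P.g i l (q.1 + v) • P.renewal.shiftFDeriv (Φ l) i v q.2

/-- The derivative of `value` in the elapsed time. -/
noncomputable def valueDelayDeriv (Φ : Fin k → ℝ × (ℝ × ℝ) → ℝ) (i : Fin k)
    (q : ℝ × (ℝ × (ℝ × ℝ))) : ℝ :=
  Real.exp (Lambda P.lam i q.1 - Lambda P.lam i (q.1 + P.T)) *
      (sumLam P.lam i q.1 - sumLam P.lam i (q.1 + P.T)) * Φ i (P.renewal.shift i P.T q.2) +
    (Real.exp (Lambda P.lam i q.1) * sumLam P.lam i q.1 * (∑ l, ∫ v in (0:ℝ)..P.T,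
      P.g i l (q.1 + v) * Φ l (P.renewal.shift i v q.2)) +
    Real.exp (Lambda P.lam i q.1) * ∑ l, (P.g i l (q.1 + P.T) * Φ l (P.renewal.shift i P.T q.2) -
      P.g i l q.1 * Φ l q.2 - ∫ v in (0:ℝ)..P.T,
        P.g i l (q.1 + v) * P.renewal.durationDeriv (Φ l) i v q.2))

variable {P} {Φ : Fin k → ℝ × (ℝ × ℝ) → ℝ}

lemma hasFDerivAt_value (hΦ : ∀ l, P.renewal.Regular (Φ l)) (i : Fin k) {y : ℝ} (hy : 0 < y)
    {z : ℝ × (ℝ × ℝ)} (hz : 0 < z.1) (hzT : z.1 ≠ P.T) :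
    HasFDerivAt (fun z => P.value Φ i (y, z)) (P.valueFDeriv Φ i (y, z)) z := by
  have h1 := RenewalData.hasFDerivAt_comp_shift (hΦ i) i (v := P.T) P.T_pos hz hzT
    (fun h => hz.ne' (left_eq_add.mp (by rw [add_comm]; exact h.symm)))
  have h2 := fun l => RenewalData.hasFDerivAt_kernel_integral (hΦ l) i (P.measurable_g_add i l y)
    (P.abs_g_add_le i l hy.le) hz hzT
  exact (h1.const_mul (Real.exp (Lambda P.lam i y - Lambda P.lam i (y + P.T)))).add
    ((HasFDerivAt.fun_sum (u := Finset.univ) fun l _ => h2 l).const_mul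
      (Real.exp (Lambda P.lam i y)))

lemma hasDerivAt_value_delay (hΦ : ∀ l, P.renewal.Regular (Φ l)) (i : Fin k) {y : ℝ} (hy : 0 < y)
    {z : ℝ × (ℝ × ℝ)} (hz : 0 < z.1) :
    HasDerivAt (fun y => P.value Φ i (y, z)) (P.valueDelayDeriv Φ i (y, z)) y := by
  have h1 := P.hasDerivAt_Lambda i hy
  have h2 := (P.hasDerivAt_Lambda i (add_pos hy P.T_pos)).comp_add_const y P.T
  have h3 := fun l => RenewalData.hasDerivAt_delay_kernel_integral (R := P.renewal) (hΦ l) i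
    (P.measurable_g i l) (fun v hv => P.abs_g_le i l hv) (fun v hv => P.continuousAt_g i l hv) hz hy
  exact ((h1.sub h2).exp.mul_const (Φ i (P.renewal.shift i P.T z))).add
    (h1.exp.mul (HasDerivAt.fun_sum (u := Finset.univ) fun l _ => h3 l))

section Continuity

lemma continuousAt_Lambda_fst (i : Fin k) {q : ℝ × (ℝ × (ℝ × ℝ))} (hy : 0 < q.1) :
    ContinuousAt (fun q : ℝ × (ℝ × (ℝ × ℝ)) => Lambda P.lam i q.1) q :=
  (P.hasDerivAt_Lambda i hy).continuousAt.comp continuousAt_fst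

lemma continuousAt_Lambda_fst_add (i : Fin k) {q : ℝ × (ℝ × (ℝ × ℝ))} (hy : 0 < q.1) :
    ContinuousAt (fun q : ℝ × (ℝ × (ℝ × ℝ)) => Lambda P.lam i (q.1 + P.T)) q :=
  ContinuousAt.comp (f := fun q : ℝ × (ℝ × (ℝ × ℝ)) => q.1 + P.T)
    (P.hasDerivAt_Lambda i (add_pos hy P.T_pos)).continuousAt (by fun_prop)

lemma continuousAt_comp_shift {Φ : ℝ × (ℝ × ℝ) → ℝ} (hΦ : P.renewal.Regular Φ) (i : Fin k) {v : ℝ}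
    {z : ℝ × (ℝ × ℝ)} (hv : 0 < v) (hz : 0 < z.1) :
    ContinuousAt (fun q : ℝ × (ℝ × (ℝ × ℝ)) => Φ (P.renewal.shift i q.1 q.2)) (v, z) := by
  obtain ⟨C, hC⟩ := hΦ.lip
  have h1 : ContinuousAt Φ (P.renewal.shift i v z) :=
    (hC.continuousOn _ (add_pos hz hv).le).continuousAt
    (nonneg_mem_nhds (add_pos hz hv))
  exact ContinuousAt.comp (f := fun q : ℝ × (ℝ × (ℝ × ℝ)) => P.renewal.shift i q.1 q.2) h1
    (P.renewal.continuous_shift i).continuousAt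

lemma continuousAt_comp_shift_T {F : Type*} [TopologicalSpace F] {X : ℝ → ℝ × (ℝ × ℝ) → F}
    {q : ℝ × (ℝ × (ℝ × ℝ))}
    (hX : ContinuousAt (fun q : ℝ × (ℝ × (ℝ × ℝ)) => X q.1 q.2) (P.T, q.2)) :
    ContinuousAt (fun q : ℝ × (ℝ × (ℝ × ℝ)) => X P.T q.2) q :=
  ContinuousAt.comp (f := fun q : ℝ × (ℝ × (ℝ × ℝ)) => (P.T, q.2)) hX (by fun_prop)

lemma continuousAt_integral_g {F : Type*} [NormedAddCommGroup F] [NormedSpace ℝ F] (i l : Fin k)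
    {X : ℝ → ℝ × (ℝ × ℝ) → F} {C : ℝ}
    (hXc : ∀ v z, 0 < v → 0 < z.1 → z.1 ≠ P.T → z.1 + v ≠ P.T →
      ContinuousAt (fun q : ℝ × (ℝ × (ℝ × ℝ)) => X q.1 q.2) (v, z))
    (hX : ∀ v z, 0 < v → 0 < z.1 → z.1 ≠ P.T → z.1 + v ≠ P.T → ‖X v z‖ ≤ C)
    {q : ℝ × (ℝ × (ℝ × ℝ))} (hy : 0 < q.1) (hz : 0 < q.2.1) (hzT : q.2.1 ≠ P.T) :
    ContinuousAt (fun q : ℝ × (ℝ × (ℝ × ℝ)) => ∫ v in (0:ℝ)..P.T, P.g i l (q.1 + v) • X v q.2) q :=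
  RenewalData.continuousAt_delay_kernel_integral (R := P.renewal) (P.measurable_g i l)
    (fun _ hv => P.abs_g_le i l hv) (fun _ hv => P.continuousAt_g i l hv) hXc hX hy hz hzT

lemma add_T_ne {t : ℝ} (ht : 0 < t) : t + P.T ≠ P.T := fun h => ht.ne' (by linarith)

lemma continuousAt_integral_g_comp_shift (hΦ : ∀ l, P.renewal.Regular (Φ l))
    (hb : ∃ C, ∀ l z, 0 ≤ z.1 → |Φ l z| ≤ C) (i l : Fin k)
    {q : ℝ × (ℝ × (ℝ × ℝ))} (hy : 0 < q.1) (hz : 0 < q.2.1) (hzT : q.2.1 ≠ P.T) :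
    ContinuousAt (fun q : ℝ × (ℝ × (ℝ × ℝ)) => ∫ v in (0:ℝ)..P.T,
      P.g i l (q.1 + v) * Φ l (P.renewal.shift i v q.2)) q := by
  obtain ⟨C, hC⟩ := hb
  exact continuousAt_integral_g i l (X := fun v z => Φ l (P.renewal.shift i v z)) (C := C)
    (fun v z hv hz _ _ => continuousAt_comp_shift (hΦ l) i hv hz)
    (fun v z hv hz _ _ => hC l _ (add_pos hz hv).le) hy hz hzT

lemma continuousAt_value (hΦ : ∀ l, P.renewal.Regular (Φ l))
    (hb : ∃ C, ∀ l z, 0 ≤ z.1 → |Φ l z| ≤ C) (i : Fin k)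
    {q : ℝ × (ℝ × (ℝ × ℝ))} (hy : 0 < q.1) (hz : 0 < q.2.1) (hzT : q.2.1 ≠ P.T) :
    ContinuousAt (P.value Φ i) q := by
  refine ContinuousAt.add (ContinuousAt.mul
    ((continuousAt_Lambda_fst i hy).sub (continuousAt_Lambda_fst_add i hy)).rexp
    (continuousAt_comp_shift_T (X := fun v z => Φ i (P.renewal.shift i v z))
      (continuousAt_comp_shift (hΦ i) i P.T_pos hz)))
    (ContinuousAt.mul (continuousAt_Lambda_fst i hy).rexp ?_)
  exact tendsto_finsetSum _ fun l _ => continuousAt_integral_g_comp_shift hΦ hb i l hy hz hzT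

lemma continuousAt_valueFDeriv (hΦ : ∀ l, P.renewal.Regular (Φ l)) (i : Fin k)
    {q : ℝ × (ℝ × (ℝ × ℝ))} (hy : 0 < q.1) (hz : 0 < q.2.1) (hzT : q.2.1 ≠ P.T) :
    ContinuousAt (P.valueFDeriv Φ i) q := by
  refine ContinuousAt.add (ContinuousAt.smul
    ((continuousAt_Lambda_fst i hy).sub (continuousAt_Lambda_fst_add i hy)).rexp
    (continuousAt_comp_shift_T (X := P.renewal.shiftFDeriv (Φ i) i)
    (RenewalData.continuousAt_fderiv_comp_shiftD (hΦ i) i P.T_pos hz hzT (add_T_ne hz))))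
    (ContinuousAt.smul (continuousAt_Lambda_fst i hy).rexp ?_)
  refine tendsto_finsetSum _ fun l _ => ?_
  obtain ⟨C, hC⟩ := (hΦ l).lip
  exact continuousAt_integral_g i l
    (fun v z hv hz hzT hvT => RenewalData.continuousAt_fderiv_comp_shiftD (hΦ l) i hv hz hzT hvT)
    (fun v z hv hz hzT hvT => RenewalData.norm_fderiv_comp_shiftD_le hC i hv hz hzT hvT) hy hz hzT

lemma continuousAt_valueDelayDeriv (hΦ : ∀ l, P.renewal.Regular (Φ l))
    (hb : ∃ C, ∀ l z, 0 ≤ z.1 → |Φ l z| ≤ C) (i : Fin k)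
    {q : ℝ × (ℝ × (ℝ × ℝ))} (hy : 0 < q.1) (hz : 0 < q.2.1) (hzT : q.2.1 ≠ P.T) :
    ContinuousAt (P.valueDelayDeriv Φ i) q := by
  have hyT := add_pos hy P.T_pos
  have hΛ := continuousAt_Lambda_fst (P := P) i hy
  have hΛT := continuousAt_Lambda_fst_add (P := P) i hy
  have hadd : ContinuousAt (fun q : ℝ × (ℝ × (ℝ × ℝ)) => q.1 + P.T) q := by fun_prop
  have hs : ContinuousAt (fun q : ℝ × (ℝ × (ℝ × ℝ)) => sumLam P.lam i q.1) q :=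
    (P.continuousAt_sumLam i hy).comp continuousAt_fst
  have hsT : ContinuousAt (fun q : ℝ × (ℝ × (ℝ × ℝ)) => sumLam P.lam i (q.1 + P.T)) q :=
    ContinuousAt.comp (f := fun q : ℝ × (ℝ × (ℝ × ℝ)) => q.1 + P.T)
      (P.continuousAt_sumLam i hyT) hadd
  have hH : ∀ l, ContinuousAt (fun q : ℝ × (ℝ × (ℝ × ℝ)) => Φ l (P.renewal.shift i P.T q.2)) q :=
    fun l => continuousAt_comp_shift_T (X := fun v z => Φ l (P.renewal.shift i v z))
      (continuousAt_comp_shift (hΦ l) i P.T_pos hz)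
  have hI : ContinuousAt (fun q : ℝ × (ℝ × (ℝ × ℝ)) => ∑ l, ∫ v in (0:ℝ)..P.T,
      P.g i l (q.1 + v) * Φ l (P.renewal.shift i v q.2)) q :=
    tendsto_finsetSum _ fun l _ => continuousAt_integral_g_comp_shift hΦ hb i l hy hz hzT
  refine ((((hΛ.sub hΛT).rexp.mul (hs.sub hsT)).mul (hH i)).add (((hΛ.rexp.mul hs).mul hI).add
    (hΛ.rexp.mul ?_)))
  refine tendsto_finsetSum _ fun l _ => ?_
  obtain ⟨C, hC⟩ := (hΦ l).lip
  have hg : ContinuousAt (fun q : ℝ × (ℝ × (ℝ × ℝ)) => P.g i l q.1) q :=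
    (P.continuousAt_g i l hy).comp continuousAt_fst
  have hgT : ContinuousAt (fun q : ℝ × (ℝ × (ℝ × ℝ)) => P.g i l (q.1 + P.T)) q :=
    ContinuousAt.comp (f := fun q : ℝ × (ℝ × (ℝ × ℝ)) => q.1 + P.T) (P.continuousAt_g i l hyT) hadd
  have hΦ0 : ContinuousAt (fun q : ℝ × (ℝ × (ℝ × ℝ)) => Φ l q.2) q :=
    ContinuousAt.comp (f := fun q : ℝ × (ℝ × (ℝ × ℝ)) => q.2)
      ((hC.continuousOn _ hz.le).continuousAt (nonneg_mem_nhds hz)) continuousAt_snd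
  refine ((hgT.mul (hH l)).sub (hg.mul hΦ0)).sub ?_
  exact continuousAt_integral_g i l
    (fun v z hv hz hzT hvT => RenewalData.continuousAt_durationDeriv (hΦ l) i hv hz hvT)
    (fun v z hv hz hzT hvT => RenewalData.abs_durationDeriv_le hC i (add_pos hz hv) hvT) hy hz hzT

end Continuity

variable (P)

/-- Value functions after a transition together with their first two log-price derivatives, solving
the heat equation on `Dom`. -/
structure HeatJet (Dom : Set (ℝ × (ℝ × ℝ))) (Φ Φ₁ Φ₂ : Fin k → ℝ × (ℝ × ℝ) → ℝ) : Prop where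
  regular : ∀ l, P.renewal.Regular (Φ l)
  regular₁ : ∀ l, P.renewal.Regular (Φ₁ l)
  bdd : ∃ C, ∀ l z, 0 ≤ z.1 → |Φ l z| ≤ C
  bdd₁ : ∃ C, ∀ l z, 0 ≤ z.1 → |Φ₁ l z| ≤ C
  bdd₂ : ∃ C, ∀ l z, 0 ≤ z.1 → |Φ₂ l z| ≤ C
  regular₂ : ∀ l, P.renewal.Regular (Φ₂ l)
  terminal : ∀ l j z, P.T ≤ z.1 → Φ l z = Φ j z
  fderiv_time : ∀ l z, P.T < z.1 → fderiv ℝ (Φ l) z (1, 0) = 0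
  fderiv_log : ∀ l z, 0 < z.1 → z.1 ≠ P.T → fderiv ℝ (Φ l) z (0, (0, 1)) = Φ₁ l z
  fderiv_log₁ : ∀ l z, 0 < z.1 → z.1 ≠ P.T → fderiv ℝ (Φ₁ l) z (0, (0, 1)) = Φ₂ l z
  heat : ∀ l, ∀ z ∈ Dom, 0 < z.1 → z.1 ≠ P.T →
    fderiv ℝ (Φ l) z (0, (1, 0)) = 1 / 2 * (Φ₂ l z + Φ₁ l z)

variable {P}

lemma valueFDeriv_apply {Φ : Fin k → ℝ × (ℝ × ℝ) → ℝ} (hΦ : ∀ l, P.renewal.Regular (Φ l))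
    (i : Fin k) {y : ℝ} (hy : 0 < y) {z : ℝ × (ℝ × ℝ)} (hz : 0 < z.1) (hzT : z.1 ≠ P.T)
    (e : ℝ × (ℝ × ℝ)) :
    P.valueFDeriv Φ i (y, z) e =
      Real.exp (Lambda P.lam i y - Lambda P.lam i (y + P.T)) *
        P.renewal.shiftFDeriv (Φ i) i P.T z e +
      Real.exp (Lambda P.lam i y) * ∑ l, ∫ v in (0:ℝ)..P.T,
        P.g i l (y + v) * P.renewal.shiftFDeriv (Φ l) i v z e := by
  have h1 : ∀ l, (∫ v in (0:ℝ)..P.T, P.g i l (y + v) • P.renewal.shiftFDeriv (Φ l) i v z) e =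
      ∫ v in (0:ℝ)..P.T, P.g i l (y + v) * P.renewal.shiftFDeriv (Φ l) i v z e := fun l =>
    ContinuousLinearMap.intervalIntegral_apply (RenewalData.intervalIntegrable_kernel_shiftFDeriv
      (hΦ l) i (P.measurable_g_add i l y) (P.abs_g_add_le i l hy.le) hz hzT) e
  simp only [valueFDeriv, add_apply, smul_apply, sum_apply, h1, smul_eq_mul]

lemma valueFDeriv_log {Φ Φ₁ : Fin k → ℝ × (ℝ × ℝ) → ℝ} (hΦ : ∀ l, P.renewal.Regular (Φ l))
    (hlog : ∀ l z, 0 < z.1 → z.1 ≠ P.T → fderiv ℝ (Φ l) z (0, (0, 1)) = Φ₁ l z)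
    (i : Fin k) {y : ℝ} (hy : 0 < y) {z : ℝ × (ℝ × ℝ)} (hz : 0 < z.1) (hzT : z.1 ≠ P.T) :
    P.valueFDeriv Φ i (y, z) (0, (0, 1)) = P.value Φ₁ i (y, z) := by
  rw [valueFDeriv_apply hΦ i hy hz hzT, value]
  simp only [RenewalData.shiftFDeriv_space]
  rw [hlog i _ (add_pos hz P.T_pos) (add_T_ne hz)]
  congr 2
  refine Finset.sum_congr rfl fun l _ => ?_
  exact RenewalData.kernel_integral_congr (R := P.renewal) fun v hv _ hvT =>
    hlog l _ (add_pos hz hv) hvT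

/-- The backward equation for `value` in log-price coordinates. -/
lemma HeatJet.backward_eq {Dom : Set (ℝ × (ℝ × ℝ))} {Φ Φ₁ Φ₂ : Fin k → ℝ × (ℝ × ℝ) → ℝ}
    (J : P.HeatJet Dom Φ Φ₁ Φ₂) (i : Fin k) {y : ℝ} (hy : 0 < y) {z : ℝ × (ℝ × ℝ)} (hz : 0 < z.1)
    (hzT : z.1 < P.T) (hDom : ∀ v, 0 < v → v ≤ P.T → P.renewal.shift i v z ∈ Dom) :
    P.valueFDeriv Φ i (y, z) (1, 0) + P.valueDelayDeriv Φ i (y, z) +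
      P.r i * P.value Φ₁ i (y, z) +
      1 / 2 * P.σ z.1 i ^ 2 * (P.value Φ₂ i (y, z) + P.value Φ₁ i (y, z)) +
      ∑ l ∈ Finset.univ.filter (fun l => l ≠ i), P.lam i l y * (Φ l z - P.value Φ i (y, z)) =
        0 := by
  have hb : P.renewal.b i z.1 = (P.σ z.1 i ^ 2, P.r i) := by
    change P.b i z.1 = _
    rw [b, if_pos hzT, max_eq_left hz.le]
  have hspace : ∀ l v, 0 < v → v ≤ P.T → z.1 + v ≠ P.T →
      P.renewal.shiftFDeriv (Φ l) i v z (1, 0) = P.renewal.durationDeriv (Φ l) i v z -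
        (1 / 2 * P.σ z.1 i ^ 2 * (Φ₂ l (P.renewal.shift i v z) + Φ₁ l (P.renewal.shift i v z)) +
          P.r i * Φ₁ l (P.renewal.shift i v z)) := by
    intro l v hv hv' hvT
    have h1 : ((0:ℝ), ((P.σ z.1 i ^ 2, P.r i) : ℝ × ℝ)) =
        P.σ z.1 i ^ 2 • ((0:ℝ), ((1:ℝ), (0:ℝ))) + P.r i • ((0:ℝ), ((0:ℝ), (1:ℝ))) := by
      ext <;> simp
    rw [RenewalData.shiftFDeriv_time, hb, h1, map_add, map_smul, map_smul,
      J.fderiv_log l _ (add_pos hz hv) hvT, J.heat l _ (hDom v hv hv') (add_pos hz hv) hvT,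
      smul_eq_mul, smul_eq_mul]
    ring
  have hend : P.renewal.durationDeriv (Φ i) i P.T z = 0 := by
    rw [RenewalData.durationDeriv]
    change fderiv ℝ (Φ i) _ (1, P.b i (z.1 + P.T)) = 0
    rw [b, if_neg (by linarith)]
    exact J.fderiv_time i _ (by simp only [RenewalData.shift]; linarith)
  have hi0 : ∀ {X : ℝ × (ℝ × ℝ) → ℝ}, P.renewal.Regular X → ∀ l, IntervalIntegrable
      (fun v => P.g i l (y + v) * X (P.renewal.shift i v z)) volume 0 P.T := by
    rintro X hX l
    obtain ⟨C, hC⟩ := hX.lip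
    exact RenewalData.intervalIntegrable_kernel_shift hC i (P.measurable_g_add i l y)
      (P.abs_g_add_le i l hy.le) hz.le
  have hi1 : ∀ l, IntervalIntegrable
      (fun v => P.g i l (y + v) * P.renewal.durationDeriv (Φ l) i v z) volume 0 P.T := by
    intro l
    have h1 : IntervalIntegrable (fun v => P.renewal.durationDeriv (Φ l) i v z) volume 0 P.T :=
      RenewalData.intervalIntegrable_durationDeriv (J.regular l) i hz
    refine (h1.norm.const_mul P.c).mono_fun'
      ((P.measurable_g_add i l y).aestronglyMeasurable.mul h1.def'.aestronglyMeasurable) ?_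
    refine (ae_restrict_iff' measurableSet_uIoc).mpr (Eventually.of_forall fun v hv => ?_)
    rw [uIoc_of_le P.T_pos.le] at hv
    change ‖_ * _‖ ≤ _
    rw [norm_mul]
    exact mul_le_mul_of_nonneg_right (P.abs_g_add_le i l hy.le v hv.1) (norm_nonneg _)
  have hInt : ∀ l, ∫ v in (0:ℝ)..P.T, P.g i l (y + v) * P.renewal.shiftFDeriv (Φ l) i v z (1, 0) =
      (∫ v in (0:ℝ)..P.T, P.g i l (y + v) * P.renewal.durationDeriv (Φ l) i v z) -
      (1 / 2 * P.σ z.1 i ^ 2 *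
        ((∫ v in (0:ℝ)..P.T, P.g i l (y + v) * Φ₂ l (P.renewal.shift i v z)) +
        ∫ v in (0:ℝ)..P.T, P.g i l (y + v) * Φ₁ l (P.renewal.shift i v z)) +
        P.r i * ∫ v in (0:ℝ)..P.T, P.g i l (y + v) * Φ₁ l (P.renewal.shift i v z)) := by
    intro l
    refine (RenewalData.kernel_integral_congr (R := P.renewal) fun v hv hv' hvT =>
      hspace l v hv hv' hvT).trans ?_
    rw [← intervalIntegral.integral_add (hi0 (J.regular₂ l) l) (hi0 (J.regular₁ l) l),
      ← intervalIntegral.integral_const_mul, ← intervalIntegral.integral_const_mul,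
      ← intervalIntegral.integral_add
        (((hi0 (J.regular₂ l) l).add (hi0 (J.regular₁ l) l)).const_mul _)
        ((hi0 (J.regular₁ l) l).const_mul _), ← intervalIntegral.integral_sub (hi1 l)
        ((((hi0 (J.regular₂ l) l).add (hi0 (J.regular₁ l) l)).const_mul _).add
          ((hi0 (J.regular₁ l) l).const_mul _))]
    refine intervalIntegral.integral_congr fun v _ => ?_
    simp only [smul_eq_mul]
    ring
  have hsumT : ∑ l, P.g i l (y + P.T) * Φ l (P.renewal.shift i P.T z) =
      sumLam P.lam i (y + P.T) * Real.exp (-Lambda P.lam i (y + P.T)) *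
        Φ i (P.renewal.shift i P.T z) := by
    rw [← P.sum_g i (add_pos hy P.T_pos), Finset.sum_mul]
    refine Finset.sum_congr rfl fun l _ => ?_
    rw [J.terminal l i _ (by simp only [RenewalData.shift]; linarith)]
  have hsum0 : Real.exp (Lambda P.lam i y) * ∑ l, P.g i l y * Φ l z =
      ∑ l ∈ Finset.univ.filter (fun l => l ≠ i), P.lam i l y * Φ l z := by
    rw [Finset.mul_sum, Finset.sum_filter]
    refine Finset.sum_congr rfl fun l _ => ?_
    by_cases hl : l = i
    · rw [if_neg (not_not.mpr hl), hl, P.g_self]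
      ring
    · rw [if_pos hl, P.g_of_pos (Ne.symm hl) hy, Real.exp_neg]
      have := (Real.exp_pos (Lambda P.lam i y)).ne'
      field_simp
  have hlamsum : ∑ l ∈ Finset.univ.filter (fun l => l ≠ i),
      P.lam i l y * (Φ l z - P.value Φ i (y, z)) =
      Real.exp (Lambda P.lam i y) * (∑ l, P.g i l y * Φ l z) -
        sumLam P.lam i y * P.value Φ i (y, z) := by
    rw [hsum0, sumLam, Finset.sum_mul, ← Finset.sum_sub_distrib]
    exact Finset.sum_congr rfl fun l _ => by ring
  rw [valueFDeriv_apply J.regular i hy hz hzT.ne, hspace i P.T P.T_pos le_rfl (add_T_ne hz), hend,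
    hlamsum, Finset.sum_congr rfl fun l _ => hInt l]
  simp only [value, valueDelayDeriv, Finset.sum_sub_distrib, Finset.sum_add_distrib,
    ← Finset.mul_sum,
    hsumT, Real.exp_sub, Real.exp_neg]
  have := (Real.exp_pos (Lambda P.lam i (y + P.T))).ne'
  field_simp
  ring

end SemiMarkovMarket

section SmoothCompact

variable {E : Type*} [NormedAddCommGroup E] [NormedSpace ℝ E]

open scoped ContDiff

/-- Smooth compactly supported functions. -/
structure SmoothCompact (f : E → ℝ) : Prop where
  contDiff : ContDiff ℝ ∞ f
  hasCompactSupport : HasCompactSupport f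

namespace SmoothCompact

variable {f : E → ℝ}

lemma fderiv_apply (hf : SmoothCompact f) (e : E) : SmoothCompact fun a => fderiv ℝ f a e where
  contDiff := (hf.contDiff.fderiv_right (by simp)).clm_apply contDiff_const
  hasCompactSupport := hf.hasCompactSupport.fderiv_apply ℝ e

lemma exists_abs_le (hf : SmoothCompact f) : ∃ C, ∀ a, |f a| ≤ C :=
  hf.hasCompactSupport.exists_bound_of_continuous hf.contDiff.continuous

lemma exists_lipschitzWith (hf : SmoothCompact f) : ∃ C, LipschitzWith C f :=
  hf.contDiff.lipschitzWith_of_hasCompactSupport hf.hasCompactSupport (by simp)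

lemma exists_taylor_bound (hf : SmoothCompact f) (e : E) : ∃ C, 0 ≤ C ∧ ∀ (a : E) (τ : ℝ),
    |f (a + τ • e) - f a - τ * fderiv ℝ f a e| ≤ C * τ ^ 2 := by
  obtain ⟨C, hC⟩ := (hf.fderiv_apply e).exists_lipschitzWith
  refine ⟨C * ‖e‖, by positivity, fun a τ => ?_⟩
  have hd : ∀ u : ℝ, HasDerivAt (fun u : ℝ => f (a + u • e) - u * fderiv ℝ f a e)
      (fderiv ℝ f (a + u • e) e - fderiv ℝ f a e) u := by
    intro u
    have h1 : HasDerivAt (fun u : ℝ => a + u • e) e u := by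
      simpa using ((hasDerivAt_id u).smul_const e).const_add a
    have h2 := (hf.contDiff.differentiable (by simp) (a + u • e)).hasFDerivAt
    have h3 := (hasDerivAt_id u).mul_const (fderiv ℝ f a e)
    rw [one_mul] at h3
    exact (h2.comp_hasDerivAt u h1).sub h3
  have hb : ∀ u ∈ uIcc 0 τ, ‖fderiv ℝ f (a + u • e) e - fderiv ℝ f a e‖ ≤ C * ‖e‖ * |τ| := by
    intro u hu
    have h1 := hC.dist_le_mul (a + u • e) a
    rw [dist_self_add_left, norm_smul, Real.norm_eq_abs, dist_eq_norm] at h1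
    have h2 : |u| ≤ |τ| := by
      have := abs_sub_left_of_mem_uIcc hu
      simpa using this
    calc _ ≤ (C : ℝ) * (|u| * ‖e‖) := h1
      _ ≤ C * (|τ| * ‖e‖) := by gcongr
      _ = _ := by ring
  have h := (convex_uIcc (0:ℝ) τ).norm_image_sub_le_of_norm_hasDerivWithin_le
    (fun u _ => (hd u).hasDerivWithinAt) hb left_mem_uIcc right_mem_uIcc
  simp only [zero_smul, add_zero, zero_mul, sub_zero, Real.norm_eq_abs] at h
  calc _ = |f (a + τ • e) - τ * fderiv ℝ f a e - f a| := by ring_nf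
    _ ≤ _ := h
    _ = _ := by rw [mul_assoc, abs_mul_abs_self, sq]

end SmoothCompact

/-- A function that is smooth on the right half-plane agrees near a rectangle with a smooth
compactly supported function. -/
lemma exists_smoothCompact_eventuallyEq {f : ℝ × ℝ → ℝ}
    (hf : ∀ n : ℕ, ContDiffOn ℝ n f {a | 0 < a.1}) {p q a b : ℝ} (hp : 0 < p) (hpq : p ≤ q)
    (hab : a ≤ b) :
    ∃ g : ℝ × ℝ → ℝ, SmoothCompact g ∧ ∀ z : ℝ × ℝ, z.1 ∈ Icc p q → z.2 ∈ Icc a b →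
      g =ᶠ[𝓝 z] f := by
  let χ : ContDiffBump ((p + q) / 2) :=
    ⟨(q - p) / 2 + p / 4, (q - p) / 2 + p / 2, by linarith, by linarith⟩
  let ξ : ContDiffBump ((a + b) / 2) :=
    ⟨(b - a) / 2 + 1, (b - a) / 2 + 2, by linarith, by linarith⟩
  have hχ0 : ∀ x, x ≤ p / 2 → χ x = 0 := fun x hx => χ.zero_of_le_dist (by
    rw [Real.dist_eq, abs_sub_comm]
    exact le_trans (by change (q - p) / 2 + p / 2 ≤ _; linarith) (le_abs_self _))
  refine ⟨fun z => χ z.1 * ξ z.2 * f z, ⟨?_, ?_⟩, ?_⟩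
  · rw [contDiff_infty]
    intro n
    rw [contDiff_iff_contDiffAt]
    intro z
    rcases lt_or_ge 0 z.1 with hz | hz
    · have h1 : ContDiffAt ℝ n f z :=
        (hf n).contDiffAt ((isOpen_lt continuous_const continuous_fst).mem_nhds hz)
      have h2 : ContDiffAt ℝ n (fun z : ℝ × ℝ => χ z.1) z :=
        χ.contDiff.contDiffAt.comp z contDiffAt_fst
      have h3 : ContDiffAt ℝ n (fun z : ℝ × ℝ => ξ z.2) z :=
        ξ.contDiff.contDiffAt.comp z contDiffAt_snd
      exact (h2.mul h3).mul h1
    · refine (contDiffAt_const (c := (0:ℝ))).congr_of_eventuallyEq ?_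
      filter_upwards [(isOpen_lt continuous_fst continuous_const).mem_nhds
        (show z.1 < p / 2 by linarith)] with w hw
      rw [hχ0 w.1 (le_of_lt hw), zero_mul, zero_mul]
  · refine HasCompactSupport.intro (K := tsupport χ ×ˢ tsupport ξ)
      (χ.hasCompactSupport.isCompact.prod ξ.hasCompactSupport.isCompact) fun z hz => ?_
    rw [mem_prod, not_and_or] at hz
    rcases hz with hz | hz
    · rw [image_eq_zero_of_notMem_tsupport hz, zero_mul, zero_mul]
    · rw [image_eq_zero_of_notMem_tsupport hz, mul_zero, zero_mul]
  · intro z hz1 hz2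
    have h1 : ∀ᶠ w : ℝ × ℝ in 𝓝 z, χ w.1 = 1 := continuousAt_fst.eventually
      (χ.eventuallyEq_one_of_mem_ball (by
        rw [Metric.mem_ball, Real.dist_eq, abs_lt]
        change -((q - p) / 2 + p / 4) < _ ∧ _ < (q - p) / 2 + p / 4
        constructor <;> linarith [hz1.1, hz1.2]))
    have h2 : ∀ᶠ w : ℝ × ℝ in 𝓝 z, ξ w.2 = 1 := continuousAt_snd.eventually
      (ξ.eventuallyEq_one_of_mem_ball (by
        rw [Metric.mem_ball, Real.dist_eq, abs_lt]
        change -((b - a) / 2 + 1) < _ ∧ _ < (b - a) / 2 + 1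
        constructor <;> linarith [hz2.1, hz2.2]))
    filter_upwards [h1, h2] with w hw1 hw2
    rw [hw1, hw2, one_mul, one_mul]

end SmoothCompact

namespace RenewalData

variable {ι : Type*} [Fintype ι] {E : Type*} [NormedAddCommGroup E] [NormedSpace ℝ E]
  {R : RenewalData ι E}

lemma exists_solvesOn_of_smoothCompact (R : RenewalData ι E) {f : E → ℝ} (hf : SmoothCompact f) :
    ∃ Φ : ι → ℝ × E → ℝ, R.SolvesOn {z | 0 ≤ z.1} f Φ ∧ ∀ j, R.Regular (Φ j) := by
  obtain ⟨C, hC⟩ := hf.exists_lipschitzWith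
  obtain ⟨B, hB⟩ := hf.exists_abs_le
  exact R.exists_solvesOn (hf.contDiff.of_le (by simp)) hC hB

/-- Spatial derivatives of a solution are solutions. -/
lemma SolvesOn.fderiv_space {f : E → ℝ} {Φ Φ' : ι → ℝ × E → ℝ} {e : E}
    (h : R.SolvesOn {z | 0 ≤ z.1} f Φ) (hf : SmoothCompact f)
    (h' : R.SolvesOn {z | 0 ≤ z.1} (fun a => fderiv ℝ f a e) Φ') {j : ι} (hΦ : R.Regular (Φ j))
    {z : ℝ × E} (hz : 0 < z.1) (hzT : z.1 ≠ R.T) :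
    fderiv ℝ (Φ j) z (0, e) = Φ' j z := by
  obtain ⟨C, hC0, hC⟩ := hf.exists_taylor_bound e
  have h1 := h.hasDerivAt h' e hC0 hC j z hz.le
  have h2 : HasDerivAt (fun τ : ℝ => z + ((0:ℝ), τ • e)) (0, e) 0 := by
    have := ((hasDerivAt_id (0:ℝ)).smul_const ((0:ℝ), e)).const_add z
    simpa using this
  have h3 := (hΦ.hasFDerivAt hz hzT)
  have h4 : HasFDerivAt (Φ j) (fderiv ℝ (Φ j) z) (z + ((0:ℝ), (0:ℝ) • e)) := by
    rwa [zero_smul, Prod.mk_zero_zero, add_zero]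
  exact (h4.comp_hasDerivAt 0 h2).unique h1

end RenewalData

namespace SemiMarkovMarket

variable {k : ℕ} {P : SemiMarkovMarket k} {φ : ℝ → ℝ → Fin k → ℝ → ℝ} {h : ℝ → ℝ} {M : ℝ}

/-- Space-time points from which the evolution reaches the horizon with accumulated variance in
`[m (T - T₁), S T]` and log-price in `[a, b + S T]`. -/
def box (P : SemiMarkovMarket k) (T₁ a b : ℝ) : Set (ℝ × (ℝ × ℝ)) :=
  {z | 0 ≤ z.1 ∧ 0 ≤ z.2.1 ∧ P.m * (P.T - T₁) ≤ z.2.1 + P.m * (P.T - min z.1 P.T) ∧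
    z.2.1 + P.S * (P.T - min z.1 P.T) ≤ P.S * P.T ∧ a ≤ z.2.2 ∧
    z.2.2 + P.S * (P.T - min z.1 P.T) ≤ b + P.S * P.T}

lemma invariant_box (T₁ a b : ℝ) : P.renewal.Invariant (P.box T₁ a b) where
  nonneg _ hz := hz.1
  shift_mem i z hz v hv _ := by
    obtain ⟨h1, h2, h3, h4, h5, h6⟩ := hz
    have hmin : min z.1 P.T ≤ min (z.1 + v) P.T := min_le_min_right _ (by linarith)
    have hc := P.cumVar_sub_bounds i hmin (min_le_right _ _)
    have h0 := P.shift_nonneg (i := i) (z := z) hv.le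
    have hr := mul_le_mul_of_nonneg_right (P.r_le i) (sub_nonneg.mpr hmin)
    have e1 : (P.renewal.shift i v z).1 = z.1 + v := rfl
    have e2 : (P.renewal.shift i v z).2.1 = z.2.1 + (cumVar (P.σ · i) (min (z.1 + v) P.T) -
      cumVar (P.σ · i) (min z.1 P.T)) := rfl
    have e3 : (P.renewal.shift i v z).2.2 = z.2.2 + (P.r i * min (z.1 + v) P.T -
      P.r i * min z.1 P.T) := rfl
    refine ⟨add_nonneg h1 hv.le, h2.trans h0.1, ?_, ?_, h5.trans h0.2, ?_⟩
    · rw [e1, e2]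
      linarith [hc.1]
    · rw [e1, e2]
      linarith [hc.2]
    · rw [e1, e3]
      linarith

lemma mem_box {T₁ a b t x : ℝ} (ht : 0 ≤ t) (htT : t ≤ T₁) (hT : T₁ ≤ P.T) (hx : x ∈ Icc a b) :
    (t, ((0:ℝ), x)) ∈ P.box T₁ a b := by
  have h1 : min t P.T = t := min_eq_left (htT.trans hT)
  have h2 := mul_nonneg P.S.coe_nonneg ht
  refine ⟨ht, le_rfl, ?_, ?_, hx.1, ?_⟩ <;> simp only [h1]
  · rw [zero_add]
    exact mul_le_mul_of_nonneg_left (by linarith) P.m_pos.le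
  · linarith
  · linarith [hx.2]

/-- On a box the smoothed prices coincide with smooth solutions of the renewal equation. -/
lemma IsPrice.exists_heatJet (H : P.IsPrice h M φ) {T₁ a b : ℝ} (hT : T₁ < P.T)
    (hab : a ≤ b) :
    ∃ Φ Φ₁ Φ₂ : Fin k → ℝ × (ℝ × ℝ) → ℝ, P.HeatJet (P.box T₁ a b) Φ Φ₁ Φ₂ ∧
      ∀ l, ∀ z ∈ P.box T₁ a b, Φ l z = P.smoothedPrice φ l z := by
  have hm : 0 < P.m * (P.T - T₁) := mul_pos P.m_pos (sub_pos.mpr hT)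
  have hend : ∀ z ∈ P.box T₁ a b, P.T ≤ z.1 → z.2.1 ∈ Icc (P.m * (P.T - T₁)) (P.S * P.T +
      P.m * (P.T - T₁)) ∧ z.2.2 ∈ Icc a (b + P.S * P.T) := by
    rintro z ⟨-, -, h3, h4, h5, h6⟩ hz
    rw [min_eq_right hz] at h3 h4 h6
    exact ⟨⟨by linarith, by linarith⟩, h5, by linarith⟩
  have hST := mul_nonneg P.S.coe_nonneg P.T_pos.le
  obtain ⟨f, hf, hfeq⟩ := exists_smoothCompact_eventuallyEq
    (fun n => contDiffOn_gaussSmooth H.h_cont H.h_le n) hm (le_add_of_nonneg_left hST)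
    (show a ≤ b + P.S * P.T by linarith)
  obtain ⟨Φ, hΦ, hΦr⟩ := P.renewal.exists_solvesOn_of_smoothCompact hf
  have hf₁ := hf.fderiv_apply (0, 1)
  have hf₂ := hf₁.fderiv_apply (0, 1)
  obtain ⟨Φ₁, hΦ₁, hΦ₁r⟩ := P.renewal.exists_solvesOn_of_smoothCompact hf₁
  obtain ⟨Φ₂, hΦ₂, hΦ₂r⟩ := P.renewal.exists_solvesOn_of_smoothCompact hf₂
  obtain ⟨Φ', hΦ', -⟩ := P.renewal.exists_solvesOn_of_smoothCompact (hf.fderiv_apply (1, 0))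
  have hsub : P.box T₁ a b ⊆ {z | 0 ≤ z.1} := fun z hz => hz.1
  refine ⟨Φ, Φ₁, Φ₂, ⟨hΦr, hΦ₁r, hΦ.bdd, hΦ₁.bdd, hΦ₂.bdd, hΦ₂r, ?_, ?_, ?_, ?_, ?_⟩, ?_⟩
  · intro l j z hz
    have h1 : z ∈ {z : ℝ × (ℝ × ℝ) | 0 ≤ z.1} := P.T_pos.le.trans hz
    rw [hΦ.terminal l z h1 hz, hΦ.terminal j z h1 hz]
  · intro l z hz
    have h1 : Φ l =ᶠ[𝓝 z] fun w => f w.2 := by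
      filter_upwards [(isOpen_lt continuous_const continuous_fst).mem_nhds hz] with w hw
      exact hΦ.terminal l w (P.T_pos.le.trans (le_of_lt hw)) (le_of_lt hw)
    have h2 : HasFDerivAt (fun w : ℝ × (ℝ × ℝ) => f w.2)
        ((fderiv ℝ f z.2).comp (ContinuousLinearMap.snd ℝ ℝ (ℝ × ℝ))) z :=
      (hf.contDiff.differentiable (by simp) z.2).hasFDerivAt.comp z hasFDerivAt_snd
    rw [h1.fderiv_eq, h2.fderiv]
    simp
  · exact fun l z hz hzT => hΦ.fderiv_space hf hΦ₁ (hΦr l) hz hzT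
  · exact fun l z hz hzT => hΦ₁.fderiv_space hf₁ hΦ₂ (hΦ₁r l) hz hzT
  · intro l z hzD hz hzT
    rw [hΦ.fderiv_space hf hΦ' (hΦr l) hz hzT]
    refine (hΦ'.mono hsub).eqOn (((hΦ₂.mono hsub).add (hΦ₁.mono hsub)).const_mul (1 / 2))
      (invariant_box T₁ a b) (fun w hw hwT => ?_) l z hzD
    have h1 := hfeq w.2 (hend w hw hwT).1 (hend w hw hwT).2
    have h2 : (fun b => fderiv ℝ f b (0, 1)) =ᶠ[𝓝 w.2]
        fun b => fderiv ℝ (gaussSmooth h) b (0, 1) :=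
      (h1.fderiv (𝕜 := ℝ)).mono fun b hb => DFunLike.congr_fun hb (0, 1)
    have h3 := gaussSmooth_heat H.h_cont H.h_le (hm.trans_le (hend w hw hwT).1.1)
    simp only [h1.fderiv_eq, h2.fderiv_eq]
    exact h3
  · intro l z hz
    refine (hΦ.mono hsub).eqOn (H.solvesOn (x₀ := a) (fun z hz => hz.1) (fun z hz => hz.2.1)
      fun z hz => hz.2.2.2.2.1) (invariant_box T₁ a b) (fun w hw hwT => ?_) l z hz
    exact (hfeq w.2 (hend w hw hwT).1 (hend w hw hwT).2).eq_of_nhds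

/-- Near a given time and log-price the price is given by `value`. -/
lemma IsPrice.eq_value (H : P.IsPrice h M φ) {T₁ a b : ℝ} (hT : T₁ < P.T)
    {Φ : Fin k → ℝ × (ℝ × ℝ) → ℝ} (hΦ : ∀ l, ∀ z ∈ P.box T₁ a b, Φ l z = P.smoothedPrice φ l z)
    (i : Fin k) {t x y : ℝ} (ht : t ∈ Icc 0 T₁) (hx : x ∈ Icc a b) (hy : y ∈ Icc 0 t) :
    φ t (Real.exp x) i y = Real.exp x * P.value Φ i (y, (t, (0, x))) := by
  have hmem := mem_box (P := P) ht.1 ht.2 hT.le hx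
  have hsh := fun v hv hv' => (invariant_box (P := P) T₁ a b).shift_mem i _ hmem v hv hv'
  rw [H.eq_kernel i x ⟨ht.1, ht.2.trans hT.le⟩ hy, value, hΦ i _ (hsh P.T P.T_pos le_rfl),
    H.smoothedPrice_of_ge i (le_add_of_nonneg_left ht.1), Real.exp_sub, Real.exp_neg]
  have h1 : ∀ l, ∫ v in (0:ℝ)..P.T, P.g i l (y + v) *
      P.smoothedPrice φ l (P.renewal.shift i v (t, (0, x))) =
      ∫ v in (0:ℝ)..P.T, P.g i l (y + v) * Φ l (P.renewal.shift i v (t, (0, x))) := fun l =>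
    RenewalData.kernel_integral_congr (R := P.renewal) (t := t) fun v hv hv' _ =>
      (hΦ l _ (hsh v hv hv')).symm
  simp only [h1]
  ring

lemma eq_renewed {T₁ a b : ℝ} (hT : T₁ < P.T)
    {Φ : Fin k → ℝ × (ℝ × ℝ) → ℝ} (hΦ : ∀ l, ∀ z ∈ P.box T₁ a b, Φ l z = P.smoothedPrice φ l z)
    (l : Fin k) {t x : ℝ} (ht : t ∈ Icc 0 T₁) (hx : x ∈ Icc a b) :
    φ t (Real.exp x) l 0 = Real.exp x * Φ l (t, (0, x)) := by
  rw [hΦ l _ (mem_box ht.1 ht.2 hT.le hx), smoothedPrice, gaussSmooth_zero, renewedPrice,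
    min_eq_left (ht.2.trans hT.le), max_eq_right ht.1, ← mul_assoc, ← Real.exp_add, add_neg_cancel,
    Real.exp_zero, one_mul]

end SemiMarkovMarket

namespace SemiMarkovMarket

variable {k : ℕ} {P : SemiMarkovMarket k} {φ : ℝ → ℝ → Fin k → ℝ → ℝ} {h : ℝ → ℝ} {M : ℝ}
  {Φ Φ₁ Φ₂ : Fin k → ℝ × (ℝ × ℝ) → ℝ}

lemma hasDerivAt_value_log (hΦ : ∀ l, P.renewal.Regular (Φ l))
    (hlog : ∀ l z, 0 < z.1 → z.1 ≠ P.T → fderiv ℝ (Φ l) z (0, (0, 1)) = Φ₁ l z) (i : Fin k)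
    {y t : ℝ} (hy : 0 < y) (ht : 0 < t) (htT : t ≠ P.T) (x : ℝ) :
    HasDerivAt (fun x => P.value Φ i (y, (t, (0, x)))) (P.value Φ₁ i (y, (t, (0, x)))) x := by
  have h1 : HasFDerivAt (fun z => P.value Φ i (y, z)) (P.valueFDeriv Φ i (y, (t, (0, x))))
      (t, (0, x)) := hasFDerivAt_value hΦ i hy ht htT
  have h2 : HasDerivAt (fun x : ℝ => (t, ((0:ℝ), x))) (0, (0, 1)) x :=
    (hasDerivAt_const x t).prodMk ((hasDerivAt_const x (0:ℝ)).prodMk (hasDerivAt_id x))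
  rw [← valueFDeriv_log hΦ hlog i hy ht htT]
  exact h1.comp_hasDerivAt x h2

lemma hasDerivAt_value_time (hΦ : ∀ l, P.renewal.Regular (Φ l)) (i : Fin k)
    {y t : ℝ} (hy : 0 < y) (ht : 0 < t) (htT : t ≠ P.T) (x : ℝ) :
    HasDerivAt (fun t => P.value Φ i (y, (t, (0, x))))
      (P.valueFDeriv Φ i (y, (t, (0, x))) (1, 0)) t := by
  have h1 : HasFDerivAt (fun z => P.value Φ i (y, z)) (P.valueFDeriv Φ i (y, (t, (0, x))))
      (t, (0, x)) := hasFDerivAt_value hΦ i hy ht htT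
  have h2 : HasDerivAt (fun t : ℝ => (t, ((0:ℝ), x))) (1, 0) t :=
    (hasDerivAt_id t).prodMk (hasDerivAt_const t ((0:ℝ), x))
  exact h1.comp_hasDerivAt t h2

/-- The arguments of `value` at time `p.1`, price `p.2.1` and elapsed time `p.2.2`. -/
noncomputable def logPoint (p : ℝ × ℝ × ℝ) : ℝ × (ℝ × (ℝ × ℝ)) :=
  (p.2.2, (p.1, (0, Real.log p.2.1)))

lemma continuousAt_logPoint {p : ℝ × ℝ × ℝ} (hp : 0 < p.2.1) : ContinuousAt logPoint p :=
  continuousAt_snd.snd.prodMk (continuousAt_fst.prodMk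
    (continuousAt_const.prodMk (continuousAt_snd.fst.log hp.ne')))

namespace IsPrice

section Derivatives

variable {T₁ a b t s y : ℝ}

lemma eq_mul_value_logPoint (H : P.IsPrice h M φ) (hT : T₁ < P.T)
    (hΦ : ∀ l, ∀ z ∈ P.box T₁ a b, Φ l z = P.smoothedPrice φ l z) (i : Fin k)
    (ht : t ∈ Icc 0 T₁) (hs : 0 < s) (hsab : Real.log s ∈ Icc a b) (hy : y ∈ Icc 0 t) :
    φ t s i y = s * P.value Φ i (logPoint (t, s, y)) := by
  have := H.eq_value hT hΦ i ht hsab hy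
  rwa [Real.exp_log hs] at this

lemma hasDerivAt_time (H : P.IsPrice h M φ) (hT : T₁ < P.T)
    (J : P.HeatJet (P.box T₁ a b) Φ Φ₁ Φ₂)
    (hΦ : ∀ l, ∀ z ∈ P.box T₁ a b, Φ l z = P.smoothedPrice φ l z) (i : Fin k)
    (ht : t ∈ Ioo 0 T₁) (hs : 0 < s) (hsab : Real.log s ∈ Ioo a b) (hy : y ∈ Ioo 0 t) :
    HasDerivAt (fun u => φ u s i y) (s * P.valueFDeriv Φ i (logPoint (t, s, y)) (1, 0)) t := by
  refine ((hasDerivAt_value_time J.regular i hy.1 ht.1 (ht.2.trans hT).ne _).const_mul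
    s).congr_of_eventuallyEq ?_
  filter_upwards [Ioo_mem_nhds ht.1 ht.2, lt_mem_nhds hy.2] with u hu hyu
  exact H.eq_mul_value_logPoint hT hΦ i (Ioo_subset_Icc_self hu) hs (Ioo_subset_Icc_self hsab)
    ⟨hy.1.le, hyu.le⟩

lemma hasDerivAt_duration (H : P.IsPrice h M φ) (hT : T₁ < P.T)
    (J : P.HeatJet (P.box T₁ a b) Φ Φ₁ Φ₂)
    (hΦ : ∀ l, ∀ z ∈ P.box T₁ a b, Φ l z = P.smoothedPrice φ l z) (i : Fin k)
    (ht : t ∈ Ioo 0 T₁) (hs : 0 < s) (hsab : Real.log s ∈ Ioo a b) (hy : y ∈ Ioo 0 t) :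
    HasDerivAt (fun w => φ t s i w) (s * P.valueDelayDeriv Φ i (logPoint (t, s, y))) y := by
  refine ((hasDerivAt_value_delay J.regular i hy.1 (z := (t, ((0:ℝ), Real.log s))) ht.1).const_mul
    s).congr_of_eventuallyEq ?_
  filter_upwards [Ioo_mem_nhds hy.1 hy.2] with w hw
  exact H.eq_mul_value_logPoint hT hΦ i (Ioo_subset_Icc_self ht) hs (Ioo_subset_Icc_self hsab)
    (Ioo_subset_Icc_self hw)

lemma hasDerivAt_price (H : P.IsPrice h M φ) (hT : T₁ < P.T)
    (J : P.HeatJet (P.box T₁ a b) Φ Φ₁ Φ₂)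
    (hΦ : ∀ l, ∀ z ∈ P.box T₁ a b, Φ l z = P.smoothedPrice φ l z) (i : Fin k)
    (ht : t ∈ Ioo 0 T₁) (hs : 0 < s) (hsab : Real.log s ∈ Ioo a b) (hy : y ∈ Ioo 0 t) :
    HasDerivAt (fun x => φ t x i y) (P.value Φ i (logPoint (t, s, y)) +
      P.value Φ₁ i (logPoint (t, s, y))) s := by
  have h1 := hasDerivAt_mul_comp_log (m := 0) (f := fun x => P.value Φ i (y, (t, (0, x))))
    (f' := fun x => P.value Φ₁ i (y, (t, (0, x)))) hs
    (hasDerivAt_value_log J.regular J.fderiv_log i hy.1 ht.1 (ht.2.trans hT).ne _)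
  simp only [add_zero] at h1
  refine h1.congr_of_eventuallyEq ?_
  filter_upwards [lt_mem_nhds hs,
    (Real.continuousAt_log hs.ne').eventually (Ioo_mem_nhds hsab.1 hsab.2)] with x hx hxab
  exact H.eq_mul_value_logPoint hT hΦ i (Ioo_subset_Icc_self ht) hx (Ioo_subset_Icc_self hxab)
    (Ioo_subset_Icc_self hy)

lemma hasDerivAt_deriv_price (H : P.IsPrice h M φ) (hT : T₁ < P.T)
    (J : P.HeatJet (P.box T₁ a b) Φ Φ₁ Φ₂)
    (hΦ : ∀ l, ∀ z ∈ P.box T₁ a b, Φ l z = P.smoothedPrice φ l z) (i : Fin k)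
    (ht : t ∈ Ioo 0 T₁) (hs : 0 < s) (hsab : Real.log s ∈ Ioo a b) (hy : y ∈ Ioo 0 t) :
    HasDerivAt (deriv fun x => φ t x i y) ((P.value Φ₁ i (logPoint (t, s, y)) +
      P.value Φ₂ i (logPoint (t, s, y))) / s) s := by
  have h1 := hasDerivAt_add_comp_log (m := 0) (f := fun x => P.value Φ i (y, (t, (0, x))))
    (g := fun x => P.value Φ₁ i (y, (t, (0, x)))) hs
    (hasDerivAt_value_log J.regular J.fderiv_log i hy.1 ht.1 (ht.2.trans hT).ne _)
    (hasDerivAt_value_log J.regular₁ J.fderiv_log₁ i hy.1 ht.1 (ht.2.trans hT).ne _)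
  simp only [add_zero] at h1
  refine h1.congr_of_eventuallyEq ?_
  filter_upwards [lt_mem_nhds hs,
    (Real.continuousAt_log hs.ne').eventually (Ioo_mem_nhds hsab.1 hsab.2)] with x hx hxab
  exact (H.hasDerivAt_price hT J hΦ i ht hx hxab hy).deriv

lemma backward_eq (H : P.IsPrice h M φ) (hT : T₁ < P.T)
    (J : P.HeatJet (P.box T₁ a b) Φ Φ₁ Φ₂)
    (hΦ : ∀ l, ∀ z ∈ P.box T₁ a b, Φ l z = P.smoothedPrice φ l z) (i : Fin k)
    (ht : t ∈ Ioo 0 T₁) (hs : 0 < s) (hsab : Real.log s ∈ Ioo a b) (hy : y ∈ Ioo 0 t) :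
    s * P.valueFDeriv Φ i (logPoint (t, s, y)) (1, 0) +
      s * P.valueDelayDeriv Φ i (logPoint (t, s, y)) +
      P.r i * s * (P.value Φ i (logPoint (t, s, y)) + P.value Φ₁ i (logPoint (t, s, y))) +
      1 / 2 * P.σ t i ^ 2 * s ^ 2 * ((P.value Φ₁ i (logPoint (t, s, y)) +
        P.value Φ₂ i (logPoint (t, s, y))) / s) +
      ∑ j ∈ Finset.univ.filter (fun j => j ≠ i), P.lam i j y * (φ t s j 0 - φ t s i y) =
      P.r i * φ t s i y := by
  have htT := ht.2.trans hT
  have hmem := mem_box (P := P) ht.1.le ht.2.le hT.le (Ioo_subset_Icc_self hsab)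
  have h1 := J.backward_eq i hy.1 (z := (t, ((0:ℝ), Real.log s))) ht.1 htT fun v hv hv' =>
    (invariant_box (P := P) T₁ a b).shift_mem i _ hmem v hv hv'
  have h2 : ∀ j, φ t s j 0 = s * Φ j (t, (0, Real.log s)) := by
    intro j
    have := eq_renewed hT hΦ j (Ioo_subset_Icc_self ht) (Ioo_subset_Icc_self hsab)
    rwa [Real.exp_log hs] at this
  have h3 := H.eq_mul_value_logPoint hT hΦ i (Ioo_subset_Icc_self ht) hs (Ioo_subset_Icc_self hsab)
    (Ioo_subset_Icc_self hy)
  have h4 : ∑ j ∈ Finset.univ.filter (fun j => j ≠ i), P.lam i j y * (φ t s j 0 - φ t s i y) =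
      s * ∑ j ∈ Finset.univ.filter (fun j => j ≠ i),
        P.lam i j y * (Φ j (t, (0, Real.log s)) - P.value Φ i (logPoint (t, s, y))) := by
    rw [Finset.mul_sum]
    refine Finset.sum_congr rfl fun j _ => ?_
    rw [h2, h3]
    ring
  rw [h4, h3]
  have h5 : s ^ 2 * ((P.value Φ₁ i (logPoint (t, s, y)) + P.value Φ₂ i (logPoint (t, s, y))) / s) =
      s * (P.value Φ₁ i (logPoint (t, s, y)) + P.value Φ₂ i (logPoint (t, s, y))) := by
    field_simp
  simp only [logPoint] at h1 h5 ⊢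
  linear_combination s * h1 + 1 / 2 * P.σ t i ^ 2 * h5

end Derivatives

/-- The price is a classical solution of the backward equation: near every interior point its
derivatives are given by continuous functions satisfying the equation. -/
theorem exists_derivatives (H : P.IsPrice h M φ) (i : Fin k) {p : ℝ × ℝ × ℝ}
    (hp : memD P.T p.1 p.2.1 p.2.2) :
    ∃ A B C D : ℝ × ℝ × ℝ → ℝ,
      (ContinuousAt A p ∧ ContinuousAt B p ∧ ContinuousAt C p ∧ ContinuousAt D p) ∧
      (∀ᶠ q in 𝓝 p, HasDerivAt (fun u => φ u q.2.1 i q.2.2) (A q) q.1 ∧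
        HasDerivAt (fun x => φ q.1 x i q.2.2) (B q) q.2.1 ∧
        HasDerivAt (deriv fun x => φ q.1 x i q.2.2) (C q) q.2.1 ∧
        HasDerivAt (fun w => φ q.1 q.2.1 i w) (D q) q.2.2) ∧
      A p + D p + P.r i * p.2.1 * B p + 1 / 2 * P.σ p.1 i ^ 2 * p.2.1 ^ 2 * C p +
        ∑ j ∈ Finset.univ.filter (fun j => j ≠ i),
          P.lam i j p.2.2 * (φ p.1 p.2.1 j 0 - φ p.1 p.2.1 i p.2.2) =
        P.r i * φ p.1 p.2.1 i p.2.2 := by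
  obtain ⟨ht, hs, hy⟩ := hp
  have hs : 0 < p.2.1 := hs
  obtain ⟨T₁, htT₁, hT₁⟩ := exists_between ht.2
  obtain ⟨Φ, Φ₁, Φ₂, J, hΦ⟩ := H.exists_heatJet (a := Real.log p.2.1 - 1)
    (b := Real.log p.2.1 + 1) hT₁ (by linarith)
  have hc := continuousAt_logPoint hs
  have hz0 : 0 < (logPoint p).2.1 := ht.1
  have hzT : (logPoint p).2.1 ≠ P.T := ht.2.ne
  have hsnd : ContinuousAt (fun q : ℝ × ℝ × ℝ => q.2.1) p := by fun_prop
  have hv : ContinuousAt (fun q => P.value Φ i (logPoint q)) p :=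
    (continuousAt_value J.regular J.bdd i hy.1 hz0 hzT).comp hc
  have hv₁ : ContinuousAt (fun q => P.value Φ₁ i (logPoint q)) p :=
    (continuousAt_value J.regular₁ J.bdd₁ i hy.1 hz0 hzT).comp hc
  have hv₂ : ContinuousAt (fun q => P.value Φ₂ i (logPoint q)) p :=
    (continuousAt_value J.regular₂ J.bdd₂ i hy.1 hz0 hzT).comp hc
  have hvt : ContinuousAt (fun q => P.valueFDeriv Φ i (logPoint q) (1, 0)) p :=
    (ContinuousAt.comp (g := P.valueFDeriv Φ i)
      (continuousAt_valueFDeriv J.regular i hy.1 hz0 hzT) hc).clm_apply continuousAt_const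
  have hvy : ContinuousAt (fun q => P.valueDelayDeriv Φ i (logPoint q)) p :=
    (continuousAt_valueDelayDeriv J.regular J.bdd i hy.1 hz0 hzT).comp hc
  refine ⟨fun q => q.2.1 * P.valueFDeriv Φ i (logPoint q) (1, 0),
    fun q => P.value Φ i (logPoint q) + P.value Φ₁ i (logPoint q),
    fun q => (P.value Φ₁ i (logPoint q) + P.value Φ₂ i (logPoint q)) / q.2.1,
    fun q => q.2.1 * P.valueDelayDeriv Φ i (logPoint q),
    ⟨hsnd.mul hvt, hv.add hv₁, (hv₁.add hv₂).div hsnd hs.ne', hsnd.mul hvy⟩, ?_, ?_⟩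
  · have hlog : ContinuousAt (fun q : ℝ × ℝ × ℝ => Real.log q.2.1) p := hsnd.log hs.ne'
    filter_upwards [continuousAt_fst.eventually (Ioo_mem_nhds ht.1 htT₁),
      hsnd.eventually (lt_mem_nhds hs),
      hlog.eventually (Ioo_mem_nhds (sub_one_lt _) (lt_add_one _)),
      continuousAt_snd.snd.eventually (lt_mem_nhds hy.1),
      continuousAt_snd.snd.eventually_lt continuousAt_fst hy.2] with q h1 h2 h3 h4 h5
    exact ⟨H.hasDerivAt_time hT₁ J hΦ i h1 h2 h3 ⟨h4, h5⟩,
      H.hasDerivAt_price hT₁ J hΦ i h1 h2 h3 ⟨h4, h5⟩,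
      H.hasDerivAt_deriv_price hT₁ J hΦ i h1 h2 h3 ⟨h4, h5⟩,
      H.hasDerivAt_duration hT₁ J hΦ i h1 h2 h3 ⟨h4, h5⟩⟩
  · exact H.backward_eq hT₁ J hΦ i ⟨ht.1, htT₁⟩ hs ⟨sub_one_lt _, lt_add_one _⟩ hy

end IsPrice

end SemiMarkovMarket

lemma Aop_terminal {k : ℕ} (lam : Fin k → Fin k → ℝ → ℝ) (r : Fin k → ℝ) (σ : ℝ → Fin k → ℝ)
    (ρ : Fin k → ℝ → ℝ → ℝ) (T : ℝ) (φ : ℝ → ℝ → Fin k → ℝ → ℝ) (s : ℝ) (i : Fin k) (y : ℝ) :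
    Aop lam r σ ρ T φ T s i y = ρ i T s := by
  simp [(Real.exp_pos _).ne', Aop, Fcdf]

/-- A continuous positive function of time, for finitely many regimes, is bounded away from zero
and bounded above on `[0, T]`. -/
lemma exists_bounds_Icc {k : ℕ} {f : ℝ → Fin k → ℝ} {T : ℝ}
    (hf : ∀ i, ContinuousOn (fun u => f u i) (Icc 0 T)) (hpos : ∀ u ∈ Icc 0 T, ∀ i, 0 < f u i) :
    ∃ m > 0, ∃ S, ∀ u ∈ Icc 0 T, ∀ i, m ≤ f u i ∧ f u i ≤ S := by
  have hlow : ∀ i, ∃ a > 0, ∀ u ∈ Icc 0 T, a ≤ f u i := fun i =>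
    isCompact_Icc.exists_forall_le' (hf i) fun u hu => hpos u hu i
  have hup : ∀ i, ∃ b, ∀ u ∈ Icc 0 T, f u i ≤ b := fun i =>
    (isCompact_Icc.bddAbove_image (hf i)).imp fun b hb u hu => hb (mem_image_of_mem _ hu)
  choose a ha ha' using hlow
  choose b hb using hup
  obtain ⟨S, hS⟩ := Finite.exists_le b
  obtain ⟨R, hR⟩ := Finite.exists_le fun i => (a i)⁻¹
  refine ⟨(max R 1)⁻¹, by positivity, S, fun u hu i => ⟨?_, (hb i u hu).trans (hS i)⟩⟩
  exact (inv_le_of_inv_le₀ (ha i) ((hR i).trans (le_max_left R 1))).trans (ha' i u hu)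

/-- A `memB` solution of the integral equation is a price for the corresponding market. -/
lemma SemiMarkovMarket.isPrice_of_eq_Aop {k : ℕ} (P : SemiMarkovMarket k) {K : ℝ → ℝ}
    (hKcont : ContinuousOn K (Ici 0)) {k₁ k₂ : ℝ} (hk₁ : 0 < k₁) (hk₂ : 0 < k₂)
    (hK : ∀ s, 0 ≤ s → 0 ≤ K s ∧ K s ≤ k₁ + k₂ * s) {ρ : Fin k → ℝ → ℝ → ℝ}
    (hρ : isBSMSolution P.r P.σ K P.T ρ) {φ : ℝ → ℝ → Fin k → ℝ → ℝ} (hφB : memB P.T φ)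
    (hφIE : ∀ t s y, memDbar P.T t s y → ∀ i, φ t s i y = Aop P.lam P.r P.σ ρ P.T φ t s i y) :
    ∃ M, P.IsPrice (fun u => K (Real.exp u)) M φ := by
  obtain ⟨hcont, M, hM⟩ := hφB
  have hKc : Continuous fun u => K (Real.exp u) :=
    hKcont.comp_continuous Real.continuous_exp fun u => (Real.exp_pos u).le
  have hKle : ∀ u, |K (Real.exp u)| ≤ (k₁ + k₂) * (1 + Real.exp u) := by
    intro u
    have hu := Real.exp_pos u
    obtain ⟨h0, h1⟩ := hK _ hu.le
    rw [abs_of_nonneg h0]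
    nlinarith
  have hbsm : ∀ i, ∀ t ∈ Icc 0 P.T, ∀ s, 0 < s → ρ i t s =
      s * gaussSmooth (fun u => K (Real.exp u))
        (cumVar (P.σ · i) P.T - cumVar (P.σ · i) t, Real.log s + P.r i * (P.T - t)) := by
    intro i t ht s hs
    obtain ⟨h1, h2, ⟨M', hM'⟩, h3, h4⟩ := hρ i
    refine bsm_eq_gaussSmooth (M' := M') P.T_pos (P.r_nonneg i) (P.σ_cont i)
      (fun u hu => P.σ_pos u hu i) hKc hKle
      (h1.mono (prod_mono_right Ioi_subset_Ici_self)) ?_ ?_ (fun t ht s hs => (h3 t ht s hs).1.1)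
      (fun t ht s hs => (h3 t ht s hs).1.2.1) (fun t ht s hs => (h3 t ht s hs).1.2.2)
      (fun t ht s hs => (h3 t ht s hs).2) ht hs
    · intro t ht s hs
      rw [abs_of_nonneg (h2 t ht s (mem_Ici.mpr hs.le))]
      exact hM' t ht s (mem_Ici.mpr hs.le)
    · intro s hs
      rw [Real.exp_log hs]
      exact h4 s (mem_Ici.mpr hs.le)
  refine ⟨max M (k₁ + k₂), hKc, fun u => (hKle u).trans ?_, hcont, fun t s y h i =>
    (hM t s y h i).trans ?_, fun i x => ?_, fun t x y ht hy i => ?_⟩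
  · have := Real.exp_pos u
    gcongr
    exact le_max_right M _
  · have : 0 ≤ s := h.2.1
    gcongr
    exact le_max_left M _
  · rw [hφIE _ _ _ ⟨right_mem_Icc.mpr P.T_pos.le, mem_Ici.mpr (Real.exp_pos x).le,
      left_mem_Icc.mpr P.T_pos.le⟩, Aop_terminal]
    exact (hρ i).2.2.2.2 _ (mem_Ici.mpr (Real.exp_pos x).le)
  · rw [hφIE _ _ _ ⟨ht, mem_Ici.mpr (Real.exp_pos x).le, hy⟩]
    simp only [Aop]
    rw [hbsm i t ht _ (Real.exp_pos x)]

theorem stmt_12 {k : ℕ} (lam : Fin k → Fin k → ℝ → ℝ)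
    (hmeas : ∀ i j : Fin k, i ≠ j → Measurable (lam i j))
    (hnn : ∀ i j : Fin k, i ≠ j → ∀ y : ℝ, 0 < y → 0 ≤ lam i j y)
    (c : ℝ) (hc : 0 < c)
    (hbound : ∀ i : Fin k, ∀ y : ℝ, 0 < y → sumLam lam i y ≤ c)
    (hinf : ∀ i : Fin k, Tendsto (Lambda lam i) atTop atTop)
    (r : Fin k → ℝ) (hr : ∀ i : Fin k, 0 ≤ r i)
    (σ : ℝ → Fin k → ℝ)
    (hσpos : ∀ u : ℝ, 0 ≤ u → ∀ i : Fin k, 0 < σ u i)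
    (hσcont : ∀ i : Fin k, ContinuousOn (fun u => σ u i) (Set.Ici 0))
    (T : ℝ) (hT : 0 < T)
    (K : ℝ → ℝ) (hKcont : ContinuousOn K (Set.Ici 0))
    (k₁ k₂ : ℝ) (hk₁ : 0 < k₁) (hk₂ : 0 < k₂)
    (hK : ∀ s : ℝ, 0 ≤ s → 0 ≤ K s ∧ K s ≤ k₁ + k₂ * s)
    (ρ : Fin k → ℝ → ℝ → ℝ) (hρ : isBSMSolution r σ K T ρ)
    (hdiff : ∀ i j : Fin k, i ≠ j → ∀ y : ℝ, 0 < y → DifferentiableAt ℝ (lam i j) y)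
    (φ : ℝ → ℝ → Fin k → ℝ → ℝ)
    (hφB : memB T φ)
    (hφIE : ∀ t s y : ℝ, memDbar T t s y → ∀ i : Fin k,
      φ t s i y = Aop lam r σ ρ T φ t s i y) :
    -- φ is of class C^{1,2,1} on D :
    (∀ i : Fin k, ∀ t s y : ℝ, memD T t s y →
      DifferentiableAt ℝ (fun u => φ u s i y) t ∧
      DifferentiableAt ℝ (fun x => φ t x i y) s ∧
      DifferentiableAt ℝ (deriv (fun x => φ t x i y)) s ∧
      DifferentiableAt ℝ (fun w => φ t s i w) y) ∧
    (∀ i : Fin k,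
      ContinuousOn (fun p : ℝ × ℝ × ℝ => deriv (fun u => φ u p.2.1 i p.2.2) p.1)
        {p : ℝ × ℝ × ℝ | memD T p.1 p.2.1 p.2.2} ∧
      ContinuousOn (fun p : ℝ × ℝ × ℝ => deriv (fun x => φ p.1 x i p.2.2) p.2.1)
        {p : ℝ × ℝ × ℝ | memD T p.1 p.2.1 p.2.2} ∧
      ContinuousOn (fun p : ℝ × ℝ × ℝ => deriv (deriv (fun x => φ p.1 x i p.2.2)) p.2.1)
        {p : ℝ × ℝ × ℝ | memD T p.1 p.2.1 p.2.2} ∧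
      ContinuousOn (fun p : ℝ × ℝ × ℝ => deriv (fun w => φ p.1 p.2.1 i w) p.2.2)
        {p : ℝ × ℝ × ℝ | memD T p.1 p.2.1 p.2.2}) ∧
    -- φ solves the PDE (P) on D :
    (∀ i : Fin k, ∀ t s y : ℝ, memD T t s y →
      deriv (fun u => φ u s i y) t + deriv (fun w => φ t s i w) y
        + r i * s * deriv (fun x => φ t x i y) s
        + (1/2) * (σ t i)^2 * s^2 * deriv (deriv (fun x => φ t x i y)) s
        + ∑ j ∈ Finset.univ.filter (fun j => j ≠ i),
            lam i j y * (φ t s j 0 - φ t s i y)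
        = r i * φ t s i y) ∧
    -- terminal condition :
    (∀ i : Fin k, ∀ s : ℝ, 0 < s → ∀ y ∈ Set.Icc (0:ℝ) T, φ T s i y = K s) := by
  obtain ⟨m, hm, S, hmS⟩ := exists_bounds_Icc (f := fun u i => σ u i ^ 2) (T := T)
    (fun i => ((hσcont i).mono Icc_subset_Ici_self).pow 2) fun u hu i => pow_pos (hσpos u hu.1 i) 2
  obtain ⟨R, hR⟩ := Finite.exists_le r
  let P : SemiMarkovMarket k :=
    { lam := lam
      lam_meas := hmeas
      lam_nonneg := hnn
      lam_cont := fun i j hij y hy => (hdiff i j hij y hy).continuousAt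
      c := c
      c_pos := hc
      sumLam_le := hbound
      r := r
      r_nonneg := hr
      σ := σ
      σ_pos := hσpos
      σ_cont := hσcont
      T := T
      T_pos := hT
      m := m
      m_pos := hm
      S := (max S R).toNNReal
      m_le := fun u hu i => (hmS u hu i).1
      le_S := fun u hu i =>
        ((hmS u hu i).2.trans (le_max_left S R)).trans (Real.le_coe_toNNReal _)
      r_le := fun i => ((hR i).trans (le_max_right S R)).trans (Real.le_coe_toNNReal _) }
  obtain ⟨M, H⟩ := P.isPrice_of_eq_Aop hKcont hk₁ hk₂ hK hρ hφB hφIE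
  refine ⟨fun i t s y hp => ?_, fun i => ⟨?_, ?_, ?_, ?_⟩, fun i t s y hp => ?_,
    fun i s hs y hy => ?_⟩
  · obtain ⟨A, B, C, D, -, hABCD, -⟩ := H.exists_derivatives i (p := (t, s, y)) hp
    obtain ⟨hA, hB, hC, hD⟩ := hABCD.self_of_nhds
    exact ⟨hA.differentiableAt, hB.differentiableAt, hC.differentiableAt, hD.differentiableAt⟩
  · intro p hp
    obtain ⟨A, B, C, D, hc, hABCD, -⟩ := H.exists_derivatives i hp
    exact (hc.1.congr (hABCD.mono fun q hq => hq.1.deriv.symm)).continuousWithinAt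
  · intro p hp
    obtain ⟨A, B, C, D, hc, hABCD, -⟩ := H.exists_derivatives i hp
    exact (hc.2.1.congr (hABCD.mono fun q hq => hq.2.1.deriv.symm)).continuousWithinAt
  · intro p hp
    obtain ⟨A, B, C, D, hc, hABCD, -⟩ := H.exists_derivatives i hp
    exact (hc.2.2.1.congr (hABCD.mono fun q hq => hq.2.2.1.deriv.symm)).continuousWithinAt
  · intro p hp
    obtain ⟨A, B, C, D, hc, hABCD, -⟩ := H.exists_derivatives i hp
    exact (hc.2.2.2.congr (hABCD.mono fun q hq => hq.2.2.2.deriv.symm)).continuousWithinAt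
  · obtain ⟨A, B, C, D, -, hABCD, heq⟩ := H.exists_derivatives i (p := (t, s, y)) hp
    obtain ⟨hA, hB, hC, hD⟩ := hABCD.self_of_nhds
    rw [hA.deriv, hB.deriv, hC.deriv, hD.deriv]
    exact heq
  · rw [hφIE T s y ⟨right_mem_Icc.mpr hT.le, mem_Ici.mpr hs.le, hy⟩, Aop_terminal]
    exact (hρ i).2.2.2.2 s (mem_Ici.mpr hs.le)
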